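/- Let Ω₀ ⊂ ℝⁿ be a bounded C^{1,1} domain. There exists r₀ = r₀(Ω₀) > 0 such that for every r < r₀/16 there exist constants c₁ > 0 and C₂ > 0, depending only on n, r, diam(Ω₀) and the C^{1,1} character of Ω₀, with the following property: for every u ∈ C²(Ω₀) ∩ C¹(Ω̄₀) with Δu + λu = 0 in Ω₀, ∂u/∂ν₀ = 0 on ∂Ω₀, and normalized so that max_{Ω̄₀} |u| = 1, the harmonic extension h(x,t) = e^{√λ t} u(x) on Ω = Ω₀ × ℝ satisfies, for every y ∈ Ω̄₀, sup_{B((y,0), r/2) ∩ Ω} |h| ≥ c₁ e^{−C₂ √λ}, where B((y,0), r/2) is the ball in ℝ^{n+1} centred at (y,0). -/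

import Mathlib

noncomputable section

open MeasureTheory Metric Set Filter Asymptotics
open scoped Topology NNReal ENNReal RealInnerProductSpace

namespace NodalNeumann

/-- Euclidean space `ℝⁿ`. -/
abbrev Euc (n : ℕ) : Type := EuclideanSpace ℝ (Fin n)

/-- The first `n` coordinates `y'` of a point `y = (y', y'') ∈ ℝ^{n+1}`. -/
def front {n : ℕ} (y : Euc (n + 1)) : Euc n :=
  (EuclideanSpace.equiv (Fin n) ℝ).symm fun i => y i.castSucc

/-- The last coordinate `y''` of a point `y = (y', y'') ∈ ℝ^{n+1}`. -/
def lastc {n : ℕ} (y : Euc (n + 1)) : ℝ := y (Fin.last n)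

/-- `(v, a) ∈ ℝ^{n+1}` built from `v ∈ ℝⁿ` and `a ∈ ℝ`. -/
def snocVec {n : ℕ} (v : Euc n) (a : ℝ) : Euc (n + 1) :=
  (EuclideanSpace.equiv (Fin (n + 1)) ℝ).symm
    fun i => if h : i = Fin.last n then a else v (i.castPred h)

/-- The Laplacian of `u : ℝⁿ → ℝ`. -/
def laplacian {n : ℕ} (u : Euc n → ℝ) (x : Euc n) : ℝ :=
  ∑ i : Fin n, fderiv ℝ (fun y => fderiv ℝ u y (EuclideanSpace.single i 1)) x
    (EuclideanSpace.single i 1)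

/-- `u` is harmonic on `s`. -/
def HarmonicOn {n : ℕ} (u : Euc n → ℝ) (s : Set (Euc n)) : Prop :=
  ContDiffOn ℝ 2 u s ∧ ∀ x ∈ s, laplacian u x = 0

/-- `ν` is the outward unit normal vector of `Ω` at the boundary point `x`:
it is a unit vector, points out of `Ω`, `-ν` points into `Ω`, and it is
orthogonal to the boundary at `x` (in the little-o sense). -/
def OutwardNormalAt {n : ℕ} (Ω : Set (Euc n)) (x ν : Euc n) : Prop :=
  ‖ν‖ = 1 ∧
  (∀ᶠ t : ℝ in 𝓝[>] (0 : ℝ), x + t • ν ∉ closure Ω) ∧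
  (∀ᶠ t : ℝ in 𝓝[>] (0 : ℝ), x - t • ν ∈ Ω) ∧
  (fun y : Euc n => (⟪ν, y - x⟫)) =o[𝓝[frontier Ω] x] fun y => ‖y - x‖

/-- `ν` is an outward unit normal field of `Ω` along `∂Ω ∩ s`. -/
def OutwardNormalFieldOn {n : ℕ} (Ω : Set (Euc n)) (ν : Euc n → Euc n)
    (s : Set (Euc n)) : Prop :=
  ∀ x ∈ frontier Ω ∩ s, OutwardNormalAt Ω x (ν x)

/-- The homogeneous Neumann boundary condition `∂h/∂ν = 0` on `∂Ω ∩ s`. -/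
def NeumannBC {n : ℕ} (Ω : Set (Euc n)) (ν : Euc n → Euc n) (h : Euc n → ℝ)
    (s : Set (Euc n)) : Prop :=
  ∀ x ∈ frontier Ω ∩ s, DifferentiableWithinAt ℝ h (closure Ω) x ∧
    fderivWithin ℝ h (closure Ω) x (ν x) = 0

/-- `f : ℝⁿ → ℝ` is `C^{1,1}` with character `M`: differentiable with `M`-Lipschitz
derivative (and itself `M`-Lipschitz). -/
def IsC11FunWith {n : ℕ} (M : ℝ≥0) (f : Euc n → ℝ) : Prop :=
  Differentiable ℝ f ∧ LipschitzWith M f ∧ LipschitzWith M fun x => fderiv ℝ f x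

/-- `Ω ∩ B(x,r)` is, after an isometry `T` of `ℝ^{n+1}` with `T 0 = x`, the region
in the ball above the graph of a function `f` with `f 0 = 0` satisfying `P`. -/
def IsGraphBall {n : ℕ} (Ω : Set (Euc (n + 1))) (x : Euc (n + 1)) (r : ℝ)
    (P : (Euc n → ℝ) → Prop) : Prop :=
  ∃ (T : Euc (n + 1) ≃ᵃⁱ[ℝ] Euc (n + 1)) (f : Euc n → ℝ), P f ∧ T 0 = x ∧ f 0 = 0 ∧
    Ω ∩ ball x r =
      ⇑T '' {y : Euc (n + 1) | y ∈ ball (0 : Euc (n + 1)) r ∧ f (front y) < lastc y}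

/-- `∂Ω ∩ B(x,r) ∈ Lip(τ)`. -/
def LipGraphBall {n : ℕ} (Ω : Set (Euc (n + 1))) (x : Euc (n + 1)) (r τ : ℝ) : Prop :=
  IsGraphBall Ω x r fun f => LipschitzWith (Real.toNNReal τ) f

/-- `Ω` is a `C^{1,1}` domain with character `(ρ, M)`. -/
def IsC11DomainWith {n : ℕ} (Ω : Set (Euc (n + 1))) (ρ : ℝ) (M : ℝ≥0) : Prop :=
  IsOpen Ω ∧ IsConnected Ω ∧ 0 < ρ ∧
    ∀ x ∈ frontier Ω, IsGraphBall Ω x ρ (IsC11FunWith M)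

/-- `Ω` is a `C^{1,1}` domain. -/
def IsC11Domain {n : ℕ} (Ω : Set (Euc (n + 1))) : Prop :=
  ∃ (ρ : ℝ) (M : ℝ≥0), IsC11DomainWith Ω ρ M

/-- `Ω` is a Lipschitz domain with character `(ρ, M)`. -/
def IsLipDomainWith {n : ℕ} (Ω : Set (Euc (n + 1))) (ρ : ℝ) (M : ℝ≥0) : Prop :=
  IsOpen Ω ∧ IsConnected Ω ∧ 0 < ρ ∧
    ∀ x ∈ frontier Ω, IsGraphBall Ω x ρ fun f => LipschitzWith M f

/-- The portion `∂Ω ∩ s` of the boundary has `C^{1,1}` character `(ρ, M)`. -/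
def HasC11CharacterOn {n : ℕ} (Ω : Set (Euc (n + 1))) (s : Set (Euc (n + 1)))
    (ρ : ℝ) (M : ℝ≥0) : Prop :=
  0 < ρ ∧ ∀ x ∈ frontier Ω ∩ s, IsGraphBall Ω x ρ (IsC11FunWith M)

/-- `H_h(x,r) = ∫_{B(x,r) ∩ Ω} h²`. -/
def Hfun {n : ℕ} (Ω : Set (Euc n)) (h : Euc n → ℝ) (x : Euc n) (r : ℝ) : ℝ :=
  ∫ y in ball x r ∩ Ω, h y ^ 2

/-- The doubling index `N_h(x,r) = log (H_h(x,2r) / H_h(x,r))`. -/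
def Nfun {n : ℕ} (Ω : Set (Euc n)) (h : Euc n → ℝ) (x : Euc n) (r : ℝ) : ℝ :=
  Real.log (Hfun Ω h x (2 * r) / Hfun Ω h x r)

/-- Closed axis-parallel cube with centre `c` and side length `s`. -/
def cube {n : ℕ} (c : Euc n) (s : ℝ) : Set (Euc n) :=
  {y : Euc n | ∀ i, |y i - c i| ≤ s / 2}

/-- Maximal doubling index `N*_h(Q)` over the cube of centre `c` and side `s`
(whose diameter is `√n · s`). -/
def Nstar {n : ℕ} (Ω : Set (Euc n)) (h : Euc n → ℝ) (c : Euc n) (s : ℝ) : ℝ :=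
  sSup {N : ℝ | ∃ x ∈ cube c s ∩ closure Ω, ∃ r : ℝ,
    0 < r ∧ r ≤ Real.sqrt n * s ∧ N = Nfun Ω h x r}

/-- The nodal set `Z(h) = {x ∈ Ω : h x = 0}`. -/
def zeroSet {n : ℕ} (Ω : Set (Euc n)) (h : Euc n → ℝ) : Set (Euc n) :=
  {x ∈ Ω | h x = 0}

/-- `sup_s g`. -/
def supOn {α : Type*} (g : α → ℝ) (s : Set α) : ℝ := sSup (g '' s)

/-- The open cylinder `S(x,r,t)` of radius `r` and height `t` whose lower face is
centred at `x`. -/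
def cyl {n : ℕ} (x : Euc (n + 1)) (r t : ℝ) : Set (Euc (n + 1)) :=
  {y : Euc (n + 1) | ‖front y - front x‖ < r ∧ 0 < lastc y - lastc x ∧
    lastc y - lastc x < t}

/-- In the chosen coordinates (centred at `x`, with `e_n = -ν(x)`), `Ω ∩ B(x,R)`
is the region above the graph of the `τ`-Lipschitz function `f` with `f 0 = 0`. -/
def AlignedLipGraphOn {n : ℕ} (Ω : Set (Euc (n + 1))) (x : Euc (n + 1)) (R τ : ℝ)
    (f : Euc n → ℝ) : Prop :=
  LipschitzWith (Real.toNNReal τ) f ∧ f 0 = 0 ∧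
    Ω ∩ ball x R = {y ∈ ball x R | f (front (y - x)) < lastc (y - x)}

/-- `z` is the centre of one of the boundary cubes `q ∈ 𝓑_k(Q)` of the standard
construction for the cube `Q` of centre `xQ` and side `s`: the projection of `z` is
the centre of one of the `2^{k·n}` subcubes of side `s/2^k` of the projection of
`Q`, and `z` lies on `∂Ω`. The cube `q` itself is `cube z (s/2^k)`. -/
def IsBdryCubeCenter {n : ℕ} (Ω : Set (Euc (n + 1))) (xQ : Euc (n + 1)) (s : ℝ)
    (k : ℕ) (z : Euc (n + 1)) : Prop :=
  z ∈ frontier Ω ∧ ∃ a : Fin n → ℕ, (∀ i, a i < 2 ^ k) ∧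
    ∀ i : Fin n, z i.castSucc = xQ i.castSucc - s / 2 + ((a i : ℝ) + 1 / 2) * (s / 2 ^ k)

/-- The infinite cylinder `Ω₀ × ℝ ⊂ ℝ^{n+1}` over `Ω₀ ⊂ ℝⁿ`. -/
def prodDomain {n : ℕ} (Ω₀ : Set (Euc n)) : Set (Euc (n + 1)) :=
  {y : Euc (n + 1) | front y ∈ Ω₀}

/-- The harmonic extension `h(x,t) = e^{√λ t} u(x)` of `u` to `Ω₀ × ℝ`. -/
def hExt {n : ℕ} (lam : ℝ) (u : Euc n → ℝ) : Euc (n + 1) → ℝ :=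
  fun y => Real.exp (Real.sqrt lam * lastc y) * u (front y)

section divergence

variable {m : ℕ}

/-- trace of an endomorphism of Euclidean space. -/
def Dv (A : Euc m →L[ℝ] Euc m) : ℝ := ∑ i : Fin m, (A (EuclideanSpace.single i 1)) i

lemma Dv_add (A B : Euc m →L[ℝ] Euc m) : Dv (A + B) = Dv A + Dv B := by
  simp [Dv, Finset.sum_add_distrib]

lemma Dv_sub (A B : Euc m →L[ℝ] Euc m) : Dv (A - B) = Dv A - Dv B := by
  simp [Dv, Finset.sum_sub_distrib]

lemma Dv_smul (c : ℝ) (A : Euc m →L[ℝ] Euc m) : Dv (c • A) = c * Dv A := by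
  simp [Dv, Finset.mul_sum]

lemma Dv_smulRight (φ : Euc m →L[ℝ] ℝ) (v : Euc m) : Dv (φ.smulRight v) = φ v := by
  have h : v = ∑ i : Fin m, v i • EuclideanSpace.single i (1 : ℝ) := by
    ext j
    simp [Finset.sum_apply, Pi.single_apply]
  conv_rhs => rw [h]
  simp [Dv, mul_comm]

lemma abs_Dv_le (A : Euc m →L[ℝ] Euc m) : |Dv A| ≤ m * ‖A‖ := by
  unfold Dv
  refine (Finset.abs_sum_le_sum_abs _ _).trans ?_
  calc ∑ i : Fin m, |(A (EuclideanSpace.single i 1)) i| ≤ ∑ i : Fin m, ‖A‖ := by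
        refine Finset.sum_le_sum fun i _ => ?_
        have h1 := PiLp.norm_apply_le (A (EuclideanSpace.single i (1 : ℝ))) i
        have h2 := A.le_opNorm (EuclideanSpace.single i (1 : ℝ))
        simp at h2
        exact (Real.norm_eq_abs _ ▸ h1).trans h2
    _ = m * ‖A‖ := by simp

lemma exists_lipschitz_of_compact {F : Euc m → Euc m} (hF : LocallyLipschitz F)
    {S : Set (Euc m)} (hS : IsCompact S) (h0 : ∀ x ∉ S, F x = 0) :
    ∃ C, LipschitzWith C F := by
  obtain ⟨r, hr⟩ := hS.isBounded.subset_closedBall 0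
  have hc : IsCompact (closedBall (0 : Euc m) (r + 1)) := isCompact_closedBall _ _
  obtain ⟨C, hC⟩ := (hF.locallyLipschitzOn (s := closedBall (0 : Euc m) (r + 1))).exists_lipschitzOnWith_of_compact hc
  obtain ⟨B, hB⟩ := hc.exists_bound_of_continuousOn hF.continuous.continuousOn
  have hB' : ∀ x, ‖F x‖ ≤ max B 0 := by
    intro x
    by_cases hx : x ∈ S
    · refine (hB x ?_).trans (le_max_left _ _)
      exact closedBall_subset_closedBall (by linarith) (hr hx)
    · simp [h0 x hx]
  refine ⟨C + Real.toNNReal (max B 0), LipschitzWith.of_dist_le_mul fun x y => ?_⟩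
  have key : ∀ x y, x ∈ S → dist (F x) (F y) ≤ (C + Real.toNNReal (max B 0) : ℝ≥0) * dist x y := by
    intro x y hx
    have hd := dist_nonneg (x := x) (y := y)
    have hB0 : (0 : ℝ) ≤ max B 0 := le_max_right _ _
    by_cases hy : y ∈ closedBall (0 : Euc m) (r + 1)
    · have := hC.dist_le_mul x (closedBall_subset_closedBall (by linarith) (hr hx)) y hy
      refine this.trans ?_
      push_cast
      rw [Real.coe_toNNReal _ hB0]
      nlinarith [C.coe_nonneg]
    · have hyS : y ∉ S := fun h => hy (closedBall_subset_closedBall (by linarith) (hr h))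
      rw [h0 y hyS, dist_zero_right]
      have h1 : 1 ≤ dist x y := by
        have h2 : dist x 0 ≤ r := hr hx
        have h3 : r + 1 < dist y 0 := by simpa using hy
        have := dist_triangle_left y 0 x
        linarith
      push_cast
      rw [Real.coe_toNNReal _ hB0]
      nlinarith [C.coe_nonneg, hB' x]
  by_cases hx : x ∈ S
  · exact key x y hx
  by_cases hy : y ∈ S
  · rw [dist_comm, dist_comm x y]; exact key y x hy
  · simp [h0 x hx, h0 y hy]; positivity

lemma integral_Dv_eq_zero {F : Euc m → Euc m} (hF : LocallyLipschitz F)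
    {S : Set (Euc m)} (hS : IsCompact S) (h0 : ∀ x ∉ S, F x = 0) :
    Integrable (fun x => Dv (fderiv ℝ F x)) ∧ ∫ x, Dv (fderiv ℝ F x) = 0 := by
  obtain ⟨C, hC⟩ := exists_lipschitz_of_compact hF hS h0
  have hsupp : HasCompactSupport F := HasCompactSupport.intro hS h0
  have hco : ∀ i : Fin m, LipschitzWith C (fun x => F x i) := fun i => by
    refine LipschitzWith.of_dist_le_mul fun x y => ?_
    refine le_trans ?_ (hC.dist_le_mul x y)
    rw [dist_eq_norm, dist_eq_norm]
    exact PiLp.norm_apply_le (F x - F y) i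
  have hdiff := hC.ae_differentiableAt (μ := volume)
  have heq : ∀ i : Fin m, (fun x => (fderiv ℝ F x (EuclideanSpace.single i 1)) i)
      =ᵐ[volume] fun x => lineDeriv ℝ (fun x => F x i) x (EuclideanSpace.single i 1) := by
    intro i
    filter_upwards [hdiff] with x hx
    have h1 : HasFDerivAt (fun x => F x i)
        ((EuclideanSpace.proj i : Euc m →L[ℝ] ℝ).comp (fderiv ℝ F x)) x :=
      (EuclideanSpace.proj i : Euc m →L[ℝ] ℝ).hasFDerivAt.comp x hx.hasFDerivAt
    rw [(h1.hasLineDerivAt _).lineDeriv]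
    simp
  have hcs : ∀ i : Fin m, HasCompactSupport (fun x => F x i) := fun i =>
    HasCompactSupport.intro hS fun x hx => by simp [h0 x hx]
  have hintg : ∀ i : Fin m, Integrable
      (fun x => lineDeriv ℝ (fun x => F x i) x (EuclideanSpace.single i 1)) := by
    intro i
    have hli := (hco i).locallyIntegrable_lineDeriv (μ := volume) (EuclideanSpace.single i (1 : ℝ))
    have h2 : IntegrableOn (fun x => lineDeriv ℝ (fun x => F x i) x (EuclideanSpace.single i 1))
        S volume := hli.integrableOn_isCompact hS
    refine (integrableOn_iff_integrable_of_support_subset ?_).1 h2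
    intro x hx
    by_contra hxS
    apply hx
    have h3 : (fun x => F x i) =ᶠ[𝓝 x] fun _ => (0 : ℝ) := by
      filter_upwards [hS.isClosed.isOpen_compl.mem_nhds hxS] with y hy
      simp [h0 y hy]
    show lineDeriv ℝ (fun x => F x i) x (EuclideanSpace.single i 1) = 0
    rw [h3.lineDeriv_eq]
    simp [lineDeriv]
  have hzero : ∀ i : Fin m, ∫ x, lineDeriv ℝ (fun x => F x i) x (EuclideanSpace.single i 1) = 0 := by
    intro i
    have := LipschitzWith.integral_lineDeriv_mul_eq (μ := volume)
      (LipschitzWith.const (1 : ℝ) : LipschitzWith 0 fun _ : Euc m => (1 : ℝ)) (hco i) (hcs i)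
      (-(EuclideanSpace.single i (1 : ℝ)))
    simp only [lineDeriv, deriv_const, zero_mul, integral_zero, neg_neg, mul_one] at this
    exact this.symm
  have hintg' : ∀ i : Fin m, Integrable
      (fun x => (fderiv ℝ F x (EuclideanSpace.single i 1)) i) := fun i =>
    (hintg i).congr (heq i).symm
  constructor
  · unfold Dv
    exact integrable_finsetSum _ fun i _ => hintg' i
  · unfold Dv
    rw [integral_finsetSum _ fun i _ => hintg' i]
    refine Finset.sum_eq_zero fun i _ => ?_
    rw [integral_congr_ae (heq i), hzero i]

end divergence

section ibp

variable {m : ℕ}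

lemma ae_diff_of_locLip {F : Type*} [NormedAddCommGroup F] [NormedSpace ℝ F]
    [FiniteDimensional ℝ F] {W : Set (Euc m)} (hW : IsOpen W) {V : Euc m → F}
    (hV : LocallyLipschitzOn W V) : ∀ᵐ x ∂(volume : Measure (Euc m)), x ∈ W → DifferentiableAt ℝ V x := by
  have : volume {x | ¬ (x ∈ W → DifferentiableAt ℝ V x)} = 0 := by
    refine measure_null_of_locally_null _ fun x hx => ?_
    simp only [mem_ofPred_eq, Classical.not_imp] at hx
    obtain ⟨K, t, ht, hK⟩ := hV hx.1
    rw [hW.nhdsWithin_eq hx.1] at ht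
    obtain ⟨ε, hε, hεt⟩ := Metric.mem_nhds_iff.1 ht
    have h1 := (hK.mono hεt).ae_differentiableWithinAt_of_mem (μ := volume)
    refine ⟨ball x ε ∩ {x | ¬ (x ∈ W → DifferentiableAt ℝ V x)}, ?_, ?_⟩
    · rw [inter_comm]; exact inter_mem_nhdsWithin _ (ball_mem_nhds x hε)
    · refine measure_mono_null ?_ (ae_iff.1 h1)
      rintro y ⟨hy1, hy2⟩
      simp only [mem_ofPred_eq, Classical.not_imp] at hy2 ⊢
      exact ⟨hy1, fun h => hy2.2 (h.differentiableAt (isOpen_ball.mem_nhds hy1))⟩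
  exact ae_iff.2 this

lemma locLipOn_comp {F G : Type*} [NormedAddCommGroup F] [NormedSpace ℝ F]
    [NormedAddCommGroup G] [NormedSpace ℝ G] {W : Set (Euc m)} (hW : IsOpen W)
    {f : Euc m → F} (hf : LocallyLipschitzOn W f) {Φ : F → G} (hΦ : ContDiff ℝ 1 Φ) :
    LocallyLipschitzOn W (fun x => Φ (f x)) := by
  intro x hx
  obtain ⟨K, t, ht, hK⟩ := hf hx
  obtain ⟨K', t', ht', hK'⟩ := (hΦ.contDiffAt (x := f x)).exists_lipschitzOnWith
  refine ⟨K' * K, t ∩ f ⁻¹' t', inter_mem ht ?_, ?_⟩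
  · exact hf.continuousOn x hx ht'
  · exact hK'.comp (hK.mono inter_subset_left) (fun y hy => hy.2)

lemma locLipOn_prod {F G : Type*} [PseudoEMetricSpace F] [PseudoEMetricSpace G]
    {W : Set (Euc m)} {f : Euc m → F} {g : Euc m → G}
    (hf : LocallyLipschitzOn W f) (hg : LocallyLipschitzOn W g) :
    LocallyLipschitzOn W (fun x => (f x, g x)) := by
  intro x hx
  obtain ⟨K, t, ht, hK⟩ := hf hx
  obtain ⟨K', t', ht', hK'⟩ := hg hx
  exact ⟨max K K', t ∩ t', inter_mem ht ht',
    (hK.mono inter_subset_left).prodMk (hK'.mono inter_subset_right)⟩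

lemma locLipOn_smul {W : Set (Euc m)} (hW : IsOpen W) {f : Euc m → ℝ} {g : Euc m → Euc m}
    (hf : LocallyLipschitzOn W f) (hg : LocallyLipschitzOn W g) :
    LocallyLipschitzOn W (fun x => f x • g x) := by
  have hΦ : ContDiff ℝ 1 (fun p : ℝ × Euc m => p.1 • p.2) := by fun_prop
  exact locLipOn_comp hW (locLipOn_prod hf hg) hΦ

/-- Integration by parts for a weight `w` supported in a compact subset of `W`. -/
lemma div_ibp {W S : Set (Euc m)} (hW : IsOpen W) (hS : IsCompact S) (hSW : S ⊆ W)
    {w : Euc m → ℝ} {P V : Euc m → Euc m} (hw : ∀ x ∈ W, HasFDerivAt w (innerSL ℝ (P x)) x)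
    (hwL : LocallyLipschitzOn W w) (hV : LocallyLipschitzOn W V) (hP : ContinuousOn P W)
    (hw0 : ∀ x ∈ W, x ∉ S → w x = 0) :
    IntegrableOn (fun x => w x * Dv (fderiv ℝ V x)) W ∧
    IntegrableOn (fun x => ⟪P x, V x⟫) W ∧
    ∫ x in W, w x * Dv (fderiv ℝ V x) = - ∫ x in W, ⟪P x, V x⟫ := by
  set F : Euc m → Euc m := W.indicator (fun x => w x • V x) with hFdef
  have hFout : ∀ x ∉ S, F x = 0 := by
    intro x hx
    by_cases hxW : x ∈ W
    · simp [hFdef, hxW, hw0 x hxW hx]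
    · simp [hFdef, hxW]
  have hFW : ∀ x ∈ W, F =ᶠ[𝓝 x] fun x => w x • V x := by
    intro x hx
    filter_upwards [hW.mem_nhds hx] with y hy
    simp [hFdef, hy]
  have hFS : ∀ x ∉ S, F =ᶠ[𝓝 x] fun _ => 0 := by
    intro x hx
    filter_upwards [hS.isClosed.isOpen_compl.mem_nhds hx] with y hy
    exact hFout y hy
  have hwV := locLipOn_smul hW hwL hV
  have hFL : LocallyLipschitz F := by
    intro x
    by_cases hx : x ∈ W
    · obtain ⟨K, t, ht, hK⟩ := hwV hx
      rw [hW.nhdsWithin_eq hx] at ht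
      refine ⟨K, t ∩ W, inter_mem ht (hW.mem_nhds hx), ?_⟩
      intro a ha b hb
      simp only [hFdef, indicator_of_mem ha.2, indicator_of_mem hb.2]
      exact hK ha.1 hb.1
    · have hxS : x ∉ S := fun h => hx (hSW h)
      refine ⟨0, Sᶜ, hS.isClosed.isOpen_compl.mem_nhds hxS, ?_⟩
      intro a ha b hb
      rw [hFout a ha, hFout b hb]; simp
  obtain ⟨hI, h0⟩ := integral_Dv_eq_zero hFL hS hFout
  have hP0 : ∀ x ∈ W, x ∉ S → P x = 0 := by
    intro x hx hxS
    have h1 : w =ᶠ[𝓝 x] fun _ => 0 := by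
      filter_upwards [hW.mem_nhds hx, hS.isClosed.isOpen_compl.mem_nhds hxS] with y hy hy'
      exact hw0 y hy hy'
    have h2 : HasFDerivAt w (0 : Euc m →L[ℝ] ℝ) x :=
      (hasFDerivAt_const (0 : ℝ) x).congr_of_eventuallyEq h1
    have h3 := (hw x hx).unique h2
    have h4 : (innerSL ℝ (P x)) (P x) = (0 : Euc m →L[ℝ] ℝ) (P x) := by rw [h3]
    simpa using h4
  have hIP : IntegrableOn (fun x => ⟪P x, V x⟫) W := by
    have h1 : IntegrableOn (fun x => ⟪P x, V x⟫) S :=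
      ((hP.mono hSW).inner (hV.continuousOn.mono hSW)).integrableOn_compact hS
    have h2 : W = S ∪ (W \ S) := by rw [union_sdiff_self, union_eq_self_of_subset_left hSW]
    rw [h2]
    refine h1.union ?_
    refine (integrableOn_zero (s := W \ S)).congr_fun (fun x hx => ?_)
      (hW.measurableSet.diff hS.measurableSet)
    simp [hP0 x hx.1 hx.2]
  have hout : ∀ x ∉ W, Dv (fderiv ℝ F x) = 0 := by
    intro x hx
    rw [(hFS x fun h => hx (hSW h)).fderiv_eq]
    simp [Dv]
  have hae : ∀ᵐ x ∂(volume.restrict W), Dv (fderiv ℝ F x) = w x * Dv (fderiv ℝ V x) + ⟪P x, V x⟫ := by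
    rw [ae_restrict_iff' hW.measurableSet]
    filter_upwards [ae_diff_of_locLip hW hV] with x hx hxW
    rw [(hFW x hxW).fderiv_eq]
    have h1 := (hw x hxW).fun_smul (hx hxW).hasFDerivAt
    rw [h1.fderiv, Dv_add, Dv_smul, Dv_smulRight]
    simp
  have hIW : IntegrableOn (fun x => Dv (fderiv ℝ F x)) W := hI.integrableOn
  have hsum : ∫ x in W, Dv (fderiv ℝ F x) = 0 := by
    rw [setIntegral_eq_integral_of_forall_compl_eq_zero hout, h0]
  have hID : IntegrableOn (fun x => w x * Dv (fderiv ℝ V x)) W := by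
    refine (hIW.sub hIP).congr ?_
    filter_upwards [hae] with x hx
    simp [hx]
  refine ⟨hID, hIP, ?_⟩
  rw [integral_congr_ae hae, integral_add hID hIP] at hsum
  linarith

end ibp

section weights

/-- The Carleman weight. -/
def cH (τ γ s : ℝ) : ℝ := Real.cosh (2 * τ * s) * Real.exp (γ * τ * s ^ 2)

/-- Its first derivative. -/
def cH1 (τ γ s : ℝ) : ℝ :=
  (2 * τ * Real.sinh (2 * τ * s) + 2 * γ * τ * s * Real.cosh (2 * τ * s)) *
    Real.exp (γ * τ * s ^ 2)

/-- Its second derivative. -/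
def cH2 (τ γ s : ℝ) : ℝ :=
  (2 * γ * τ * s * (2 * τ * Real.sinh (2 * τ * s) + 2 * γ * τ * s * Real.cosh (2 * τ * s))
    + 4 * τ ^ 2 * Real.cosh (2 * τ * s) + 2 * γ * τ * Real.cosh (2 * τ * s)
    + 4 * γ * τ ^ 2 * s * Real.sinh (2 * τ * s)) * Real.exp (γ * τ * s ^ 2)

/-- Its primitive. -/
def cG (τ γ s : ℝ) : ℝ := ∫ t in (0 : ℝ)..s, cH τ γ t

lemma hasDerivAt_cexp (τ γ s : ℝ) : HasDerivAt (fun s => Real.exp (γ * τ * s ^ 2))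
    (Real.exp (γ * τ * s ^ 2) * (γ * τ * (2 * s))) s := by
  have h : HasDerivAt (fun s : ℝ => γ * τ * s ^ 2) (γ * τ * (2 * s)) s := by
    simpa using (hasDerivAt_pow 2 s).const_mul (γ * τ)
  exact h.exp

lemma hasDerivAt_lin (τ s : ℝ) : HasDerivAt (fun s : ℝ => 2 * τ * s) (2 * τ) s := by
  simpa using (hasDerivAt_id s).const_mul (2 * τ)

lemma hasDerivAt_cH (τ γ s : ℝ) : HasDerivAt (cH τ γ) (cH1 τ γ s) s := by
  have h := (hasDerivAt_lin τ s).cosh.mul (hasDerivAt_cexp τ γ s)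
  refine h.congr_deriv ?_
  unfold cH1; ring

lemma hasDerivAt_cH1 (τ γ s : ℝ) : HasDerivAt (cH1 τ γ) (cH2 τ γ s) s := by
  have h1 : HasDerivAt (fun s : ℝ => 2 * γ * τ * s) (2 * γ * τ) s := by
    simpa using (hasDerivAt_id s).const_mul (2 * γ * τ)
  have h := (((hasDerivAt_lin τ s).sinh.const_mul (2 * τ)).add
    (h1.mul (hasDerivAt_lin τ s).cosh)).mul (hasDerivAt_cexp τ γ s)
  refine h.congr_deriv ?_
  unfold cH2
  simp only [Pi.add_apply, Pi.mul_apply]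
  ring

lemma cH_contDiff (τ γ : ℝ) : ContDiff ℝ 1 (cH τ γ) := by
  unfold cH; fun_prop

lemma cH1_contDiff (τ γ : ℝ) : ContDiff ℝ 1 (cH1 τ γ) := by
  unfold cH1; fun_prop

lemma hasDerivAt_cG (τ γ s : ℝ) : HasDerivAt (cG τ γ) (cH τ γ s) s :=
  intervalIntegral.integral_hasDerivAt_right ((cH_contDiff τ γ).continuous.intervalIntegrable _ _)
    ((cH_contDiff τ γ).continuous.stronglyMeasurableAtFilter _ _) (cH_contDiff τ γ).continuous.continuousAt

lemma cG_contDiff (τ γ : ℝ) : ContDiff ℝ 1 (cG τ γ) := by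
  rw [contDiff_one_iff_deriv]
  refine ⟨fun s => (hasDerivAt_cG τ γ s).differentiableAt, ?_⟩
  have : deriv (cG τ γ) = cH τ γ := funext fun s => (hasDerivAt_cG τ γ s).deriv
  rw [this]; exact (cH_contDiff τ γ).continuous

lemma cH_pos (τ γ s : ℝ) : 0 < cH τ γ s := mul_pos (Real.cosh_pos _) (Real.exp_pos _)

lemma cG_zero (τ γ : ℝ) : cG τ γ 0 = 0 := by simp [cG]

lemma cH1_zero (τ γ : ℝ) : cH1 τ γ 0 = 0 := by simp [cH1]

lemma cH_zero (τ γ : ℝ) : cH τ γ 0 = 1 := by simp [cH]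

lemma cG_nonneg (τ γ : ℝ) {s : ℝ} (hs : 0 ≤ s) : 0 ≤ cG τ γ s :=
  intervalIntegral.integral_nonneg hs fun t _ => (cH_pos τ γ t).le

lemma cG_le {τ γ s : ℝ} (hτ : 0 < τ) (hγ : 0 ≤ γ) (hs : 0 ≤ s) : 2 * τ * cG τ γ s ≤ cH τ γ s := by
  have hk : 2 * τ * cG τ γ s ≤ Real.sinh (2 * τ * s) * Real.exp (γ * τ * s ^ 2) := by
    have hmono : MonotoneOn
        (fun s => Real.sinh (2 * τ * s) * Real.exp (γ * τ * s ^ 2) - 2 * τ * cG τ γ s) (Ici 0) := by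
      have hd : ∀ s, HasDerivAt
          (fun s => Real.sinh (2 * τ * s) * Real.exp (γ * τ * s ^ 2) - 2 * τ * cG τ γ s)
          (2 * γ * τ * s * Real.sinh (2 * τ * s) * Real.exp (γ * τ * s ^ 2)) s := by
        intro s
        have h := ((hasDerivAt_lin τ s).sinh.mul (hasDerivAt_cexp τ γ s)).sub
          ((hasDerivAt_cG τ γ s).const_mul (2 * τ))
        refine h.congr_deriv ?_
        unfold cH; ring
      refine monotoneOn_of_deriv_nonneg (convex_Ici 0)
        (fun x _ => (hd x).continuousAt.continuousWithinAt)
        (fun x _ => (hd x).differentiableAt.differentiableWithinAt) ?_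
      intro x hx
      rw [interior_Ici] at hx
      rw [(hd x).deriv]
      have hx' : 0 < x := hx
      have : 0 ≤ Real.sinh (2 * τ * x) := Real.sinh_nonneg_iff.2 (by positivity)
      positivity
    have := hmono (mem_Ici.2 le_rfl) (mem_Ici.2 hs) hs
    simp [cG_zero] at this
    linarith
  refine hk.trans ?_
  unfold cH
  gcongr
  exact (Real.sinh_lt_cosh _).le

lemma cH1_nonneg {τ γ s : ℝ} (hτ : 0 < τ) (hγ : 0 ≤ γ) (hs : 0 ≤ s) : 0 ≤ cH1 τ γ s := by
  have : 0 ≤ Real.sinh (2 * τ * s) := Real.sinh_nonneg_iff.2 (by positivity)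
  have := Real.cosh_pos (2 * τ * s)
  unfold cH1
  positivity

lemma cH1_le {τ γ s : ℝ} (hτ : 0 < τ) (hγ : 0 ≤ γ) (hs : 0 ≤ s) (h1 : γ * s ≤ 1) :
    cH1 τ γ s ≤ 4 * τ * cH τ γ s := by
  unfold cH1 cH
  rw [← mul_assoc]
  gcongr
  have h2 := (Real.sinh_lt_cosh (2 * τ * s)).le
  have h3 := Real.cosh_pos (2 * τ * s)
  have : γ * s * (τ * Real.cosh (2 * τ * s)) ≤ 1 * (τ * Real.cosh (2 * τ * s)) := by gcongr
  nlinarith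

lemma cH2_ge {τ γ s : ℝ} (hτ : 0 < τ) (hγ : 0 ≤ γ) :
    cH1 τ γ s ^ 2 + 2 * γ * τ * cH τ γ s ^ 2 ≤ cH2 τ γ s * cH τ γ s := by
  unfold cH1 cH2 cH
  have h := Real.cosh_sq (2 * τ * s)
  set C := Real.cosh (2 * τ * s)
  set S := Real.sinh (2 * τ * s)
  set e := Real.exp (γ * τ * s ^ 2)
  have : 0 ≤ 4 * τ ^ 2 * e ^ 2 * (C ^ 2 - S ^ 2) := by
    rw [h]; ring_nf; positivity
  nlinarith

lemma cH_mono {τ γ : ℝ} (hτ : 0 < τ) (hγ : 0 ≤ γ) : MonotoneOn (cH τ γ) (Ici 0) := by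
  refine monotoneOn_of_deriv_nonneg (convex_Ici 0)
    (cH_contDiff τ γ).continuous.continuousOn
    (fun x _ => (hasDerivAt_cH τ γ x).differentiableAt.differentiableWithinAt) ?_
  intro x hx
  rw [interior_Ici] at hx
  rw [(hasDerivAt_cH τ γ x).deriv]
  exact cH1_nonneg hτ hγ (le_of_lt hx)

/-- exponential growth from `s` to `t`. -/
lemma cH_growth {τ γ s t : ℝ} (hτ : 0 < τ) (hγ : 0 ≤ γ) (hs : 0 ≤ s) (hst : s ≤ t) :
    Real.exp (2 * τ * (t - s)) * cH τ γ s ≤ 2 * cH τ γ t := by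
  unfold cH
  have h1 : Real.exp (γ * τ * s ^ 2) ≤ Real.exp (γ * τ * t ^ 2) := by gcongr
  have h2 : Real.exp (2 * τ * (t - s)) * Real.cosh (2 * τ * s) ≤ 2 * Real.cosh (2 * τ * t) := by
    have h3 : Real.cosh (2 * τ * s) ≤ Real.exp (2 * τ * s) := by
      rw [Real.cosh_eq]
      have : Real.exp (-(2 * τ * s)) ≤ Real.exp (2 * τ * s) := by
        apply Real.exp_le_exp.2
        have : 0 ≤ 2 * τ * s := by positivity
        linarith
      linarith
    have h4 : Real.exp (2 * τ * t) ≤ 2 * Real.cosh (2 * τ * t) := by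
      rw [Real.cosh_eq]
      have := Real.exp_pos (-(2 * τ * t))
      linarith
    calc _ ≤ Real.exp (2 * τ * (t - s)) * Real.exp (2 * τ * s) := by gcongr
      _ = Real.exp (2 * τ * t) := by rw [← Real.exp_add]; congr 1; ring
      _ ≤ _ := h4
  calc _ = (Real.exp (2 * τ * (t - s)) * Real.cosh (2 * τ * s)) * Real.exp (γ * τ * s ^ 2) := by ring
    _ ≤ (2 * Real.cosh (2 * τ * t)) * Real.exp (γ * τ * t ^ 2) := by
        gcongr
    _ = _ := by ring

lemma cH_upper {τ γ s : ℝ} (hτ : 0 < τ) (hs : 0 ≤ s) (h1 : γ * s ≤ 1) :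
    cH τ γ s ≤ Real.exp (3 * τ * s) := by
  unfold cH
  have h3 : Real.cosh (2 * τ * s) ≤ Real.exp (2 * τ * s) := by
    rw [Real.cosh_eq]
    have : Real.exp (-(2 * τ * s)) ≤ Real.exp (2 * τ * s) := by
      apply Real.exp_le_exp.2
      have : 0 ≤ 2 * τ * s := by positivity
      linarith
    linarith
  have h4 : Real.exp (γ * τ * s ^ 2) ≤ Real.exp (τ * s) := by
    apply Real.exp_le_exp.2
    have : (γ * s) * (τ * s) ≤ 1 * (τ * s) := by gcongr
    nlinarith
  calc _ ≤ Real.exp (2 * τ * s) * Real.exp (τ * s) := by gcongr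
    _ = _ := by rw [← Real.exp_add]; congr 1; ring

end weights

/-- the algebraic core of the Carleman inequality. -/
lemma carleman_alg {G H H1 H2 τ γ Q K T lam u p g2 AG mm : ℝ} (hH : 0 < H) (hG : 0 ≤ G)
    (hτ : 0 < τ) (hGH : 2 * τ * G ≤ H) (hH1 : 0 ≤ H1) (hH1' : H1 ≤ 4 * τ * H)
    (hH2 : H1 ^ 2 + 2 * γ * τ * H ^ 2 ≤ H2 * H) (hK : 0 ≤ K) (hmm : 0 ≤ mm)
    (hQ : Q = (2 + mm) * K) (hT : |T| ≤ mm * K)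
    (hτQ : Q ≤ τ) (hγ : γ = 30 * Q) (hlam : 0 ≤ lam) (hlamτ : lam ≤ τ ^ 2)
    (hg2 : 0 ≤ g2) (hAG : |AG| ≤ K * g2) :
    1 / 2 * γ * τ * H * u ^ 2 ≤
      2 * H * p ^ 2 + (Q / τ) * H * (g2 - lam * u ^ 2) + (2 + Q / τ) * H1 * u * p
        + 1 / 2 * H2 * u ^ 2 + 2 * G * AG - G * (g2 - lam * u ^ 2) * T
        + 1 / 2 * H1 * u ^ 2 * T := by
  obtain ⟨ε, hε⟩ : ∃ ε, ε = Q / τ := ⟨_, rfl⟩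
  have hετ : ε * τ = Q := by rw [hε]; field_simp
  have hQ0 : 0 ≤ Q := by rw [hQ]; positivity
  have hε0 : 0 ≤ ε := by rw [hε]; positivity
  have hε1 : ε ≤ 1 := by rw [hε]; exact (div_le_one hτ).2 hτQ
  rw [← hε]
  have hTQ : |T| ≤ Q := by rw [hQ]; linarith only [hT, hK]
  obtain ⟨hT1, hT2⟩ := abs_le.1 hT
  obtain ⟨hT1', hT2'⟩ := abs_le.1 hTQ
  obtain ⟨hA1, hA2⟩ := abs_le.1 hAG
  have hu : 0 ≤ u ^ 2 := sq_nonneg u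
  -- gradient terms
  have e1 : 0 ≤ ε * H * g2 + 2 * G * AG - G * g2 * T := by
    have h1 : -(2 * G * (K * g2)) ≤ 2 * G * AG := by
      have := mul_le_mul_of_nonneg_left hA1 (mul_nonneg zero_le_two hG)
      linarith only [this]
    have h2 : G * g2 * T ≤ G * g2 * (mm * K) := by gcongr
    have h3 : G * Q ≤ ε * H := by
      have : 2 * τ * G * ε ≤ H * ε := by gcongr
      have : 2 * G * Q ≤ H * ε := by rw [← hετ]; linarith
      have : 0 ≤ G * Q := by positivity
      linarith
    have h4 : G * Q * g2 ≤ ε * H * g2 := by gcongr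
    rw [hQ] at h4
    linarith only [h1, h2, h4]
  have e2 : -(1 / 2 * τ * Q * H * u ^ 2) ≤ G * lam * u ^ 2 * T := by
    have h1 : G * lam * u ^ 2 * (-Q) ≤ G * lam * u ^ 2 * T := by gcongr
    have h2 : G * lam ≤ 1 / 2 * τ * H := by
      calc G * lam ≤ G * τ ^ 2 := by gcongr
        _ = 1 / 2 * τ * (2 * τ * G) := by ring
        _ ≤ _ := by gcongr
    have h3 : G * lam * (u ^ 2 * Q) ≤ 1 / 2 * τ * H * (u ^ 2 * Q) := by gcongr
    linarith
  have e3 : -(2 * τ * Q * H * u ^ 2) ≤ 1 / 2 * H1 * u ^ 2 * T := by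
    have h1 : 1 / 2 * H1 * u ^ 2 * (-Q) ≤ 1 / 2 * H1 * u ^ 2 * T := by gcongr
    have h3 : H1 * (u ^ 2 * Q) ≤ 4 * τ * H * (u ^ 2 * Q) := by gcongr
    linarith
  have e4 : ε * H * (lam * u ^ 2) ≤ τ * Q * H * u ^ 2 := by
    calc ε * H * (lam * u ^ 2) ≤ ε * H * (τ ^ 2 * u ^ 2) := by gcongr
      _ = (ε * τ) * τ * H * u ^ 2 := by ring
      _ = _ := by rw [hετ]; ring
  -- the square
  have e5 : (γ * τ - 10 * Q * τ) * H * u ^ 2 ≤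
      2 * H * p ^ 2 + (2 + ε) * H1 * u * p + 1 / 2 * H2 * u ^ 2 := by
    obtain ⟨l, hl⟩ : ∃ l, l = H1 / H := ⟨_, rfl⟩
    have hlH : H1 = l * H := by rw [hl]; field_simp
    have hl0 : 0 ≤ l := by rw [hl]; positivity
    have hl4 : l ≤ 4 * τ := by rw [hl, div_le_iff₀ hH]; exact hH1'
    have hH2' : (l ^ 2 + 2 * γ * τ) * H ≤ H2 := by
      rw [hlH] at hH2
      have : (l ^ 2 + 2 * γ * τ) * H * H ≤ H2 * H := by linarith only [hH2]
      exact le_of_mul_le_mul_right this hH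
    have h1 : 1 / 2 * ((l ^ 2 + 2 * γ * τ) * H) * u ^ 2 ≤ 1 / 2 * H2 * u ^ 2 := by gcongr
    have h2 : 0 ≤ 2 * H * (p + (2 + ε) * l * u / 4) ^ 2 := by positivity
    have h3 : (ε / 2 + ε ^ 2 / 8) * l ^ 2 ≤ 10 * Q * τ := by
      have hee : ε ^ 2 ≤ ε := by nlinarith only [hε0, hε1]
      calc (ε / 2 + ε ^ 2 / 8) * l ^ 2 ≤ (ε / 2 + ε / 8) * (4 * τ) ^ 2 := by gcongr
        _ = 10 * (ε * τ) * τ := by ring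
        _ = _ := by rw [hετ]
    have h4 : (ε / 2 + ε ^ 2 / 8) * l ^ 2 * (H * u ^ 2) ≤ 10 * Q * τ * (H * u ^ 2) := by gcongr
    rw [hlH]
    have h5 : 2 * H * (p + (2 + ε) * l * u / 4) ^ 2 = 2 * H * p ^ 2 + (2 + ε) * (l * H) * u * p
      + 1 / 2 * l ^ 2 * H * u ^ 2 + (ε / 2 + ε ^ 2 / 8) * l ^ 2 * (H * u ^ 2) := by ring
    rw [h5] at h2
    linarith only [h1, h2, h4]
  have e6 : 0 ≤ Q * τ * H * u ^ 2 := by positivity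
  rw [hγ] at e5 ⊢
  linarith only [e1, e2, e3, e4, e5, e6]

section carleman

variable {m : ℕ}

/-- A foliation function `η` with unit gradient `N` and quadratic control `K`. -/
structure Fol (W : Set (Euc m)) (η : Euc m → ℝ) (N : Euc m → Euc m) (K : ℝ) : Prop where
  op : IsOpen W
  Kpos : 0 < K
  unit : ∀ x ∈ W, ‖N x‖ = 1
  quad : ∀ x ∈ W, ∀ y ∈ W, |η y - η x - ⟪N x, y - x⟫| ≤ K * ‖y - x‖ ^ 2

/-- A Laplace eigenfunction on an open set, with gradient `g` and Hessian `B`. -/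
structure Eig (W : Set (Euc m)) (u : Euc m → ℝ) (g : Euc m → Euc m)
    (B : Euc m → Euc m →L[ℝ] Euc m) (lam : ℝ) : Prop where
  op : IsOpen W
  du : ∀ x ∈ W, HasFDerivAt u (innerSL ℝ (g x)) x
  dg : ∀ x ∈ W, HasFDerivAt g (B x) x
  symm : ∀ x ∈ W, ∀ v w, ⟪B x v, w⟫ = ⟪v, B x w⟫
  tr : ∀ x ∈ W, Dv (B x) = -(lam * u x)
  uL : LocallyLipschitzOn W u
  gL : LocallyLipschitzOn W g

variable {W : Set (Euc m)} {η : Euc m → ℝ} {N : Euc m → Euc m} {K : ℝ}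
  {u : Euc m → ℝ} {g : Euc m → Euc m} {B : Euc m → Euc m →L[ℝ] Euc m} {lam : ℝ}

lemma Eig.mono (h : Eig W u g B lam) {W' : Set (Euc m)} (ho : IsOpen W') (hs : W' ⊆ W) :
    Eig W' u g B lam where
  op := ho
  du x hx := h.du x (hs hx)
  dg x hx := h.dg x (hs hx)
  symm x hx := h.symm x (hs hx)
  tr x hx := h.tr x (hs hx)
  uL := h.uL.mono hs
  gL := h.gL.mono hs

lemma Fol.mono (h : Fol W η N K) {W' : Set (Euc m)} (ho : IsOpen W') (hs : W' ⊆ W) :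
    Fol W' η N K where
  op := ho
  Kpos := h.Kpos
  unit x hx := h.unit x (hs hx)
  quad x hx y hy := h.quad x (hs hx) y (hs hy)

lemma Fol.hasFDerivAt (h : Fol W η N K) {x : Euc m} (hx : x ∈ W) :
    HasFDerivAt η (innerSL ℝ (N x)) x := by
  have h1 : HasFDerivAt (fun y => η y - η x - ⟪N x, y - x⟫) (0 : Euc m →L[ℝ] ℝ) x := by
    refine IsBigO.hasFDerivAt (n := 2) ?_ one_lt_two
    refine IsBigO.of_bound K ?_
    filter_upwards [h.op.mem_nhds hx] with y hy
    simpa using h.quad x hx y hy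
  have h2 : HasFDerivAt (fun y => η x + ⟪N x, y - x⟫) (innerSL ℝ (N x)) x := by
    have h3 : HasFDerivAt (fun y : Euc m => y - x) (ContinuousLinearMap.id ℝ (Euc m)) x :=
      (hasFDerivAt_id x).sub_const x
    have := ((innerSL ℝ (N x)).hasFDerivAt.comp x h3).const_add (η x)
    simpa using this
  have h4 := h1.add h2
  simp only [zero_add] at h4
  refine h4.congr_of_eventuallyEq (Eventually.of_forall fun y => ?_)
  simp

lemma Fol.N_lip (h : Fol W η N K) {x : Euc m} (hx : x ∈ W) :
    ∃ ε > 0, LipschitzOnWith (Real.toNNReal (6 * K)) N (ball x ε) := by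
  obtain ⟨ε, hε, hb⟩ := Metric.isOpen_iff.1 h.op x hx
  refine ⟨ε / 3, by positivity, ?_⟩
  have hK := h.Kpos
  refine LipschitzOnWith.of_dist_le_mul fun a ha b hb' => ?_
  rw [Real.coe_toNNReal _ (by positivity)]
  rw [mem_ball] at ha hb'
  have haW : a ∈ W := hb (by rw [mem_ball]; linarith)
  have hbW : b ∈ W := hb (by rw [mem_ball]; linarith)
  set k := dist a b with hk
  have hk2 : k < 2 * (ε / 3) := by
    have := dist_triangle_right a b x
    linarith
  rw [dist_eq_norm]
  set v := N a - N b with hv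
  by_cases hv0 : ‖v‖ = 0
  · rw [hv0]; positivity
  have hvp : 0 < ‖v‖ := lt_of_le_of_ne (norm_nonneg _) (Ne.symm hv0)
  by_cases hk0 : k = 0
  · have : a = b := dist_eq_zero.1 hk0
    rw [hv, this] at hv0; simp at hv0
  have hkp : 0 < k := lt_of_le_of_ne dist_nonneg (Ne.symm hk0)
  set w : Euc m := (k / ‖v‖) • v with hw
  have hwn : ‖w‖ = k := by
    rw [hw, norm_smul, Real.norm_of_nonneg (by positivity)]; field_simp
  have hcW : a + w ∈ W := hb (by
    rw [mem_ball]
    have : dist (a + w) a = k := by rw [dist_eq_norm]; simpa using hwn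
    have := dist_triangle (a + w) a x
    linarith)
  have e1 := abs_le.1 (h.quad a haW _ hcW)
  have e2 := abs_le.1 (h.quad b hbW _ hcW)
  have e3 := abs_le.1 (h.quad b hbW _ haW)
  have n1 : ‖a + w - a‖ = k := by simpa using hwn
  have n3 : ‖a - b‖ = k := by rw [hk, dist_eq_norm]
  have n2 : ‖a + w - b‖ ≤ 2 * k := by
    have : a + w - b = (a - b) + w := by abel
    rw [this]
    have := norm_add_le (a - b) w
    linarith
  have n2' : ‖a + w - b‖ ^ 2 ≤ (2 * k) ^ 2 := by gcongr
  have n2'' : K * ‖a + w - b‖ ^ 2 ≤ K * (2 * k) ^ 2 := by gcongr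
  rw [n1] at e1
  rw [n3] at e3
  have i1 : ⟪N a, a + w - a⟫ = ⟪N a, w⟫ := by congr 1; abel
  have i2 : ⟪N b, a + w - b⟫ = ⟪N b, a - b⟫ + ⟪N b, w⟫ := by
    rw [← inner_add_right]; congr 1; abel
  rw [i1] at e1
  rw [i2] at e2
  have i3 : ⟪N a, w⟫ - ⟪N b, w⟫ = k * ‖v‖ := by
    rw [← inner_sub_left, ← hv, hw, inner_smul_right, real_inner_self_eq_norm_sq]
    field_simp
  have : k * ‖v‖ ≤ k * (6 * K * k) := by nlinarith [e1.1, e1.2, e2.1, e2.2, e3.1, e3.2]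
  exact le_of_mul_le_mul_left this hkp

lemma Fol.locLip_N (h : Fol W η N K) : LocallyLipschitzOn W N := by
  intro x hx
  obtain ⟨ε, hε, hl⟩ := h.N_lip hx
  exact ⟨_, ball x ε, mem_nhdsWithin_of_mem_nhds (ball_mem_nhds x hε), hl⟩

lemma Fol.fderiv_N_le (h : Fol W η N K) {x : Euc m} (hx : x ∈ W) : ‖fderiv ℝ N x‖ ≤ 6 * K := by
  obtain ⟨ε, hε, hl⟩ := h.N_lip hx
  have := norm_fderiv_le_of_lipschitzOn ℝ (ball_mem_nhds x hε) hl
  rwa [Real.coe_toNNReal _ (by have := h.Kpos; positivity)] at this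

lemma Fol.locLip_eta (h : Fol W η N K) : LocallyLipschitzOn W η := by
  intro x hx
  obtain ⟨ε, hε, hb⟩ := Metric.isOpen_iff.1 h.op x hx
  have hK := h.Kpos
  refine ⟨Real.toNNReal (1 + K * (2 * ε)), ball x ε,
    mem_nhdsWithin_of_mem_nhds (ball_mem_nhds x hε), ?_⟩
  refine LipschitzOnWith.of_dist_le_mul fun a ha b hb' => ?_
  rw [Real.coe_toNNReal _ (by positivity)]
  have e := abs_le.1 (h.quad b (hb hb') a (hb ha))
  have hab : ‖a - b‖ ≤ 2 * ε := by
    rw [← dist_eq_norm]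
    have := dist_triangle_right a b x
    rw [mem_ball] at ha hb'
    linarith
  have hi : |⟪N b, a - b⟫| ≤ ‖a - b‖ := by
    have := abs_real_inner_le_norm (N b) (a - b)
    rwa [h.unit b (hb hb'), one_mul] at this
  have hi' := abs_le.1 hi
  have hq : K * ‖a - b‖ ^ 2 ≤ K * (2 * ε) * ‖a - b‖ := by
    rw [sq, mul_assoc K]
    gcongr
  rw [dist_eq_norm, dist_eq_norm, Real.norm_eq_abs, abs_le]
  constructor <;> linarith [e.1, e.2, hi'.1, hi'.2]

/-- The Carleman field. -/
def cV (τ γ β lam : ℝ) (η : Euc m → ℝ) (N : Euc m → Euc m) (u : Euc m → ℝ) (g : Euc m → Euc m)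
    (x : Euc m) : Euc m :=
  (2 * cG τ γ (η x) * ⟪g x, N x⟫ + β * cH τ γ (η x) * u x) • g x +
    (-(cG τ γ (η x) * (⟪g x, g x⟫ - lam * u x ^ 2)) + 1 / 2 * cH1 τ γ (η x) * u x ^ 2) • N x

lemma locLip_cV (hf : Fol W η N K) (hu : Eig W u g B lam) (τ γ β : ℝ) :
    LocallyLipschitzOn W (cV τ γ β lam η N u g) := by
  have h1 := locLipOn_prod (locLipOn_prod hf.locLip_eta hf.locLip_N) (locLipOn_prod hu.uL hu.gL)
  let Φ : (ℝ × Euc m) × (ℝ × Euc m) → Euc m := fun q =>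
    (2 * cG τ γ q.1.1 * ⟪q.2.2, q.1.2⟫ + β * cH τ γ q.1.1 * q.2.1) • q.2.2 +
    (-(cG τ γ q.1.1 * (⟪q.2.2, q.2.2⟫ - lam * q.2.1 ^ 2)) +
      1 / 2 * cH1 τ γ q.1.1 * q.2.1 ^ 2) • q.1.2
  have hΦ : ContDiff ℝ 1 Φ := by
    have a1 : ContDiff ℝ 1 (fun q : (ℝ × Euc m) × (ℝ × Euc m) => cG τ γ q.1.1) :=
      (cG_contDiff τ γ).comp (by fun_prop)
    have a2 : ContDiff ℝ 1 (fun q : (ℝ × Euc m) × (ℝ × Euc m) => cH τ γ q.1.1) :=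
      (cH_contDiff τ γ).comp (by fun_prop)
    have a3 : ContDiff ℝ 1 (fun q : (ℝ × Euc m) × (ℝ × Euc m) => cH1 τ γ q.1.1) :=
      (cH1_contDiff τ γ).comp (by fun_prop)
    have a4 : ContDiff ℝ 1 (fun q : (ℝ × Euc m) × (ℝ × Euc m) => (⟪q.2.2, q.1.2⟫ : ℝ)) :=
      ContDiff.inner ℝ (by fun_prop) (by fun_prop)
    have a5 : ContDiff ℝ 1 (fun q : (ℝ × Euc m) × (ℝ × Euc m) => (⟪q.2.2, q.2.2⟫ : ℝ)) :=
      ContDiff.inner ℝ (by fun_prop) (by fun_prop)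
    fun_prop
  exact locLipOn_comp hf.op h1 hΦ

lemma Dv_cV (hf : Fol W η N K) (hu : Eig W u g B lam) (τ γ β : ℝ) {x : Euc m} (hx : x ∈ W)
    (hN : DifferentiableAt ℝ N x) :
    Dv (fderiv ℝ (cV τ γ β lam η N u g) x) =
      2 * cH τ γ (η x) * ⟪g x, N x⟫ ^ 2 +
      (β - 1) * cH τ γ (η x) * (⟪g x, g x⟫ - lam * u x ^ 2) +
      (β + 1) * cH1 τ γ (η x) * u x * ⟪g x, N x⟫ + 1 / 2 * cH2 τ γ (η x) * u x ^ 2 +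
      2 * cG τ γ (η x) * ⟪g x, fderiv ℝ N x (g x)⟫ -
      cG τ γ (η x) * (⟪g x, g x⟫ - lam * u x ^ 2) * Dv (fderiv ℝ N x) +
      1 / 2 * cH1 τ γ (η x) * u x ^ 2 * Dv (fderiv ℝ N x) := by
  have dη := hf.hasFDerivAt hx
  have du := hu.du x hx
  have dg := hu.dg x hx
  have dN := hN.hasFDerivAt
  have dG := (hasDerivAt_cG τ γ (η x)).comp_hasFDerivAt x dη
  have dH := (hasDerivAt_cH τ γ (η x)).comp_hasFDerivAt x dη
  have dH1 := (hasDerivAt_cH1 τ γ (η x)).comp_hasFDerivAt x dη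
  have dp := dg.inner ℝ dN
  have dq := dg.inner ℝ dg
  have du2 := du.pow 2
  have dA := ((dG.const_mul 2).mul dp).add ((dH.const_mul β).mul du)
  have dB := ((dG.mul (dq.sub (du2.const_mul lam))).neg).add ((dH1.const_mul (1 / 2)).mul du2)
  have dV := (dA.smul dg).add (dB.smul dN)
  have e : cV τ γ β lam η N u g = _ := rfl
  have hV : HasFDerivAt (cV τ γ β lam η N u g) _ x := dV
  rw [hV.fderiv, Dv_add, Dv_add, Dv_add, Dv_smul, Dv_smul, Dv_smulRight, Dv_smulRight, hu.tr x hx]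
  have hNN : ⟪N x, N x⟫ = (1 : ℝ) := by rw [real_inner_self_eq_norm_sq, hf.unit x hx]; norm_num
  have hs := hu.symm x hx (g x) (N x)
  have hs' : ⟪B x (N x), g x⟫ = ⟪g x, B x (N x)⟫ := real_inner_comm _ _
  have hc : ⟪N x, g x⟫ = ⟪g x, N x⟫ := real_inner_comm _ _
  simp only [ContinuousLinearMap.add_apply, ContinuousLinearMap.smul_apply, smul_eq_mul,
    ContinuousLinearMap.neg_apply, ContinuousLinearMap.sub_apply, ContinuousLinearMap.comp_apply,
    ContinuousLinearMap.prod_apply, fderivInnerCLM_apply, innerSL_apply_apply, Function.comp,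
    hNN, hs, hs', hc, Pi.mul_apply, Pi.add_apply, Pi.neg_apply, Pi.sub_apply]
  simp
  ring

lemma Dv_cV_ge (hf : Fol W η N K) (hu : Eig W u g B lam) {τ γ Q : ℝ} {x : Euc m} (hx : x ∈ W)
    (hN : DifferentiableAt ℝ N x) (hlam : 0 ≤ lam) (hτ : 0 < τ) (hQ : Q = (2 + m) * (6 * K))
    (hγ : γ = 30 * Q) (hτQ : Q ≤ τ) (hlamτ : lam ≤ τ ^ 2) (hη0 : 0 ≤ η x) (hη1 : γ * η x ≤ 1) :
    1 / 2 * γ * τ * cH τ γ (η x) * u x ^ 2 ≤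
      Dv (fderiv ℝ (cV τ γ (1 + Q / τ) lam η N u g) x) := by
  have hK := hf.Kpos
  have hQ0 : 0 < Q := by rw [hQ]; positivity
  have hγ0 : 0 ≤ γ := by rw [hγ]; positivity
  rw [Dv_cV hf hu τ γ _ hx hN]
  have hA := hf.fderiv_N_le hx
  have hT : |Dv (fderiv ℝ N x)| ≤ m * (6 * K) :=
    (abs_Dv_le _).trans (by gcongr)
  have hAG : |⟪g x, fderiv ℝ N x (g x)⟫| ≤ 6 * K * ⟪g x, g x⟫ := by
    rw [real_inner_self_eq_norm_sq]
    calc _ ≤ ‖g x‖ * ‖fderiv ℝ N x (g x)‖ := abs_real_inner_le_norm _ _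
      _ ≤ ‖g x‖ * (6 * K * ‖g x‖) := by
        gcongr
        exact (fderiv ℝ N x).le_of_opNorm_le hA _
      _ = _ := by ring
  have := carleman_alg (u := u x) (p := ⟪g x, N x⟫) (T := Dv (fderiv ℝ N x))
    (AG := ⟪g x, fderiv ℝ N x (g x)⟫) (cH_pos τ γ (η x)) (cG_nonneg τ γ hη0) hτ
    (cG_le hτ hγ0 hη0) (cH1_nonneg hτ hγ0 hη0) (cH1_le hτ hγ0 hη0 hη1) (cH2_ge (s := η x) hτ hγ0)
    (by positivity : 0 ≤ 6 * K) (Nat.cast_nonneg m) hQ hT hτQ hγ hlam hlamτ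
    (real_inner_self_nonneg : 0 ≤ ⟪g x, g x⟫) hAG
  refine this.trans (le_of_eq ?_)
  ring

lemma abs_inner_cV_le (hf : Fol W η N K) {τ γ β : ℝ} {x : Euc m} (hx : x ∈ W)
    (hlam : 0 ≤ lam) (hτ : 1 ≤ τ) (hγ0 : 0 ≤ γ) (hβ0 : 0 ≤ β) (hβ : β ≤ 2)
    (hlamτ : lam ≤ τ ^ 2) (hη0 : 0 ≤ η x) (hη1 : γ * η x ≤ 1) :
    |⟪N x, cV τ γ β lam η N u g x⟫| ≤ 4 * τ * cH τ γ (η x) * (u x ^ 2 + ‖g x‖ ^ 2) := by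
  have hNN : ⟪N x, N x⟫ = (1 : ℝ) := by rw [real_inner_self_eq_norm_sq, hf.unit x hx]; norm_num
  have hτ0 : 0 < τ := by linarith
  have hH := cH_pos τ γ (η x)
  have hG := cG_nonneg τ γ hη0
  have hGH := cG_le hτ0 hγ0 hη0
  have hH1 := cH1_nonneg hτ0 hγ0 hη0
  have hH1' := cH1_le hτ0 hγ0 hη0 hη1
  have hp : ⟪N x, g x⟫ ^ 2 ≤ ‖g x‖ ^ 2 := by
    have := abs_real_inner_le_norm (N x) (g x)
    rw [hf.unit x hx, one_mul] at this
    exact sq_le_sq' (abs_le.1 this).1 (abs_le.1 this).2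
  unfold cV
  rw [inner_add_right, inner_smul_right, inner_smul_right, hNN, real_inner_self_eq_norm_sq,
    real_inner_comm (N x) (g x)]
  set p : ℝ := ⟪N x, g x⟫
  set G := cG τ γ (η x)
  set H := cH τ γ (η x)
  set H1 := cH1 τ γ (η x)
  set U := u x
  set g2 := ‖g x‖ ^ 2
  have hg2 : 0 ≤ g2 := by positivity
  have hU2 : 0 ≤ U ^ 2 := sq_nonneg U
  have b1 : 2 * G * p ^ 2 ≤ H * g2 := by
    have h1 : 2 * G ≤ H := by nlinarith only [hGH, hτ, hG]
    calc 2 * G * p ^ 2 ≤ 2 * G * g2 := by gcongr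
      _ ≤ _ := by gcongr
  have b1' : 0 ≤ 2 * G * p ^ 2 := by positivity
  have b2 : |β * H * U * p| ≤ H * (U ^ 2 + g2) := by
    have h1 : |β * H * U * p| = β * H * (|U| * |p|) := by
      rw [abs_mul, abs_mul, abs_mul, abs_of_nonneg hβ0, abs_of_pos hH]; ring
    have h2 : 2 * (|U| * |p|) ≤ U ^ 2 + g2 := by
      have := two_mul_le_add_sq (|U|) (|p|)
      rw [sq_abs, sq_abs] at this
      linarith
    rw [h1]
    calc β * H * (|U| * |p|) ≤ 2 * H * (|U| * |p|) := by gcongr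
      _ = H * (2 * (|U| * |p|)) := by ring
      _ ≤ _ := by gcongr
  have b3 : G * g2 ≤ H * g2 := by
    have h1 : G ≤ H := by nlinarith only [hGH, hτ, hG]
    gcongr
  have b3' : 0 ≤ G * g2 := by positivity
  have b4 : G * lam * U ^ 2 ≤ τ * H * U ^ 2 := by
    have : G * lam ≤ τ * H := by
      calc G * lam ≤ G * τ ^ 2 := by gcongr
        _ = 1 / 2 * τ * (2 * τ * G) := by ring
        _ ≤ 1 / 2 * τ * H := by gcongr
        _ ≤ _ := by nlinarith only [mul_pos hτ0 hH]
    gcongr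
  have b4' : 0 ≤ G * lam * U ^ 2 := by positivity
  have b5 : 1 / 2 * H1 * U ^ 2 ≤ 2 * τ * H * U ^ 2 := by
    have : H1 * U ^ 2 ≤ 4 * τ * H * U ^ 2 := by gcongr
    linarith
  have b5' : 0 ≤ 1 / 2 * H1 * U ^ 2 := by positivity
  have c1 : H * U ^ 2 ≤ τ * H * U ^ 2 := by
    have : 1 * (H * U ^ 2) ≤ τ * (H * U ^ 2) := by gcongr
    linarith
  have c2 : H * g2 ≤ τ * H * g2 := by
    have : 1 * (H * g2) ≤ τ * (H * g2) := by gcongr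
    linarith
  have c3 : 0 ≤ H * g2 := by positivity
  have c4 : 0 ≤ τ * H * U ^ 2 := by positivity
  obtain ⟨b2a, b2b⟩ := abs_le.1 b2
  rw [abs_le]
  constructor <;> nlinarith only [b1, b1', b2a, b2b, b3, b3', b4, b4', b5, b5', c1, c2, c3, c4]

/-- Integrated Carleman inequality. -/
lemma carleman_int (hf : Fol W η N K) (hu : Eig W u g B lam) {τ γ Q : ℝ}
    (hlam : 0 ≤ lam) (hτ : 0 < τ) (hQ : Q = (2 + m) * (6 * K))
    (hγ : γ = 30 * Q) (hτQ : Q ≤ τ) (hlamτ : lam ≤ τ ^ 2) (hη0 : ∀ x ∈ W, 0 ≤ η x)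
    (hη1 : ∀ x ∈ W, γ * η x ≤ 1) {ω ω' : ℝ → ℝ} (hω : ∀ s, HasDerivAt ω (ω' s) s)
    (hω' : Continuous ω') (hω0 : ∀ s, 0 ≤ ω s)
    {S : Set (Euc m)} (hS : IsCompact S) (hSW : S ⊆ W) (hsupp : ∀ x ∈ W, x ∉ S → ω (η x) = 0) :
    IntegrableOn (fun x => ω (η x) * (1 / 2 * γ * τ * cH τ γ (η x) * u x ^ 2)) W ∧
    IntegrableOn (fun x => ω' (η x) * ⟪N x, cV τ γ (1 + Q / τ) lam η N u g x⟫) W ∧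
    ∫ x in W, ω (η x) * (1 / 2 * γ * τ * cH τ γ (η x) * u x ^ 2) ≤
      -∫ x in W, ω' (η x) * ⟪N x, cV τ γ (1 + Q / τ) lam η N u g x⟫ := by
  have hηc : ContinuousOn η W := fun x hx => (hf.hasFDerivAt hx).continuousAt.continuousWithinAt
  have huc : ContinuousOn u W := fun x hx => (hu.du x hx).continuousAt.continuousWithinAt
  have hNc : ContinuousOn N W := hf.locLip_N.continuousOn
  have hωC : ContDiff ℝ 1 ω := by
    rw [contDiff_one_iff_deriv]
    refine ⟨fun s => (hω s).differentiableAt, ?_⟩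
    rwa [show deriv ω = ω' from funext fun s => (hω s).deriv]
  have hKp := hf.Kpos
  have hγ0 : 0 ≤ γ := by rw [hγ, hQ]; positivity
  obtain ⟨i1, i2, i3⟩ := div_ibp hf.op hS hSW (w := fun x => ω (η x))
    (P := fun x => ω' (η x) • N x) (V := cV τ γ (1 + Q / τ) lam η N u g)
    (fun x hx => by
      have := (hω (η x)).comp_hasFDerivAt x (hf.hasFDerivAt hx)
      refine this.congr_fderiv ?_
      ext v; simp)
    (locLipOn_comp hf.op hf.locLip_eta hωC) (locLip_cV hf hu τ γ _)
    ((hω'.comp_continuousOn hηc).smul hNc) hsupp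
  simp only [real_inner_smul_left] at i2 i3
  have hae : ∀ᵐ x ∂(volume.restrict W), ω (η x) * (1 / 2 * γ * τ * cH τ γ (η x) * u x ^ 2) ≤
      ω (η x) * Dv (fderiv ℝ (cV τ γ (1 + Q / τ) lam η N u g) x) := by
    rw [ae_restrict_iff' hf.op.measurableSet]
    filter_upwards [ae_diff_of_locLip hf.op hf.locLip_N] with x hx hxW
    refine mul_le_mul_of_nonneg_left ?_ (hω0 _)
    exact Dv_cV_ge hf hu hxW (hx hxW) hlam hτ hQ hγ hτQ hlamτ (hη0 x hxW) (hη1 x hxW)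
  have hnn : ∀ x, 0 ≤ ω (η x) * (1 / 2 * γ * τ * cH τ γ (η x) * u x ^ 2) := fun x => by
    have := cH_pos τ γ (η x)
    have := hω0 (η x)
    positivity
  have hmeas : AEStronglyMeasurable (fun x => ω (η x) * (1 / 2 * γ * τ * cH τ γ (η x) * u x ^ 2))
      (volume.restrict W) := by
    refine ContinuousOn.aestronglyMeasurable ?_ hf.op.measurableSet
    have h1 := hωC.continuous.comp_continuousOn hηc
    have h2 := (cH_contDiff τ γ).continuous.comp_continuousOn hηc
    exact h1.mul ((continuousOn_const.mul h2).mul (huc.pow 2))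
  refine ⟨?_, i2, ?_⟩
  · refine Integrable.mono' i1 hmeas ?_
    filter_upwards [hae] with x hx
    rwa [Real.norm_of_nonneg (hnn x)]
  · rw [← i3]
    exact integral_mono_of_nonneg (Eventually.of_forall hnn) i1 hae

end carleman

section cuts

lemma exists_C0 : ∃ C : ℝ, 0 < C ∧ ∀ x, |deriv Real.smoothTransition x| ≤ C := by
  have hc : Continuous (deriv Real.smoothTransition) :=
    (Real.smoothTransition.contDiff (n := 1)).continuous_deriv le_rfl
  obtain ⟨C, hC⟩ := (isCompact_Icc (a := (0:ℝ)) (b := 1)).exists_bound_of_continuousOn hc.continuousOn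
  refine ⟨|C| + 1, by positivity, fun x => ?_⟩
  by_cases h0 : x < 0
  · have : deriv Real.smoothTransition x = 0 := by
      apply IsLocalMin.deriv_eq_zero
      refine Eventually.of_forall fun y => ?_
      rw [Real.smoothTransition.zero_of_nonpos h0.le]
      exact Real.smoothTransition.nonneg y
    rw [this]; simp; positivity
  by_cases h1 : 1 < x
  · have : deriv Real.smoothTransition x = 0 := by
      apply IsLocalMax.deriv_eq_zero
      refine Eventually.of_forall fun y => ?_
      rw [Real.smoothTransition.one_of_one_le h1.le]
      exact Real.smoothTransition.le_one y
    rw [this]; simp; positivity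
  have := hC x ⟨not_lt.1 h0, not_lt.1 h1⟩
  rw [Real.norm_eq_abs] at this
  linarith [le_abs_self C]

/-- Bound for the derivative of the standard cutoff. -/
def C0 : ℝ := Classical.choose exists_C0
lemma C0_pos : 0 < C0 := (Classical.choose_spec exists_C0).1
lemma C0_spec (x : ℝ) : |deriv Real.smoothTransition x| ≤ C0 := (Classical.choose_spec exists_C0).2 x

/-- cutoff rising from `0` at `a` to `1` at `b`. -/
def cut (a b s : ℝ) : ℝ := Real.smoothTransition ((s - a) / (b - a))
/-- its derivative. -/
def cut' (a b s : ℝ) : ℝ := deriv Real.smoothTransition ((s - a) / (b - a)) / (b - a)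

lemma hasDerivAt_cut (a b s : ℝ) : HasDerivAt (cut a b) (cut' a b s) s := by
  have h1 : HasDerivAt (fun s : ℝ => (s - a) / (b - a)) (1 / (b - a)) s :=
    ((hasDerivAt_id s).sub_const a).div_const _
  have h2 : HasDerivAt Real.smoothTransition (deriv Real.smoothTransition ((s - a) / (b - a)))
      ((s - a) / (b - a)) :=
    ((Real.smoothTransition.contDiff (n := 1)).differentiable (by simp) _).hasDerivAt
  have := h2.comp s h1
  refine this.congr_deriv ?_
  unfold cut'; ring

lemma continuous_cut' (a b : ℝ) : Continuous (cut' a b) := by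
  have hc : Continuous (deriv Real.smoothTransition) :=
    (Real.smoothTransition.contDiff (n := 1)).continuous_deriv le_rfl
  unfold cut'
  exact (hc.comp ((continuous_id.sub continuous_const).div_const _)).div_const _

lemma cut_nonneg (a b s : ℝ) : 0 ≤ cut a b s := Real.smoothTransition.nonneg _
lemma cut_le_one (a b s : ℝ) : cut a b s ≤ 1 := Real.smoothTransition.le_one _
lemma cut_zero {a b s : ℝ} (hab : a < b) (h : s ≤ a) : cut a b s = 0 :=
  Real.smoothTransition.zero_of_nonpos (div_nonpos_of_nonpos_of_nonneg (by linarith) (by linarith))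
lemma cut_one {a b s : ℝ} (hab : a < b) (h : b ≤ s) : cut a b s = 1 :=
  Real.smoothTransition.one_of_one_le (by rw [le_div_iff₀ (by linarith)]; linarith)
lemma cut'_nonneg {a b : ℝ} (hab : a < b) (s : ℝ) : 0 ≤ cut' a b s :=
  div_nonneg (Real.smoothTransition.monotone.deriv_nonneg) (by linarith)
lemma abs_cut'_le {a b : ℝ} (hab : a < b) (s : ℝ) : |cut' a b s| ≤ C0 / (b - a) := by
  have : 0 < b - a := by linarith
  unfold cut'
  rw [abs_div, abs_of_pos this]
  gcongr
  exact C0_spec _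
lemma cut'_zero {a b s : ℝ} (hab : a < b) (h : s ≤ a ∨ b ≤ s) : cut' a b s = 0 := by
  rcases h with h | h
  · have : IsLocalMin (cut a b) s := Eventually.of_forall fun y => by
      rw [cut_zero hab h]; exact cut_nonneg _ _ _
    exact this.hasDerivAt_eq_zero (hasDerivAt_cut a b s)
  · have : IsLocalMax (cut a b) s := Eventually.of_forall fun y => by
      rw [cut_one hab h]; exact cut_le_one _ _ _
    exact this.hasDerivAt_eq_zero (hasDerivAt_cut a b s)

/-- plateau function: `1` on `[p,q]`, `0` outside `[p-σ,q+σ]`. -/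
def plat (p q σ s : ℝ) : ℝ := cut (p - σ) p s * (1 - cut q (q + σ) s)
/-- its derivative. -/
def plat' (p q σ s : ℝ) : ℝ :=
  cut' (p - σ) p s * (1 - cut q (q + σ) s) - cut (p - σ) p s * cut' q (q + σ) s

variable {p q σ s : ℝ}

lemma hasDerivAt_plat (p q σ s : ℝ) : HasDerivAt (plat p q σ) (plat' p q σ s) s := by
  have := (hasDerivAt_cut (p - σ) p s).mul ((hasDerivAt_cut q (q + σ) s).const_sub 1)
  refine this.congr_deriv ?_
  unfold plat'; ring

lemma continuous_cut (a b : ℝ) : Continuous (cut a b) :=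
  continuous_iff_continuousAt.2 fun s => (hasDerivAt_cut a b s).continuousAt

lemma continuous_plat (p q σ : ℝ) : Continuous (plat p q σ) :=
  continuous_iff_continuousAt.2 fun s => (hasDerivAt_plat p q σ s).continuousAt

lemma continuous_plat' (p q σ : ℝ) : Continuous (plat' p q σ) := by
  unfold plat'
  have h1 := continuous_cut (p - σ) p
  have h2 := continuous_cut q (q + σ)
  have h3 := continuous_cut' (p - σ) p
  have h4 := continuous_cut' q (q + σ)
  fun_prop

lemma plat_nonneg (p q σ s : ℝ) : 0 ≤ plat p q σ s :=
  mul_nonneg (cut_nonneg _ _ _) (by linarith [cut_le_one q (q + σ) s])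
lemma plat_le_one (p q σ s : ℝ) : plat p q σ s ≤ 1 :=
  mul_le_one₀ (cut_le_one _ _ _) (by linarith [cut_le_one q (q + σ) s])
    (by linarith [cut_nonneg q (q + σ) s])
lemma plat_one (hσ : 0 < σ) (h1 : p ≤ s) (h2 : s ≤ q) : plat p q σ s = 1 := by
  unfold plat
  rw [cut_one (by linarith) h1, cut_zero (by linarith) h2]; norm_num
lemma plat_zero (hσ : 0 < σ) (h : s ≤ p - σ ∨ q + σ ≤ s) : plat p q σ s = 0 := by
  unfold plat
  rcases h with h | h
  · rw [cut_zero (by linarith) h]; simp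
  · rw [cut_one (a := q) (by linarith) h]; simp
lemma plat'_zero (hσ : 0 < σ) (h : s ≤ p - σ ∨ q + σ ≤ s ∨ (p ≤ s ∧ s ≤ q)) :
    plat' p q σ s = 0 := by
  unfold plat'
  rcases h with h | h | ⟨h1, h2⟩
  · rw [cut_zero (a := p - σ) (by linarith) h, cut'_zero (a := p - σ) (by linarith) (Or.inl h)]; simp
  · rw [cut_one (a := q) (by linarith) h, cut'_zero (a := q) (by linarith) (Or.inr h)]; simp
  · rw [cut'_zero (a := p - σ) (by linarith) (Or.inr h1),
      cut'_zero (a := q) (by linarith) (Or.inl h2)]; simp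
lemma abs_plat'_le (hσ : 0 < σ) : |plat' p q σ s| ≤ 2 * C0 / σ := by
  have h1 := abs_cut'_le (a := p - σ) (b := p) (by linarith) s
  have h2 := abs_cut'_le (a := q) (b := q + σ) (by linarith) s
  rw [show p - (p - σ) = σ by ring] at h1
  rw [show q + σ - q = σ by ring] at h2
  unfold plat'
  have a1 := cut_nonneg q (q + σ) s
  have a2 := cut_le_one q (q + σ) s
  have a3 := cut_nonneg (p - σ) p s
  have a4 := cut_le_one (p - σ) p s
  calc _ ≤ |cut' (p - σ) p s * (1 - cut q (q + σ) s)| + |cut (p - σ) p s * cut' q (q + σ) s| :=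
        abs_sub _ _
    _ ≤ C0 / σ * 1 + 1 * (C0 / σ) := by
        rw [abs_mul, abs_mul, abs_of_nonneg a3, abs_of_nonneg (by linarith : 0 ≤ 1 - cut q (q + σ) s)]
        have := C0_pos
        gcongr
        linarith
    _ = _ := by ring

end cuts

section bands

variable {m : ℕ} {W : Set (Euc m)} {η : Euc m → ℝ} {N : Euc m → Euc m} {K : ℝ}
  {u : Euc m → ℝ} {g : Euc m → Euc m} {B : Euc m → Euc m →L[ℝ] Euc m} {lam : ℝ}

lemma intOn_of_supp {f : Euc m → ℝ} (hW : IsOpen W) {S : Set (Euc m)} (hS : IsCompact S)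
    (hSW : S ⊆ W) (hf : ContinuousOn f W) (h0 : ∀ x ∈ W, x ∉ S → f x = 0) : IntegrableOn f W :=
  ((hf.mono hSW).integrableOn_compact hS).of_forall_sdiff_eq_zero hW.measurableSet
    fun x hx => h0 x hx.1 hx.2

/-- level band -/
def band (W : Set (Euc m)) (η : Euc m → ℝ) (a b : ℝ) : Set (Euc m) := {x ∈ W | a ≤ η x ∧ η x ≤ b}

lemma band_subset (a b : ℝ) : band W η a b ⊆ W := fun _ hx => hx.1

lemma band_mono {a b a' b' : ℝ} (h1 : a' ≤ a) (h2 : b ≤ b') : band W η a b ⊆ band W η a' b' :=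
  fun _ hx => ⟨hx.1, h1.trans hx.2.1, hx.2.2.trans h2⟩

lemma Fol.continuousOn (hf : Fol W η N K) : ContinuousOn η W :=
  fun _ hx => (hf.hasFDerivAt hx).continuousAt.continuousWithinAt
lemma Eig.continuousOn_u (hu : Eig W u g B lam) : ContinuousOn u W := hu.uL.continuousOn
lemma Eig.continuousOn_g (hu : Eig W u g B lam) : ContinuousOn g W := hu.gL.continuousOn

/-- Gradient estimate in a band. -/
lemma grad_band (hf : Fol W η N K) (hu : Eig W u g B lam) {p q σ : ℝ} (hσ : 0 < σ)
    (hlam : 0 ≤ lam) (hc : IsCompact (band W η (p - σ) (q + σ)))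
    (hc' : IsCompact (band W η p q)) :
    ∫ x in band W η p q, ‖g x‖ ^ 2 ≤
      (2 * lam + 4 * (2 * C0 / σ) ^ 2) * ∫ x in band W η (p - σ) (q + σ), u x ^ 2 := by
  set ω := plat p q σ with hω
  set ω' := plat' p q σ with hω'
  have hηc := hf.continuousOn
  have huc := hu.continuousOn_u
  have hgc := hu.continuousOn_g
  have hNc : ContinuousOn N W := hf.locLip_N.continuousOn
  have hωc : Continuous ω := continuous_plat p q σ
  have hω'c : Continuous ω' := continuous_plat' p q σ
  have cω := hωc.comp_continuousOn hηc
  have cω' := hω'c.comp_continuousOn hηc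
  set S := band W η (p - σ) (q + σ) with hSdef
  have hSW : S ⊆ W := band_subset _ _
  have hout : ∀ x ∈ W, x ∉ S → η x ≤ p - σ ∨ q + σ ≤ η x := by
    intro x hx hxS
    by_contra hcon
    push Not at hcon
    exact hxS ⟨hx, hcon.1.le, hcon.2.le⟩
  have hω0 : ∀ x ∈ W, x ∉ S → ω (η x) = 0 := fun x hx hxS => plat_zero hσ (hout x hx hxS)
  have hω'0 : ∀ x ∈ W, x ∉ S → ω' (η x) = 0 := fun x hx hxS => plat'_zero hσ (by
    rcases hout x hx hxS with h | h <;> tauto)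
  have hωC : ContDiff ℝ 1 (fun s => ω s ^ 2) := by
    have : ContDiff ℝ 1 ω := by
      rw [contDiff_one_iff_deriv]
      refine ⟨fun s => (hasDerivAt_plat p q σ s).differentiableAt, ?_⟩
      rwa [show deriv ω = ω' from funext fun s => (hasDerivAt_plat p q σ s).deriv]
    fun_prop
  obtain ⟨i1, i2, i3⟩ := div_ibp hf.op hc hSW (w := fun x => ω (η x) ^ 2)
    (P := fun x => (2 * ω (η x) * ω' (η x)) • N x) (V := fun x => u x • g x)
    (fun x hx => by
      have := ((hasDerivAt_plat p q σ (η x)).pow 2).comp_hasFDerivAt x (hf.hasFDerivAt hx)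
      refine this.congr_fderiv ?_
      ext v; simp [hω, hω'])
    (locLipOn_comp hf.op hf.locLip_eta hωC) (locLipOn_smul hf.op hu.uL hu.gL)
    (((continuousOn_const.mul cω).mul cω').smul hNc)
    (fun x hx hxS => by rw [hω0 x hx hxS]; simp)
  have hdv : ∀ x ∈ W, Dv (fderiv ℝ (fun x => u x • g x) x) = ‖g x‖ ^ 2 - lam * u x ^ 2 := by
    intro x hx
    have h := (hu.du x hx).smul (hu.dg x hx)
    have h' : HasFDerivAt (fun x => u x • g x) _ x := h
    rw [h'.fderiv, Dv_add, Dv_smul, Dv_smulRight, hu.tr x hx, innerSL_apply_apply,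
      real_inner_self_eq_norm_sq]
    ring
  have i4 : ∫ x in W, ω (η x) ^ 2 * Dv (fderiv ℝ (fun x => u x • g x) x) =
      ∫ x in W, ω (η x) ^ 2 * (‖g x‖ ^ 2 - lam * u x ^ 2) :=
    setIntegral_congr_fun hf.op.measurableSet fun x hx => by rw [hdv x hx]
  have j1 : IntegrableOn (fun x => ω (η x) ^ 2 * ‖g x‖ ^ 2) W :=
    intOn_of_supp hf.op hc hSW ((cω.pow 2).mul (hgc.norm.pow 2))
      (fun x hx hxS => by simp [hω0 x hx hxS])
  have j2 : IntegrableOn (fun x => (2 * lam * ω (η x) ^ 2 + 4 * ω' (η x) ^ 2) * u x ^ 2) W :=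
    intOn_of_supp hf.op hc hSW (((continuousOn_const.mul (cω.pow 2)).add
      (continuousOn_const.mul (cω'.pow 2))).mul (huc.pow 2))
      (fun x hx hxS => by simp [hω0 x hx hxS, hω'0 x hx hxS])
  have j3 : IntegrableOn (fun x => ω (η x) ^ 2 * (‖g x‖ ^ 2 - lam * u x ^ 2)) W :=
    intOn_of_supp hf.op hc hSW ((cω.pow 2).mul ((hgc.norm.pow 2).sub
      (continuousOn_const.mul (huc.pow 2)))) (fun x hx hxS => by simp [hω0 x hx hxS])
  have key : ∫ x in W, ω (η x) ^ 2 * ‖g x‖ ^ 2 ≤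
      ∫ x in W, (2 * lam * ω (η x) ^ 2 + 4 * ω' (η x) ^ 2) * u x ^ 2 := by
    have e1 : 0 ≤ ∫ x in W, ((2 * lam * ω (η x) ^ 2 + 4 * ω' (η x) ^ 2) * u x ^ 2
        - ω (η x) ^ 2 * ‖g x‖ ^ 2 + 2 * (ω (η x) ^ 2 * (‖g x‖ ^ 2 - lam * u x ^ 2) +
          ⟪(2 * ω (η x) * ω' (η x)) • N x, u x • g x⟫)) := by
      refine setIntegral_nonneg hf.op.measurableSet fun x hx => ?_
      rw [real_inner_smul_left, real_inner_smul_right]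
      have hp := abs_real_inner_le_norm (N x) (g x)
      rw [hf.unit x hx, one_mul] at hp
      have hp2 : ⟪N x, g x⟫ ^ 2 ≤ ‖g x‖ ^ 2 := sq_le_sq' (abs_le.1 hp).1 (abs_le.1 hp).2
      have : ω (η x) ^ 2 * ⟪N x, g x⟫ ^ 2 ≤ ω (η x) ^ 2 * ‖g x‖ ^ 2 := by gcongr
      nlinarith [sq_nonneg (2 * ω' (η x) * u x + ω (η x) * ⟪N x, g x⟫)]
    have e2 := integral_add (j2.sub j1) ((j3.add i2).const_mul 2)
    have e3 := integral_sub j2 j1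
    have e4 := integral_add j3 i2
    simp only [Pi.add_apply, Pi.sub_apply, integral_const_mul] at e2
    rw [e2, e3, e4] at e1
    rw [i4] at i3
    linarith
  have l1 : ∫ x in band W η p q, ‖g x‖ ^ 2 ≤ ∫ x in W, ω (η x) ^ 2 * ‖g x‖ ^ 2 := by
    calc _ = ∫ x in band W η p q, ω (η x) ^ 2 * ‖g x‖ ^ 2 := by
          refine setIntegral_congr_fun hc'.measurableSet fun x hx => ?_
          simp only [hω]
          rw [plat_one hσ hx.2.1 hx.2.2]; ring
      _ ≤ _ := setIntegral_mono_set j1 (Eventually.of_forall fun x => by positivity)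
          (band_subset p q).eventuallyLE
  have l2 : ∫ x in W, (2 * lam * ω (η x) ^ 2 + 4 * ω' (η x) ^ 2) * u x ^ 2 =
      ∫ x in S, (2 * lam * ω (η x) ^ 2 + 4 * ω' (η x) ^ 2) * u x ^ 2 := by
    refine setIntegral_eq_of_subset_of_forall_sdiff_eq_zero hf.op.measurableSet hSW fun x hx => ?_
    simp [hω0 x hx.1 hx.2, hω'0 x hx.1 hx.2]
  refine l1.trans (key.trans ?_)
  rw [l2, ← integral_const_mul]
  refine setIntegral_mono_on (j2.mono_set hSW)
    ((((huc.mono hSW).pow 2).integrableOn_compact hc).const_mul _) hc.measurableSet fun x hx => ?_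
  have a1 : ω (η x) ^ 2 ≤ 1 := by
    have := plat_nonneg p q σ (η x)
    have := plat_le_one p q σ (η x)
    exact pow_le_one₀ (by assumption) (by assumption)
  have a2 : ω' (η x) ^ 2 ≤ (2 * C0 / σ) ^ 2 := by
    have := abs_plat'_le (p := p) (q := q) (s := η x) hσ
    exact sq_le_sq' (abs_le.1 this).1 (abs_le.1 this).2
  refine mul_le_mul_of_nonneg_right ?_ (sq_nonneg _)
  linarith [mul_le_mul_of_nonneg_left a1 hlam]

/-- Interior Carleman estimate between bands. -/
lemma carleman_bands (hf : Fol W η N K) (hu : Eig W u g B lam) {τ γ Q σ : ℝ} (hσ : 0 < σ)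
    (hlam : 0 ≤ lam) (hτ1 : 1 ≤ τ) (hQ : Q = (2 + m) * (6 * K))
    (hγ : γ = 30 * Q) (hτQ : Q ≤ τ) (hlamτ : lam ≤ τ ^ 2) (hη0 : ∀ x ∈ W, 0 ≤ η x)
    (hη1 : ∀ x ∈ W, γ * η x ≤ 1)
    (hc : ∀ a b, σ ≤ a → b ≤ 9 * σ → IsCompact (band W η a b)) :
    1 / 2 * γ * cH τ γ (5 * σ) * ∫ x in band W η (5 * σ) (7 * σ), u x ^ 2 ≤
      (8 * C0 / σ) * (1 + (2 * lam + 4 * (2 * C0 / σ) ^ 2)) *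
      (cH τ γ (3 * σ) * (∫ x in band W η σ (4 * σ), u x ^ 2) +
       cH τ γ (8 * σ) * ∫ x in band W η (6 * σ) (9 * σ), u x ^ 2) := by
  have hτ : 0 < τ := by linarith
  have hηc := hf.continuousOn
  have huc := hu.continuousOn_u
  have hgc := hu.continuousOn_g
  have hKp := hf.Kpos
  have hQ0 : 0 < Q := by rw [hQ]; positivity
  have hγ0 : 0 ≤ γ := by rw [hγ]; positivity
  have hC0 := C0_pos
  set ω := plat (3 * σ) (7 * σ) σ with hω
  set ω' := plat' (3 * σ) (7 * σ) σ with hω'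
  set S := band W η (2 * σ) (8 * σ) with hS
  have hSc : IsCompact S := hc _ _ (by linarith) (by linarith)
  obtain ⟨i1, i2, i3⟩ := carleman_int hf hu hlam hτ hQ hγ hτQ hlamτ hη0 hη1
    (ω := ω) (ω' := ω') (hasDerivAt_plat _ _ _) (continuous_plat' _ _ _) (plat_nonneg _ _ _)
    hSc (band_subset _ _) (fun x hx hxS => plat_zero hσ (by
      by_contra hcon
      push Not at hcon
      exact hxS ⟨hx, by linarith [hcon.1], by linarith [hcon.2]⟩))
  -- lower bound
  have lo : τ * (1 / 2 * γ * cH τ γ (5 * σ) * ∫ x in band W η (5 * σ) (7 * σ), u x ^ 2) ≤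
      ∫ x in W, ω (η x) * (1 / 2 * γ * τ * cH τ γ (η x) * u x ^ 2) := by
    have hcb := hc (5 * σ) (7 * σ) (by linarith) (by linarith)
    calc _ = ∫ x in band W η (5 * σ) (7 * σ), 1 / 2 * γ * τ * cH τ γ (5 * σ) * u x ^ 2 := by
          rw [integral_const_mul]; ring
      _ ≤ ∫ x in band W η (5 * σ) (7 * σ), ω (η x) * (1 / 2 * γ * τ * cH τ γ (η x) * u x ^ 2) := by
          refine setIntegral_mono_on
            ((((huc.mono (band_subset _ _)).pow 2).integrableOn_compact hcb).const_mul _)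
            (i1.mono_set (band_subset _ _)) hcb.measurableSet fun x hx => ?_
          rw [hω, plat_one hσ (by linarith [hx.2.1]) hx.2.2, one_mul]
          have := cH_mono hτ hγ0 (mem_Ici.2 (by positivity : 0 ≤ 5 * σ)) (mem_Ici.2 (hη0 x hx.1)) hx.2.1
          gcongr
      _ ≤ _ := by
          refine setIntegral_mono_set i1 (Eventually.of_forall fun x => ?_)
            (band_subset _ _).eventuallyLE
          have := cH_pos τ γ (η x)
          have := plat_nonneg (3 * σ) (7 * σ) σ (η x)
          simp only [Pi.zero_apply]
          positivity
  -- upper bound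
  set f : Euc m → ℝ := fun x => u x ^ 2 + ‖g x‖ ^ 2 with hf'
  have hfc : ContinuousOn f W := (huc.pow 2).add (hgc.norm.pow 2)
  set b1 := band W η (2 * σ) (3 * σ) with hb1
  set b2 := band W η (7 * σ) (8 * σ) with hb2
  have hb1c : IsCompact b1 := hc _ _ (by linarith) (by linarith)
  have hb2c : IsCompact b2 := hc _ _ (by linarith) (by linarith)
  have fi1 : IntegrableOn f b1 := (hfc.mono (band_subset _ _)).integrableOn_compact hb1c
  have fi2 : IntegrableOn f b2 := (hfc.mono (band_subset _ _)).integrableOn_compact hb2c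
  set c := 2 * C0 / σ * (4 * τ) with hcdef
  have hc0 : 0 ≤ c := by positivity
  have hup : -∫ x in W, ω' (η x) * ⟪N x, cV τ γ (1 + Q / τ) lam η N u g x⟫ ≤
      c * cH τ γ (3 * σ) * (∫ x in b1, f x) + c * cH τ γ (8 * σ) * ∫ x in b2, f x := by
    have hF1 : IntegrableOn (b1.indicator fun x => c * cH τ γ (3 * σ) * f x) W :=
      ((integrable_indicator_iff hb1c.measurableSet).2 (fi1.const_mul _)).integrableOn
    have hF2 : IntegrableOn (b2.indicator fun x => c * cH τ γ (8 * σ) * f x) W :=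
      ((integrable_indicator_iff hb2c.measurableSet).2 (fi2.const_mul _)).integrableOn
    have e1 : ∫ x in W, b1.indicator (fun x => c * cH τ γ (3 * σ) * f x) x =
        c * cH τ γ (3 * σ) * ∫ x in b1, f x := by
      rw [setIntegral_indicator hb1c.measurableSet, inter_eq_right.2 (band_subset _ _),
        integral_const_mul]
    have e2 : ∫ x in W, b2.indicator (fun x => c * cH τ γ (8 * σ) * f x) x =
        c * cH τ γ (8 * σ) * ∫ x in b2, f x := by
      rw [setIntegral_indicator hb2c.measurableSet, inter_eq_right.2 (band_subset _ _),
        integral_const_mul]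
    rw [← e1, ← e2, ← integral_add hF1 hF2, ← integral_neg]
    refine setIntegral_mono_on i2.neg (hF1.add hF2) hf.op.measurableSet fun x hx => ?_
    have hn1 : 0 ≤ b1.indicator (fun x => c * cH τ γ (3 * σ) * f x) x :=
      indicator_nonneg (fun x _ => by have := cH_pos τ γ (3 * σ); positivity) x
    have hn2 : 0 ≤ b2.indicator (fun x => c * cH τ γ (8 * σ) * f x) x :=
      indicator_nonneg (fun x _ => by have := cH_pos τ γ (8 * σ); positivity) x
    have hpt : -(ω' (η x) * ⟪N x, cV τ γ (1 + Q / τ) lam η N u g x⟫) ≤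
        |ω' (η x)| * (4 * τ * cH τ γ (η x) * f x) := by
      refine (neg_le_abs _).trans ?_
      rw [abs_mul]
      gcongr
      refine abs_inner_cV_le hf hx hlam hτ1 hγ0 (by positivity) ?_ hlamτ (hη0 x hx) (hη1 x hx)
      have : Q / τ ≤ 1 := (div_le_one hτ).2 hτQ
      linarith
    refine hpt.trans ?_
    have hab := abs_plat'_le (p := 3 * σ) (q := 7 * σ) (s := η x) hσ
    have hfx : 0 ≤ f x := by positivity
    have hHx := cH_pos τ γ (η x)
    have hmain : ∀ t, η x ≤ t → |ω' (η x)| * (4 * τ * cH τ γ (η x) * f x) ≤ c * cH τ γ t * f x := by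
      intro t ht
      have := cH_mono hτ hγ0 (mem_Ici.2 (hη0 x hx)) (mem_Ici.2 ((hη0 x hx).trans ht)) ht
      calc _ ≤ 2 * C0 / σ * (4 * τ * cH τ γ t * f x) := by gcongr
        _ = _ := by rw [hcdef]; ring
    by_cases h1 : x ∈ b1
    · rw [indicator_of_mem h1]
      exact (hmain _ h1.2.2).trans (le_add_of_nonneg_right hn2)
    by_cases h2 : x ∈ b2
    · rw [indicator_of_mem h2]
      exact (hmain _ h2.2.2).trans (le_add_of_nonneg_left hn1)
    have : ω' (η x) = 0 := plat'_zero hσ (by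
      by_contra hcon
      push Not at hcon
      obtain ⟨c1, c2, c3⟩ := hcon
      by_cases h3 : 3 * σ ≤ η x
      · exact h2 ⟨hx, (c3 h3).le, by linarith⟩
      · exact h1 ⟨hx, by linarith, (not_le.1 h3).le⟩)
    rw [this]
    simp only [abs_zero, zero_mul]
    exact add_nonneg hn1 hn2
  have gb : ∀ p q p' q', p' = p - σ → q' = q + σ → σ ≤ p' → q' ≤ 9 * σ →
      ∫ x in band W η p q, f x ≤
      (1 + (2 * lam + 4 * (2 * C0 / σ) ^ 2)) * ∫ x in band W η p' q', u x ^ 2 := by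
    intro p q p' q' hp hq h1 h2
    have k1 := hc p q (by linarith) (by linarith)
    have k2 := hc p' q' h1 h2
    have ui : IntegrableOn (fun x => u x ^ 2) (band W η p' q') :=
      ((huc.mono (band_subset _ _)).pow 2).integrableOn_compact k2
    have hsub : band W η p q ⊆ band W η p' q' := band_mono (by linarith) (by linarith)
    have gi : IntegrableOn (fun x => ‖g x‖ ^ 2) (band W η p q) :=
      ((hgc.mono (band_subset _ _)).norm.pow 2).integrableOn_compact k1
    rw [hf']
    rw [integral_add (ui.mono_set hsub) gi, add_mul, one_mul]
    subst hp hq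
    refine add_le_add ?_ (grad_band hf hu hσ hlam k2 k1)
    exact setIntegral_mono_set ui (Eventually.of_forall fun x => by positivity) hsub.eventuallyLE
  have g1 := gb (2 * σ) (3 * σ) σ (4 * σ) (by ring) (by ring) le_rfl (by linarith)
  have g2 := gb (7 * σ) (8 * σ) (6 * σ) (9 * σ) (by ring) (by ring) (by linarith) le_rfl
  have hH3 := cH_pos τ γ (3 * σ)
  have hH8 := cH_pos τ γ (8 * σ)
  set D := 1 + (2 * lam + 4 * (2 * C0 / σ) ^ 2)
  refine le_of_mul_le_mul_left (lo.trans (i3.trans (hup.trans ?_))) hτ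
  calc _ ≤ c * cH τ γ (3 * σ) * (D * ∫ x in band W η σ (4 * σ), u x ^ 2) +
        c * cH τ γ (8 * σ) * (D * ∫ x in band W η (6 * σ) (9 * σ), u x ^ 2) := by gcongr
    _ = _ := by rw [hcdef]; ring

end bands

section threeball

variable {m : ℕ}

lemma norm_taylor {X Y : Euc m} {ρ : ℝ} (hρ : 0 < ρ) (hX : ρ ≤ ‖X‖) :
    |‖Y‖ - ‖X‖ - ⟪(1 / ‖X‖) • X, Y - X⟫| ≤ 1 / ρ * ‖Y - X‖ ^ 2 := by
  have hX0 : 0 < ‖X‖ := hρ.trans_le hX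
  have h1 : ‖Y‖ - ‖X‖ - ⟪(1 / ‖X‖) • X, Y - X⟫ = (‖X‖ * ‖Y‖ - ⟪X, Y⟫) / ‖X‖ := by
    rw [real_inner_smul_left, inner_sub_right, real_inner_self_eq_norm_sq]
    field_simp
    ring
  have h2 : 0 ≤ ‖X‖ * ‖Y‖ - ⟪X, Y⟫ := by linarith [real_inner_le_norm X Y]
  have h3 : ‖Y - X‖ ^ 2 = ‖Y‖ ^ 2 - 2 * ⟪X, Y⟫ + ‖X‖ ^ 2 := by
    rw [norm_sub_sq_real, real_inner_comm]
  have h4 : ‖X‖ * ‖Y‖ - ⟪X, Y⟫ ≤ ‖Y - X‖ ^ 2 := by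
    rw [h3]; nlinarith [sq_nonneg (‖X‖ - ‖Y‖)]
  rw [h1, abs_of_nonneg (by positivity)]
  calc (‖X‖ * ‖Y‖ - ⟪X, Y⟫) / ‖X‖ ≤ ‖Y - X‖ ^ 2 / ρ := by gcongr
    _ = _ := by ring

lemma fol_sphere {ρ R c : ℝ} (hρ : 0 < ρ) (z : Euc m) :
    Fol {x : Euc m | ρ < ‖x - z‖ ∧ ‖x - z‖ < R} (fun x => c - ‖x - z‖)
      (fun x => -((1 / ‖x - z‖) • (x - z))) (1 / ρ) where
  op := by
    have h : Continuous fun x : Euc m => ‖x - z‖ := by fun_prop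
    exact (isOpen_lt continuous_const h).inter (isOpen_lt h continuous_const)
  Kpos := by positivity
  unit x hx := by
    have : 0 < ‖x - z‖ := hρ.trans hx.1
    rw [norm_neg, norm_smul, Real.norm_of_nonneg (by positivity)]
    field_simp
  quad x hx y hy := by
    have := norm_taylor (Y := y - z) hρ hx.1.le
    rw [sub_sub_sub_cancel_right] at this
    rw [inner_neg_left, ← abs_neg]
    refine le_trans (le_of_eq ?_) this
    congr 1
    ring

/-- step size -/
def sg (m : ℕ) (ρ : ℝ) : ℝ := ρ / (1800 * (m + 2))

lemma sg_pos {ρ : ℝ} (hρ : 0 < ρ) : 0 < sg m ρ := by unfold sg; positivity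

lemma sg_le {ρ : ℝ} (hρ : 0 < ρ) : 20 * sg m ρ ≤ ρ := by
  unfold sg
  rw [mul_div_assoc', div_le_iff₀ (by positivity)]
  have : (0:ℝ) ≤ m := Nat.cast_nonneg m
  nlinarith

lemma three_ball_alg1 {γ a q v lam H3 H5 H8 e1 e2 Min I I8 I9 : ℝ} (hγ : 0 < γ) (ha : 0 ≤ a)
    (hq : 0 ≤ q) (hv : 0 ≤ v) (hlam : 0 ≤ lam) (h3 : 0 < H3) (h5 : 1 ≤ H5) (h8 : 0 < H8)
    (he1 : 0 < e1) (he2 : 0 < e2) (hM : 0 ≤ Min) (hI80 : 0 ≤ I8) (h8v : I8 ≤ v) (h9 : I9 ≤ Min)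
    (hg : H3 ≤ 2 * e1 * H5) (hg8 : H8 ≤ e2)
    (main : 1 / 2 * γ * H5 * I ≤ a * (1 + (2 * lam + q)) * (H3 * I8 + H8 * I9)) :
    I ≤ 2 / γ * a * (2 + q) * (2 * v + 1) * (1 + lam) * (e1 + e2 * Min) := by
  have h50 : 0 < H5 := by linarith
  have e : 0 ≤ e2 * Min := by positivity
  have s1 : H3 * I8 ≤ (2 * e1 * H5) * v := by gcongr
  have s2 : H8 * I9 ≤ (e2 * H5) * Min := by
    calc H8 * I9 ≤ H8 * Min := by gcongr
      _ ≤ e2 * H5 * Min := by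
        refine mul_le_mul_of_nonneg_right (hg8.trans ?_) hM
        exact le_mul_of_one_le_right he2.le h5
  have s3 : H3 * I8 + H8 * I9 ≤ H5 * ((2 * v + 1) * (e1 + e2 * Min)) := by
    have : H5 * ((2 * v + 1) * (e1 + e2 * Min)) = (2 * e1 * H5) * v + (e2 * H5) * Min
      + H5 * (e1 + 2 * v * (e2 * Min)) := by ring
    have : 0 ≤ H5 * (e1 + 2 * v * (e2 * Min)) := by positivity
    linarith
  have s4 : 1 + (2 * lam + q) ≤ (2 + q) * (1 + lam) := by nlinarith [mul_nonneg hq hlam]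
  have s5 : 1 / 2 * γ * H5 * I ≤ a * ((2 + q) * (1 + lam)) * (H5 * ((2 * v + 1) * (e1 + e2 * Min))) := by
    refine main.trans ?_
    have : 0 ≤ H5 * ((2 * v + 1) * (e1 + e2 * Min)) := by positivity
    exact (mul_le_mul_of_nonneg_left s3 (by positivity)).trans
      (mul_le_mul_of_nonneg_right (mul_le_mul_of_nonneg_left s4 ha) this)
  refine le_of_mul_le_mul_left (a := 1 / 2 * γ * H5) (s5.trans (le_of_eq ?_)) (by positivity)
  field_simp

lemma three_ball (m : ℕ) {ρ : ℝ} (hρ : 0 < ρ) : ∃ C : ℝ, 0 < C ∧ ∃ τ₀ : ℝ, 1 ≤ τ₀ ∧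
    ∀ (Ω : Set (Euc m)) (u : Euc m → ℝ) (g : Euc m → Euc m) (B : Euc m → Euc m →L[ℝ] Euc m)
      (lam τ : ℝ) (z : Euc m), Eig Ω u g B lam → 0 ≤ lam → τ₀ ≤ τ → lam ≤ τ ^ 2 →
      closedBall z (2 * ρ) ⊆ Ω → (∀ x ∈ Ω, |u x| ≤ 1) →
      ∫ x in closedBall z (ρ + 5 * sg m ρ), u x ^ 2 ≤
        C * (1 + lam) * (Real.exp (-(4 * sg m ρ * τ)) +
          Real.exp (24 * sg m ρ * τ) * ∫ x in closedBall z (ρ + 4 * sg m ρ), u x ^ 2) := by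
  set σ := sg m ρ with hσdef
  have hσ : 0 < σ := sg_pos hρ
  have hσρ : 20 * σ ≤ ρ := sg_le hρ
  set K := 1 / ρ with hK
  set Q := (2 + (m : ℝ)) * (6 * K) with hQ
  set γ := 30 * Q with hγ
  have hK0 : 0 < K := by positivity
  have hQ0 : 0 < Q := by positivity
  have hγ0 : 0 < γ := by positivity
  have hC0 := C0_pos
  set v := volume.real (closedBall (0 : Euc m) (2 * ρ)) with hv
  have hv0 : 0 ≤ v := measureReal_nonneg
  set q := 4 * (2 * C0 / σ) ^ 2 with hq
  have hq0 : 0 ≤ q := by positivity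
  set C1 := 2 / γ * (8 * C0 / σ) * (2 + q) * (2 * v + 1) with hC1
  have hC1' : 0 ≤ C1 := by positivity
  refine ⟨1 + C1, by positivity, max 1 Q, le_max_left _ _, ?_⟩
  intro Ω u g B lam τ z hu hlam hτ0 hlamτ hball hu1
  have hτ1 : 1 ≤ τ := (le_max_left _ _).trans hτ0
  have hτQ : Q ≤ τ := (le_max_right _ _).trans hτ0
  have hτ : 0 < τ := by linarith
  set W := {x : Euc m | ρ < ‖x - z‖ ∧ ‖x - z‖ < ρ + 10 * σ} with hW
  have hf : Fol W (fun x => (ρ + 10 * σ) - ‖x - z‖) (fun x => -((1 / ‖x - z‖) • (x - z))) K :=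
    fol_sphere hρ z
  have hWΩ : W ⊆ Ω := fun x hx => hball (by
    rw [mem_closedBall, dist_eq_norm]; linarith [hx.2])
  have hu' := hu.mono hf.op hWΩ
  have hcont : Continuous fun x : Euc m => ‖x - z‖ := by fun_prop
  have hband : ∀ a b, σ ≤ a → b ≤ 9 * σ →
      IsCompact (band W (fun x => (ρ + 10 * σ) - ‖x - z‖) a b) := by
    intro a b ha hb
    have : band W (fun x => (ρ + 10 * σ) - ‖x - z‖) a b =
        {x | a ≤ (ρ + 10 * σ) - ‖x - z‖ ∧ (ρ + 10 * σ) - ‖x - z‖ ≤ b} := by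
      ext x
      constructor
      · exact fun h => h.2
      · intro h
        have h1 := h.1
        have h2 := h.2
        exact ⟨⟨by linarith, by linarith⟩, h⟩
    rw [this]
    refine Metric.isCompact_of_isClosed_isBounded ?_ ?_
    · exact (isClosed_le continuous_const (continuous_const.sub hcont)).inter
        (isClosed_le (continuous_const.sub hcont) continuous_const)
    · refine (isBounded_closedBall (x := z) (r := 2 * ρ)).subset fun x hx => ?_
      rw [mem_closedBall, dist_eq_norm]
      linarith [hx.1]
  have main := carleman_bands hf hu' hσ hlam hτ1 hQ hγ hτQ hlamτ
    (fun x hx => by linarith [hx.2]) (fun x hx => by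
      have h1 : (ρ + 10 * σ) - ‖x - z‖ ≤ 10 * σ := by linarith [hx.1]
      calc γ * ((ρ + 10 * σ) - ‖x - z‖) ≤ γ * (10 * σ) := by gcongr
        _ = 1 := by
          rw [hγ, hQ, hK, hσdef]; unfold sg; field_simp; ring) hband
  have hintg : ∀ s ⊆ closedBall z (2 * ρ), IntegrableOn (fun x => u x ^ 2) s := fun s hs =>
    (((hu.continuousOn_u.mono hball).pow 2).integrableOn_compact (isCompact_closedBall _ _)).mono_set hs
  have hnn : ∀ s : Set (Euc m), 0 ≤ᵐ[volume.restrict s] fun x => u x ^ 2 := fun s =>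
    Eventually.of_forall fun x => sq_nonneg _
  set Min := ∫ x in closedBall z (ρ + 4 * σ), u x ^ 2 with hMin
  have hMin0 : 0 ≤ Min := integral_nonneg fun x => sq_nonneg _
  set b := fun p q => band W (fun x => (ρ + 10 * σ) - ‖x - z‖) p q with hb
  have m1 : ∫ x in b σ (4 * σ), u x ^ 2 ≤ v := by
    have hsub : b σ (4 * σ) ⊆ closedBall z (2 * ρ) := fun x hx => by
      rw [mem_closedBall, dist_eq_norm]; linarith [hx.1.2]
    calc _ ≤ ∫ x in closedBall z (2 * ρ), u x ^ 2 :=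
          setIntegral_mono_set (hintg _ subset_rfl) (hnn _) hsub.eventuallyLE
      _ ≤ ∫ x in closedBall z (2 * ρ), (1 : ℝ) := by
          refine setIntegral_mono_on (hintg _ subset_rfl)
            (integrableOn_const (isCompact_closedBall _ _).measure_lt_top.ne)
            measurableSet_closedBall fun x hx => ?_
          rw [← sq_abs]
          exact pow_le_one₀ (abs_nonneg _) (hu1 x (hball hx))
      _ = v := by
          rw [setIntegral_const, smul_eq_mul, mul_one, hv, measureReal_def, measureReal_def,
            Measure.addHaar_closedBall_center]
  have m2 : ∫ x in b (6 * σ) (9 * σ), u x ^ 2 ≤ Min := by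
    have hsub : b (6 * σ) (9 * σ) ⊆ closedBall z (ρ + 4 * σ) := fun x hx => by
      rw [mem_closedBall, dist_eq_norm]
      have := hx.2.1
      simp only at this
      linarith
    exact setIntegral_mono_set (hintg _ (closedBall_subset_closedBall (by linarith))) (hnn _)
      hsub.eventuallyLE
  have m3 : ∫ x in closedBall z (ρ + 5 * σ), u x ^ 2 ≤ Min + ∫ x in b (5 * σ) (7 * σ), u x ^ 2 := by
    have hbs : b (5 * σ) (7 * σ) ⊆ closedBall z (2 * ρ) := fun x hx => by
      rw [mem_closedBall, dist_eq_norm]; linarith [hx.1.2]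
    have hcs : closedBall z (ρ + 4 * σ) ⊆ closedBall z (2 * ρ) :=
      closedBall_subset_closedBall (by linarith)
    have hsub : closedBall z (ρ + 5 * σ) ⊆ closedBall z (ρ + 4 * σ) ∪ b (5 * σ) (7 * σ) := by
      intro x hx
      rw [mem_closedBall, dist_eq_norm] at hx
      by_cases h : ‖x - z‖ ≤ ρ + 4 * σ
      · left; rwa [mem_closedBall, dist_eq_norm]
      · push Not at h
        right
        exact ⟨⟨by linarith, by linarith⟩, by simp only; linarith, by simp only; linarith⟩
    calc _ ≤ ∫ x in closedBall z (ρ + 4 * σ) ∪ b (5 * σ) (7 * σ), u x ^ 2 :=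
          setIntegral_mono_set (hintg _ (union_subset hcs hbs)) (hnn _) hsub.eventuallyLE
      _ ≤ _ := by
          have hd : closedBall z (ρ + 4 * σ) ∪ b (5 * σ) (7 * σ) =
            closedBall z (ρ + 4 * σ) ∪ (b (5 * σ) (7 * σ) \ closedBall z (ρ + 4 * σ)) := by simp
          have hbm : MeasurableSet (b (5 * σ) (7 * σ)) :=
            (hband _ _ (by linarith) (by linarith)).measurableSet
          rw [hd, setIntegral_union disjoint_sdiff_right (hbm.diff measurableSet_closedBall)
            (hintg _ hcs) (hintg _ (diff_subset.trans hbs))]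
          refine add_le_add le_rfl ?_
          exact setIntegral_mono_set (hintg _ hbs) (hnn _) diff_subset.eventuallyLE
  have hH3 := cH_pos τ γ (3 * σ)
  have hH5 := cH_pos τ γ (5 * σ)
  have hH8 := cH_pos τ γ (8 * σ)
  have hg35 : cH τ γ (3 * σ) ≤ 2 * Real.exp (-(4 * σ * τ)) * cH τ γ (5 * σ) := by
    have h := cH_growth (s := 3 * σ) (t := 5 * σ) hτ hγ0.le (by positivity) (by linarith)
    rw [show 2 * τ * (5 * σ - 3 * σ) = 4 * σ * τ by ring] at h
    rw [Real.exp_neg]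
    have he := Real.exp_pos (4 * σ * τ)
    have : cH τ γ (3 * σ) ≤ (2 * cH τ γ (5 * σ)) / Real.exp (4 * σ * τ) := by
      rw [le_div_iff₀ he]; linarith
    refine this.trans (le_of_eq ?_)
    field_simp
  have hH51 : 1 ≤ cH τ γ (5 * σ) := by
    have := cH_mono hτ hγ0.le (mem_Ici.2 le_rfl) (mem_Ici.2 (by positivity : 0 ≤ 5 * σ))
      (by positivity : 0 ≤ 5 * σ)
    rwa [cH_zero] at this
  have hH8' : cH τ γ (8 * σ) ≤ Real.exp (24 * σ * τ) := by
    have : γ * (10 * σ) = 1 := by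
      rw [hγ, hQ, hK, hσdef]; unfold sg; field_simp; ring
    have h := cH_upper (γ := γ) (s := 8 * σ) hτ (by positivity) (by nlinarith)
    rwa [show 3 * τ * (8 * σ) = 24 * σ * τ by ring] at h
  set e1 := Real.exp (-(4 * σ * τ)) with he1
  set e2 := Real.exp (24 * σ * τ) with he2
  have he10 : 0 < e1 := Real.exp_pos _
  have he20 : 0 < e2 := Real.exp_pos _
  set I := ∫ x in b (5 * σ) (7 * σ), u x ^ 2 with hI
  have hI80 : 0 ≤ ∫ x in b σ (4 * σ), u x ^ 2 := integral_nonneg fun x => sq_nonneg _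
  have k2 : I ≤ C1 * (1 + lam) * (e1 + e2 * Min) :=
    three_ball_alg1 hγ0 (by positivity) hq0 hv0 hlam hH3 hH51 hH8 he10 he20 hMin0 hI80 m1 m2
      hg35 hH8' main
  have he2' : 1 ≤ e2 := Real.one_le_exp (by positivity)
  have k3 : Min ≤ (1 + lam) * (e1 + e2 * Min) := by
    clear_value Min e1 e2
    clear main hband
    have h1 : Min ≤ e2 * Min := le_mul_of_one_le_left hMin0 he2'
    calc Min ≤ 1 * (e1 + e2 * Min) := by linarith
      _ ≤ _ := by
        have : 0 ≤ e1 + e2 * Min := by linarith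
        exact mul_le_mul_of_nonneg_right (by linarith) this
  calc _ ≤ Min + I := m3
    _ ≤ (1 + lam) * (e1 + e2 * Min) + C1 * (1 + lam) * (e1 + e2 * Min) := add_le_add k3 k2
    _ = _ := by ring

lemma three_ball_step (m : ℕ) {ρ : ℝ} (hρ : 0 < ρ) (A : ℝ) : ∃ A' : ℝ, A ≤ A' ∧
    ∀ (Ω : Set (Euc m)) (u : Euc m → ℝ) (g : Euc m → Euc m) (B : Euc m → Euc m →L[ℝ] Euc m)
      (lam : ℝ) (z : Euc m), Eig Ω u g B lam → 0 ≤ lam →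
      closedBall z (2 * ρ) ⊆ Ω → (∀ x ∈ Ω, |u x| ≤ 1) →
      Real.exp (-(A * (1 + √lam))) ≤ ∫ x in closedBall z (ρ + 5 * sg m ρ), u x ^ 2 →
      Real.exp (-(A' * (1 + √lam))) ≤ ∫ x in closedBall z (ρ + 4 * sg m ρ), u x ^ 2 := by
  obtain ⟨C, hC, τ₀, hτ₀, H⟩ := three_ball m hρ
  have hσ : 0 < sg m ρ := sg_pos hρ
  set σ := sg m ρ
  set T := max τ₀ ((C + 3 + A) / (4 * σ)) with hT
  have hT1 : τ₀ ≤ T := le_max_left _ _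
  have hT2 : C + 3 + A ≤ 4 * σ * T := by
    have : (C + 3 + A) / (4 * σ) ≤ T := le_max_right _ _
    rw [div_le_iff₀ (by positivity)] at this
    linarith
  refine ⟨A + 3 + C + 24 * σ * T, by nlinarith, ?_⟩
  intro Ω u g B lam z hu hlam hball hu1 hA
  set s := 1 + √lam with hs
  have hsq := Real.sqrt_nonneg lam
  have hs1 : 1 ≤ s := by linarith
  have hsl : √lam ^ 2 = lam := Real.sq_sqrt hlam
  have hls : 1 + lam ≤ s ^ 2 := by nlinarith
  have hτ1 : τ₀ ≤ T * s := by nlinarith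
  have hτ2 : lam ≤ (T * s) ^ 2 := by
    have : 1 ≤ T := hτ₀.trans hT1
    have : s ≤ T * s := by nlinarith
    nlinarith
  have h := hA.trans (H Ω u g B lam (T * s) z hu hlam hτ1 hτ2 hball hu1)
  set Min := ∫ x in closedBall z (ρ + 4 * σ), u x ^ 2
  have hMin0 : 0 ≤ Min := integral_nonneg fun x => sq_nonneg _
  have hCs : C ≤ Real.exp (C * s) := by
    have := Real.add_one_le_exp (C * s)
    nlinarith
  have hss : 1 + lam ≤ Real.exp (2 * s) := by
    have : s ≤ Real.exp s := by linarith [Real.add_one_le_exp s]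
    calc 1 + lam ≤ s ^ 2 := hls
      _ ≤ Real.exp s ^ 2 := by gcongr
      _ = _ := by rw [← Real.exp_nat_mul]; norm_num
  have h2s : 2 ≤ Real.exp s := by
    linarith [Real.add_one_le_exp s]
  have hCl : C * (1 + lam) ≤ Real.exp ((C + 2) * s) := by
    calc C * (1 + lam) ≤ Real.exp (C * s) * Real.exp (2 * s) := by gcongr
      _ = _ := by rw [← Real.exp_add]; congr 1; ring
  have a1 : 2 * (C * (1 + lam) * Real.exp (-(4 * σ * (T * s)))) ≤ Real.exp (-(A * s)) := by
    calc _ ≤ Real.exp s * (Real.exp ((C + 2) * s) * Real.exp (-(4 * σ * (T * s)))) := by gcongr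
      _ = Real.exp ((C + 3 - 4 * σ * T) * s) := by
          rw [← Real.exp_add, ← Real.exp_add]; congr 1; ring
      _ ≤ _ := by
          apply Real.exp_le_exp.2
          nlinarith
  have a2 : Real.exp (-(A * s)) ≤ 2 * (C * (1 + lam) * Real.exp (24 * σ * (T * s)) * Min) := by
    have e : ∀ E1 E2 : ℝ, C * (1 + lam) * (E1 + E2 * Min) = C * (1 + lam) * E1 + C * (1 + lam) * E2 * Min :=
      fun _ _ => by ring
    rw [e] at h
    linarith
  have a3 : 2 * (C * (1 + lam) * Real.exp (24 * σ * (T * s)) * Min) ≤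
      Real.exp ((C + 3 + 24 * σ * T) * s) * Min := by
    calc _ ≤ Real.exp s * (Real.exp ((C + 2) * s) * Real.exp (24 * σ * (T * s)) * Min) := by gcongr
      _ = _ := by
          rw [← mul_assoc, ← mul_assoc, ← Real.exp_add, ← Real.exp_add]; congr 2; ring
  have a4 := a2.trans a3
  have : Real.exp (-((A + 3 + C + 24 * σ * T) * s)) =
      Real.exp (-((C + 3 + 24 * σ * T) * s)) * Real.exp (-(A * s)) := by
    rw [← Real.exp_add]; congr 1; ring
  rw [this]
  calc _ ≤ Real.exp (-((C + 3 + 24 * σ * T) * s)) * (Real.exp ((C + 3 + 24 * σ * T) * s) * Min) := by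
        gcongr
    _ = Min := by
        rw [← mul_assoc, ← Real.exp_add]; simp

end threeball

section chain

lemma chain_count {X : Type*} [MetricSpace X] {E : Set X} (hE : IsPreconnected E) {σ : ℝ}
    (T : Finset X) (hT : ∀ x ∈ E, ∃ t ∈ T, dist x t < σ / 2) (P : ℕ → X → Prop)
    (hmono : ∀ k z, P k z → P (k + 1) z)
    (hstep : ∀ k, ∀ z ∈ E, ∀ z' ∈ E, P k z → dist z z' ≤ σ → P (k + 1) z')
    {x : X} (hx : x ∈ E) (h0 : P 0 x) {n : ℕ} (hn : T.card + 1 ≤ n) : ∀ y ∈ E, P n y := by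
  classical
  have hm : ∀ k l z, k ≤ l → P k z → P l z := by
    intro k l z hkl
    induction hkl with
    | refl => exact id
    | step _ ih => exact fun h => hmono _ _ (ih h)
  let S : ℕ → Finset X := fun k => T.filter fun t => ∃ z ∈ E, dist z t < σ / 2 ∧ P k z
  have hSm : ∀ k, S k ⊆ S (k + 1) := by
    intro k t ht
    simp only [S, Finset.mem_filter] at ht ⊢
    obtain ⟨h1, z, h2, h3, h4⟩ := ht
    exact ⟨h1, z, h2, h3, hmono _ _ h4⟩
  have hex : ∃ k ≤ T.card, S k = S (k + 1) := by
    by_contra hcon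
    push Not at hcon
    have hcard : ∀ k ≤ T.card + 1, k ≤ (S k).card := by
      intro k
      induction k with
      | zero => intro _; exact Nat.zero_le _
      | succ k ih =>
        intro hk
        have h1 := ih (by omega)
        have h2 : S k ⊂ S (k + 1) := (hSm k).ssubset_of_ne (hcon k (by omega))
        have := Finset.card_lt_card h2
        omega
    have h1 := hcard (T.card + 1) le_rfl
    have h2 : (S (T.card + 1)).card ≤ T.card := Finset.card_le_card (Finset.filter_subset _ _)
    omega
  obtain ⟨k, hk, hSk⟩ := hex
  let U : Set X := ⋃ t ∈ S k, ball t (σ / 2)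
  let V : Set X := ⋃ t ∈ T \ S k, ball t (σ / 2)
  have hU : IsOpen U := isOpen_biUnion fun _ _ => isOpen_ball
  have hV : IsOpen V := isOpen_biUnion fun _ _ => isOpen_ball
  have hUP : ∀ y ∈ E, y ∈ U → P (k + 1) y := by
    intro y hy hyU
    simp only [U, mem_iUnion, exists_prop] at hyU
    obtain ⟨t, ht, hyt⟩ := hyU
    simp only [S, Finset.mem_filter] at ht
    obtain ⟨_, z, hz, hzt, hPz⟩ := ht
    refine hstep k z hz y hy hPz ?_
    rw [mem_ball] at hyt
    have := dist_triangle_right z y t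
    linarith
  have hcov : E ⊆ U ∪ V := by
    intro y hy
    obtain ⟨t, ht, hyt⟩ := hT y hy
    by_cases h : t ∈ S k
    · left; exact mem_biUnion h hyt
    · right
      refine mem_biUnion (x := t) ?_ hyt
      simp [ht, h]
  have hdisj : E ∩ (U ∩ V) = ∅ := by
    rw [Set.eq_empty_iff_forall_notMem]
    rintro y ⟨hy, hyU, hyV⟩
    have hP := hUP y hy hyU
    simp only [V, mem_iUnion, exists_prop] at hyV
    obtain ⟨t, ht, hyt⟩ := hyV
    rw [Finset.mem_sdiff] at ht
    apply ht.2
    rw [hSk]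
    simp only [S, Finset.mem_filter]
    exact ⟨ht.1, y, hy, hyt, hP⟩
  have hxU : x ∈ U := by
    obtain ⟨t, ht, hxt⟩ := hT x hx
    refine mem_biUnion (x := t) ?_ hxt
    simp only [S, Finset.coe_filter]
    exact ⟨ht, x, hx, hxt, hm 0 k x (Nat.zero_le _) h0⟩
  intro y hy
  have hyU : y ∈ U := by
    by_contra hyU
    have hyV : y ∈ V := (hcov hy).resolve_left hyU
    have := hE U V hU hV hcov ⟨x, hx, hxU⟩ ⟨y, hy, hyV⟩
    rw [hdisj] at this
    exact Set.not_nonempty_empty this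
  exact hm (k + 1) n y (by omega) (hUP y hy hyU)

lemma chain_mass (m : ℕ) {ρ : ℝ} (hρ : 0 < ρ) (D A : ℝ) : ∃ A' : ℝ, 
    ∀ (Ω : Set (Euc m)) (u : Euc m → ℝ) (g : Euc m → Euc m) (B : Euc m → Euc m →L[ℝ] Euc m)
      (lam : ℝ) (E : Set (Euc m)), Eig Ω u g B lam → 0 ≤ lam →
      (∀ x ∈ Ω, |u x| ≤ 1) → IsPreconnected E → (∀ z ∈ E, closedBall z (2 * ρ) ⊆ Ω) →
      (∀ x ∈ E, ∀ y ∈ E, dist x y ≤ D) → ∀ x ∈ E,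
      Real.exp (-(A * (1 + √lam))) ≤ ∫ x in closedBall x (ρ + 4 * sg m ρ), u x ^ 2 → ∀ y ∈ E,
      Real.exp (-(A' * (1 + √lam))) ≤ ∫ x in closedBall y (ρ + 4 * sg m ρ), u x ^ 2 := by
  classical
  choose F hF1 hF2 using three_ball_step m hρ
  have hσ : 0 < sg m ρ := sg_pos hρ
  have hσρ := sg_le (m := m) hρ
  set σ := sg m ρ
  obtain ⟨t, -, htf, htc⟩ := (isCompact_closedBall (0 : Euc m) D).finite_cover_balls
    (half_pos hσ)
  set T0 := htf.toFinset
  refine ⟨F^[T0.card + 1] A, ?_⟩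
  intro Ω u g B lam E hu hlam hu1 hE hball hD x hx hmass
  have hs : 0 ≤ 1 + √lam := by positivity
  refine chain_count hE (σ := σ) (T0.image fun v => x + v) ?_
    (fun k z => Real.exp (-(F^[k] A * (1 + √lam))) ≤ ∫ x in closedBall z (ρ + 4 * σ), u x ^ 2)
    ?_ ?_ hx ?_ (Nat.add_le_add_right Finset.card_image_le 1)
  · intro y hy
    have : y - x ∈ closedBall (0 : Euc m) D := by
      rw [mem_closedBall, dist_zero_right, ← dist_eq_norm]; exact hD y hy x hx
    have := htc this
    simp only [mem_iUnion, exists_prop] at this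
    obtain ⟨v, hv, hyv⟩ := this
    refine ⟨x + v, Finset.mem_image.2 ⟨v, htf.mem_toFinset.2 hv, rfl⟩, ?_⟩
    rw [mem_ball, dist_eq_norm] at hyv
    rw [dist_eq_norm]
    rwa [show y - (x + v) = y - x - v by abel]
  · intro k z hz
    refine le_trans (Real.exp_le_exp.2 ?_) hz
    rw [Function.iterate_succ_apply']
    have := hF1 (F^[k] A)
    nlinarith
  · intro k z hz z' hz' hP hzz
    rw [Function.iterate_succ_apply']
    refine hF2 _ Ω u g B lam z' hu hlam (hball z' hz') hu1 (hP.trans ?_)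
    refine setIntegral_mono_set ?_ (Eventually.of_forall fun x => sq_nonneg _) ?_
    · refine (((hu.continuousOn_u.mono (hball z' hz')).pow 2).integrableOn_compact
        (isCompact_closedBall _ _)).mono_set (closedBall_subset_closedBall ?_)
      linarith
    · refine (closedBall_subset_closedBall' ?_).eventuallyLE
      linarith
  · simpa using hmass

end chain

section geometry

lemma snocVec_castSucc {n : ℕ} (v : Euc n) (a : ℝ) (i : Fin n) : snocVec v a i.castSucc = v i := by
  simp [snocVec, Fin.castSucc_ne_last]

lemma snocVec_last {n : ℕ} (v : Euc n) (a : ℝ) : snocVec v a (Fin.last n) = a := by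
  simp [snocVec]

lemma front_snocVec {n : ℕ} (v : Euc n) (a : ℝ) : front (snocVec v a) = v := by
  ext i
  simp [front, snocVec_castSucc]

lemma lastc_snocVec {n : ℕ} (v : Euc n) (a : ℝ) : lastc (snocVec v a) = a := by
  simp [lastc, snocVec_last]

lemma inner_snoc {n : ℕ} (x y : Euc (n + 1)) :
    ⟪x, y⟫ = ⟪front x, front y⟫ + lastc x * lastc y := by
  simp [PiLp.inner_apply, Fin.sum_univ_castSucc, front, lastc, mul_comm]

lemma norm_sq_snoc {n : ℕ} (x : Euc (n + 1)) : ‖x‖ ^ 2 = ‖front x‖ ^ 2 + lastc x ^ 2 := by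
  rw [← real_inner_self_eq_norm_sq, ← real_inner_self_eq_norm_sq, inner_snoc]; ring

lemma front_sub {n : ℕ} (x y : Euc (n + 1)) : front (x - y) = front x - front y := by
  ext i; simp [front]

lemma lastc_sub {n : ℕ} (x y : Euc (n + 1)) : lastc (x - y) = lastc x - lastc y := by
  simp [lastc]

/-- Two-sided ball condition with inward normal `nu`. -/
structure TB {m : ℕ} (Ω : Set (Euc m)) (R : ℝ) (nu : Euc m → Euc m) : Prop where
  op : IsOpen Ω
  bdd : Bornology.IsBounded Ω
  ne : Ω.Nonempty
  cne : Ωᶜ.Nonempty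
  Rpos : 0 < R
  unit : ∀ p ∈ frontier Ω, ‖nu p‖ = 1
  inn : ∀ p ∈ frontier Ω, ball (p + R • nu p) R ⊆ Ω
  out : ∀ p ∈ frontier Ω, ∀ x ∈ ball (p - R • nu p) R, x ∉ Ω

lemma c11_quad {n : ℕ} {M : ℝ≥0} {f : Euc n → ℝ} (hf : IsC11FunWith M f) (h0 : f 0 = 0) (y : Euc n) :
    |f y - fderiv ℝ f 0 y| ≤ M * ‖y‖ ^ 2 := by
  have hc : Convex ℝ (closedBall (0 : Euc n) ‖y‖) := convex_closedBall _ _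
  have := hc.norm_image_sub_le_of_norm_hasFDerivWithin_le' (f := f) (f' := fderiv ℝ f)
    (φ := fderiv ℝ f 0) (C := M * ‖y‖) (x := 0) (y := y)
    (fun x _ => (hf.1 x).hasFDerivAt.hasFDerivWithinAt) (fun x hx => by
      have h1 := hf.2.2.dist_le_mul x 0
      rw [dist_eq_norm] at h1
      rw [mem_closedBall] at hx
      refine h1.trans ?_
      gcongr) (by simp) (by simp)
  rw [h0] at this
  simp only [sub_zero, Real.norm_eq_abs] at this
  refine this.trans (le_of_eq (by ring))

lemma mem_ball_unit {m : ℕ} {e y : Euc m} {R : ℝ} (he : ‖e‖ = 1) (hR : 0 < R) :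
    y ∈ ball (R • e) R ↔ ‖y‖ ^ 2 < 2 * R * ⟪e, y⟫ := by
  have h : ‖y - R • e‖ ^ 2 = ‖y‖ ^ 2 - 2 * R * ⟪e, y⟫ + R ^ 2 := by
    rw [norm_sub_sq_real, norm_smul, he, inner_smul_right, real_inner_comm, Real.norm_of_nonneg hR.le]
    ring
  rw [mem_ball, dist_eq_norm, ← sq_lt_sq₀ (norm_nonneg _) hR.le, h]
  constructor <;> intro h <;> linarith

lemma graph_two_ball {n : ℕ} {Ω : Set (Euc (n + 1))} {p : Euc (n + 1)} {ρ R : ℝ} {M : ℝ≥0}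
    (hρ : 0 < ρ) (h : IsGraphBall Ω p ρ (IsC11FunWith M)) (hR : 0 < R) (hRρ : 2 * R ≤ ρ)
    (hRM : 2 * R * M ≤ 1) : ∃ e : Euc (n + 1), ‖e‖ = 1 ∧ ball (p + R • e) R ⊆ Ω ∧
      ∀ x ∈ ball (p - R • e) R, x ∉ Ω := by
  obtain ⟨T, f, hf, hT0, hf0, hΩ⟩ := h
  set a : Euc n := (InnerProductSpace.toDual ℝ (Euc n)).symm (fderiv ℝ f 0) with ha
  have hau : ∀ y, fderiv ℝ f 0 y = ⟪a, y⟫ := fun y => by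
    rw [ha, InnerProductSpace.toDual_symm_apply]
  set s := ‖snocVec (-a) 1‖ with hs
  have hs2 : s ^ 2 = ‖a‖ ^ 2 + 1 := by rw [hs, norm_sq_snoc, front_snocVec, lastc_snocVec]; simp
  have hs1 : 1 ≤ s := by
    have : 0 ≤ s := norm_nonneg _
    nlinarith [sq_nonneg ‖a‖]
  have hs0 : 0 < s := by linarith
  set e0 : Euc (n + 1) := (1 / s) • snocVec (-a) 1 with he0
  have he0n : ‖e0‖ = 1 := by
    rw [he0, norm_smul, ← hs, Real.norm_of_nonneg (by positivity)]; field_simp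
  have he0i : ∀ y, s * ⟪e0, y⟫ = lastc y - fderiv ℝ f 0 (front y) := by
    intro y
    rw [he0, real_inner_smul_left, inner_snoc, front_snocVec, lastc_snocVec, hau, inner_neg_left]
    field_simp
    ring
  set L := T.linearIsometryEquiv with hL
  have hTy : ∀ y, T y = p + L y := by
    intro y
    have := T.map_vadd 0 y
    simp only [vadd_eq_add, add_zero, hT0] at this
    exact this.trans (add_comm _ _)
  have hfr : ∀ y : Euc (n + 1), ‖front y‖ ^ 2 ≤ ‖y‖ ^ 2 := fun y => by
    rw [norm_sq_snoc]; nlinarith [sq_nonneg (lastc y)]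
  have hM0 : (0:ℝ) ≤ M := M.2
  have key : ∀ (k y : ℝ), 0 ≤ y → y < 2 * R * k → M * y < s * k := by
    intro k y hy hyk
    have hk : 0 < k := by
      by_contra hk
      push Not at hk
      nlinarith
    have h1 : M * y ≤ M * (2 * R * k) := by gcongr
    rcases eq_or_lt_of_le hM0 with h0 | h0
    · rw [← h0]; simp; positivity
    · have h2 : M * y < M * (2 * R * k) := by gcongr
      have h3 : M * (2 * R * k) ≤ k := by
        calc _ = (2 * R * M) * k := by ring
          _ ≤ 1 * k := by gcongr
          _ = k := one_mul k
      nlinarith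
  refine ⟨L e0, by rw [LinearIsometryEquiv.norm_map, he0n], ?_, ?_⟩
  · intro x hx
    obtain ⟨y, rfl⟩ := T.surjective x
    have hy : y ∈ ball (R • e0) R := by
      rw [mem_ball, dist_eq_norm] at hx ⊢
      rwa [hTy, add_sub_add_left_eq_sub, ← map_smul, ← map_sub, LinearIsometryEquiv.norm_map] at hx
    have hyρ : y ∈ ball (0 : Euc (n + 1)) ρ := by
      rw [mem_ball, dist_zero_right]
      rw [mem_ball, dist_eq_norm] at hy
      have h2 : ‖R • e0‖ = R := by rw [norm_smul, he0n, Real.norm_of_nonneg hR.le, mul_one]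
      have := norm_add_le (y - R • e0) (R • e0)
      rw [sub_add_cancel] at this
      linarith
    rw [mem_ball_unit he0n hR] at hy
    have h1 := c11_quad hf hf0 (front y)
    have h2 := key _ _ (by positivity) hy
    have h3 := he0i y
    have h4 : M * ‖front y‖ ^ 2 ≤ M * ‖y‖ ^ 2 := mul_le_mul_of_nonneg_left (hfr y) hM0
    have h5 := (abs_le.1 h1).2
    have : T y ∈ Ω ∩ ball p ρ := by
      rw [hΩ]
      exact ⟨y, ⟨hyρ, by linarith⟩, rfl⟩
    exact this.1
  · intro x hx hxΩ
    obtain ⟨y, rfl⟩ := T.surjective x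
    have hy : -y ∈ ball (R • e0) R := by
      rw [mem_ball, dist_eq_norm] at hx ⊢
      rwa [hTy, sub_eq_add_neg p, add_sub_add_left_eq_sub, ← map_smul, ← map_neg, ← map_sub,
        LinearIsometryEquiv.norm_map, sub_neg_eq_add, ← norm_neg,
        show -(y + R • e0) = -y - R • e0 by abel] at hx
    have hyρ : y ∈ ball (0 : Euc (n + 1)) ρ := by
      rw [mem_ball, dist_zero_right, ← norm_neg]
      rw [mem_ball, dist_eq_norm] at hy
      have h2 : ‖R • e0‖ = R := by rw [norm_smul, he0n, Real.norm_of_nonneg hR.le, mul_one]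
      have := norm_add_le (-y - R • e0) (R • e0)
      rw [sub_add_cancel] at this
      linarith
    rw [mem_ball_unit he0n hR, norm_neg, inner_neg_right] at hy
    have h1 := c11_quad hf hf0 (front y)
    have h2 := key _ _ (by positivity) hy
    have h3 := he0i y
    have h4 : M * ‖front y‖ ^ 2 ≤ M * ‖y‖ ^ 2 := mul_le_mul_of_nonneg_left (hfr y) hM0
    have h5 := (abs_le.1 h1).1
    have hball : T y ∈ ball p ρ := by
      rw [mem_ball, dist_eq_norm, hTy, add_sub_cancel_left, LinearIsometryEquiv.norm_map]
      simpa using hyρ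
    have : T y ∈ Ω ∩ ball p ρ := ⟨hxΩ, hball⟩
    rw [hΩ] at this
    obtain ⟨y', hy', hyy⟩ := this
    obtain rfl := T.injective hyy
    linarith [hy'.2]

lemma exists_frontier_segment {m : ℕ} {Ω : Set (Euc m)} {a b : Euc m} (ha : a ∈ Ω) (hb : b ∉ Ω) :
    ∃ q ∈ segment ℝ a b, q ∈ frontier Ω := by
  have hc : IsPreconnected (segment ℝ a b) := (convex_segment a b).isPreconnected
  by_contra hcon
  push Not at hcon
  have hfr : ∀ q ∈ segment ℝ a b, q ∈ interior Ω ∨ q ∈ (closure Ω)ᶜ := by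
    intro q hq
    by_contra h
    push Not at h
    exact hcon q hq ⟨notMem_compl_iff.1 h.2, h.1⟩
  have ha' : a ∈ interior Ω := (hfr a (left_mem_segment ℝ a b)).resolve_right
    fun h => h (subset_closure ha)
  have hb' : b ∈ (closure Ω)ᶜ := (hfr b (right_mem_segment ℝ a b)).resolve_left
    fun h => hb (interior_subset h)
  obtain ⟨q, -, hq1, hq2⟩ := hc _ _ isOpen_interior isClosed_closure.isOpen_compl
    (fun q hq => hfr q hq) ⟨a, left_mem_segment ℝ a b, ha'⟩ ⟨b, right_mem_segment ℝ a b, hb'⟩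
  exact hq2 (subset_closure (interior_subset hq1))

set_option maxHeartbeats 1000000 in
lemma normal_eq {m : ℕ} {Ω : Set (Euc m)} {p ν e : Euc m} {R : ℝ} (hR : 0 < R) (he : ‖e‖ = 1)
    (hin : ball (p + R • e) R ⊆ Ω) (hout : ∀ x ∈ ball (p - R • e) R, x ∉ Ω)
    (hν : OutwardNormalAt Ω p ν) : ν = -e := by
  obtain ⟨hν1, -, hν3, hν4⟩ := hν
  set κ := ⟪ν, e⟫ with hκ
  set w := ν - κ • e with hw
  have hee : ⟪e, e⟫ = 1 := by rw [real_inner_self_eq_norm_sq, he, one_pow]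
  have hwe : ⟪e, w⟫ = 0 := by
    rw [hw, inner_sub_right, inner_smul_right, hee, real_inner_comm, ← hκ]; ring
  have hνw : ⟪ν, w⟫ = ‖w‖ ^ 2 := by
    have : ν = w + κ • e := by rw [hw]; abel
    conv_lhs => rw [this]
    rw [inner_add_left, inner_smul_left, hwe, real_inner_self_eq_norm_sq]; simp
  have hκ1 : |κ| ≤ 1 := by
    have := abs_real_inner_le_norm ν e
    rwa [hν1, he, mul_one] at this
  have hw1 : ‖w‖ ≤ 1 := by
    have h1 := real_inner_le_norm ν w
    rw [hνw, hν1, one_mul] at h1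
    nlinarith [norm_nonneg w]
  have hw0 : w = 0 := by
    by_contra hne
    have hwp : 0 < ‖w‖ ^ 2 := by positivity
    have h1 := hν4.def (c := ‖w‖ ^ 2 / 8) (by positivity)
    rw [eventually_nhdsWithin_iff, Metric.eventually_nhds_iff] at h1
    obtain ⟨δ, hδ, h1⟩ := h1
    set t := min (δ / 4) (min (R / 2) (R * ‖w‖ ^ 2 / 4)) with ht
    have ht0 : 0 < t := by positivity
    have ht1 : t ≤ δ / 4 := min_le_left _ _
    have ht2 : t ≤ R / 2 := (min_le_right _ _).trans (min_le_left _ _)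
    have ht3 : t ≤ R * ‖w‖ ^ 2 / 4 := (min_le_right _ _).trans (min_le_right _ _)
    have hts : t ^ 2 / R ≤ t / 2 := by
      rw [div_le_iff₀ hR]; nlinarith
    have hcalc : ‖t • w + (t ^ 2 / R) • e‖ ^ 2 < 2 * R * (t ^ 2 / R) ∧
        ‖t • w - (t ^ 2 / R) • e‖ ^ 2 < 2 * R * (t ^ 2 / R) := by
      have hi : ⟪t • w, (t ^ 2 / R) • e⟫ = 0 := by
        rw [inner_smul_left, inner_smul_right, real_inner_comm, hwe]; simp
      have hb : ‖t • w‖ ^ 2 + ‖(t ^ 2 / R) • e‖ ^ 2 < 2 * R * (t ^ 2 / R) := by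
        rw [norm_smul, norm_smul, he, Real.norm_of_nonneg ht0.le, Real.norm_of_nonneg (by positivity)]
        have : 2 * R * (t ^ 2 / R) = 2 * t ^ 2 := by field_simp
        rw [this]
        have h3 : (t * ‖w‖) ^ 2 ≤ t ^ 2 := by
          apply pow_le_pow_left₀ (by positivity); nlinarith
        have h4 : (t ^ 2 / R * 1) ^ 2 ≤ (t / 2) ^ 2 := by
          rw [mul_one]; exact pow_le_pow_left₀ (by positivity) hts 2
        nlinarith
      rw [norm_add_sq_real, norm_sub_sq_real, hi]
      constructor <;> linarith
    have hA : p + (t • w + (t ^ 2 / R) • e) ∈ Ω := by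
      apply hin
      rw [mem_ball, dist_eq_norm, add_sub_add_left_eq_sub, ← dist_eq_norm, ← mem_ball,
        mem_ball_unit he hR, inner_add_right, inner_smul_right, inner_smul_right, hwe, hee]
      simpa using hcalc.1
    have hB : p + (t • w - (t ^ 2 / R) • e) ∉ Ω := by
      apply hout
      have he' : ‖-e‖ = 1 := by rwa [norm_neg]
      rw [mem_ball, dist_eq_norm, sub_eq_add_neg p, add_sub_add_left_eq_sub, ← dist_eq_norm,
        ← mem_ball, ← smul_neg,
        mem_ball_unit he' hR, inner_sub_right, inner_smul_right, inner_smul_right, inner_neg_left,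
        inner_neg_left, hwe, hee]
      simpa using hcalc.2
    obtain ⟨q, hq, hqf⟩ := exists_frontier_segment hA hB
    rw [segment_eq_image] at hq
    obtain ⟨θ, hθ, rfl⟩ := hq
    set c := (1 - 2 * θ) * (t ^ 2 / R) with hc
    have hqe : (1 - θ) • (p + (t • w + (t ^ 2 / R) • e)) + θ • (p + (t • w - (t ^ 2 / R) • e)) - p
        = t • w + c • e := by
      rw [hc]; module
    have hcb : |c| ≤ t ^ 2 / R := by
      rw [hc, abs_mul, abs_of_nonneg (by positivity : 0 ≤ t ^ 2 / R)]
      have : |1 - 2 * θ| ≤ 1 := abs_le.2 ⟨by linarith [hθ.2], by linarith [hθ.1]⟩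
      have h0 : 0 ≤ t ^ 2 / R := by positivity
      nlinarith
    have hqn : ‖t • w + c • e‖ ≤ 2 * t := by
      refine (norm_add_le _ _).trans ?_
      rw [norm_smul, norm_smul, he, Real.norm_of_nonneg ht0.le, Real.norm_eq_abs]
      nlinarith
    have h2 := h1 (y := (1 - θ) • (p + (t • w + (t ^ 2 / R) • e)) +
      θ • (p + (t • w - (t ^ 2 / R) • e))) (by rw [dist_eq_norm, hqe]; linarith) hqf
    rw [hqe, norm_norm, inner_add_right, inner_smul_right, inner_smul_right, hνw, ← hκ,
      Real.norm_eq_abs] at h2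
    have h3 := (abs_le.1 h2).2
    have h4 : |c * κ| ≤ t ^ 2 / R := by
      rw [abs_mul]
      have := abs_nonneg c
      nlinarith [abs_nonneg κ]
    have h5 := (abs_le.1 h4).1
    have h6 : t ^ 2 / R ≤ t * (‖w‖ ^ 2 / 4) := by
      rw [div_le_iff₀ hR]; nlinarith
    have h7 : ‖w‖ ^ 2 / 8 * ‖t • w + c • e‖ ≤ ‖w‖ ^ 2 / 8 * (2 * t) := by gcongr
    have : 0 < t * ‖w‖ ^ 2 := by positivity
    nlinarith
  have hνe : ν = κ • e := by rw [← sub_eq_zero]; exact hw0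
  have hκ2 : |κ| = 1 := by
    have := congrArg norm hνe
    rw [hν1, norm_smul, he, mul_one, Real.norm_eq_abs] at this
    exact this.symm
  rcases eq_or_eq_neg_of_abs_eq hκ2 with h | h
  · exfalso
    rw [hνe, h, one_smul] at hν3
    have h1 : ∀ᶠ t : ℝ in 𝓝[>] (0 : ℝ), p - t • e ∉ Ω := by
      have : Ioo (0:ℝ) R ∈ 𝓝[>] (0:ℝ) := Ioo_mem_nhdsGT hR
      filter_upwards [this] with t ht
      apply hout
      rw [mem_ball, dist_eq_norm, sub_sub_sub_cancel_left, ← sub_smul, norm_smul, he, mul_one,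
        Real.norm_eq_abs, abs_lt]
      constructor <;> linarith [ht.1, ht.2]
    obtain ⟨t, h2, h3⟩ := (hν3.and h1).exists
    exact h3 h2
  · rw [hνe, h, neg_one_smul]

lemma exists_TB (n : ℕ) (ρ : ℝ) (M : ℝ≥0) (hρ : 0 < ρ) : ∃ R : ℝ, 0 < R ∧
    ∀ (Ω : Set (Euc (n + 1))) (ν : Euc (n + 1) → Euc (n + 1)),
      Bornology.IsBounded Ω → IsC11DomainWith Ω ρ M → OutwardNormalFieldOn Ω ν univ →
      TB Ω R (fun p => -ν p) := by
  have hM : (0:ℝ) ≤ M := M.2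
  set R := min (ρ / 2) (1 / (2 * (M + 1))) with hRd
  have hR : 0 < R := by positivity
  refine ⟨R, hR, ?_⟩
  intro Ω ν hb hΩ hν
  have hR1 : 2 * R ≤ ρ := by have : R ≤ ρ / 2 := min_le_left _ _; linarith
  have hR2 : 2 * R * M ≤ 1 := by
    have : R ≤ 1 / (2 * ((M:ℝ) + 1)) := min_le_right _ _
    rw [le_div_iff₀ (by positivity)] at this
    nlinarith
  have key : ∀ p ∈ frontier Ω, ‖-ν p‖ = 1 ∧ ball (p + R • (-ν p)) R ⊆ Ω ∧
      ∀ x ∈ ball (p - R • (-ν p)) R, x ∉ Ω := by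
    intro p hp
    obtain ⟨e, he, h1, h2⟩ := graph_two_ball hρ (hΩ.2.2.2 p hp) hR hR1 hR2
    have := normal_eq hR he h1 h2 (hν p ⟨hp, mem_univ p⟩)
    rw [this, neg_neg]
    exact ⟨he, h1, h2⟩
  have hcne : Ωᶜ.Nonempty := by
    rw [nonempty_compl]
    rintro rfl
    exact NormedSpace.unbounded_univ ℝ (Euc (n + 1)) hb
  exact ⟨hΩ.1, hb, hΩ.2.1.nonempty, hcne, hR, fun p hp => (key p hp).1, fun p hp => (key p hp).2.1,
    fun p hp => (key p hp).2.2⟩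

end geometry

section distfun

variable {m : ℕ}

/-- distance to the complement -/
def dd (Ω : Set (Euc m)) (x : Euc m) : ℝ := infDist x Ωᶜ

open Classical in
/-- a nearest boundary point -/
def npt (Ω : Set (Euc m)) (x : Euc m) : Euc m :=
  if h : ∃ p ∈ frontier Ω, dist x p = dd Ω x then h.choose else 0

/-- the extended inward normal -/
def NN (Ω : Set (Euc m)) (nu : Euc m → Euc m) (x : Euc m) : Euc m := nu (npt Ω x)

variable {Ω : Set (Euc m)} {R : ℝ} {nu : Euc m → Euc m}

lemma dd_cont : Continuous (dd Ω) := continuous_infDist_pt _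

lemma dd_nonneg (x : Euc m) : 0 ≤ dd Ω x := infDist_nonneg

lemma dd_le_add (x y : Euc m) : dd Ω x ≤ dd Ω y + dist x y := infDist_le_infDist_add_dist

lemma TB.dd_pos_iff (h : TB Ω R nu) {x : Euc m} : 0 < dd Ω x ↔ x ∈ Ω := by
  have := h.op.isClosed_compl.notMem_iff_infDist_pos h.cne (x := x)
  rw [dd, ← this, notMem_compl_iff]

lemma TB.ball_dd_subset (h : TB Ω R nu) (x : Euc m) : ball x (dd Ω x) ⊆ Ω := by
  intro y hy
  rw [← h.dd_pos_iff]
  rw [mem_ball, dist_comm] at hy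
  linarith [dd_le_add (Ω := Ω) x y]

lemma le_dd_of_ball (h : Ωᶜ.Nonempty) {x : Euc m} {r : ℝ} (hb : ball x r ⊆ Ω) : r ≤ dd Ω x := by
  rw [dd, le_infDist h]
  intro y hy
  by_contra hlt
  push Not at hlt
  exact hy (hb (by rwa [mem_ball, dist_comm]))

lemma TB.npt_spec (h : TB Ω R nu) {x : Euc m} (hx : x ∈ Ω) :
    npt Ω x ∈ frontier Ω ∧ dist x (npt Ω x) = dd Ω x := by
  have hd := h.dd_pos_iff.2 hx
  have hex : ∃ p ∈ frontier Ω, dist x p = dd Ω x := by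
    obtain ⟨p, hp, hpd⟩ := h.op.isClosed_compl.exists_infDist_eq_dist h.cne x
    refine ⟨p, ?_, hpd.symm⟩
    rw [h.op.frontier_eq]
    refine ⟨?_, hp⟩
    have : p ∈ closure (ball x (dd Ω x)) := by
      rw [closure_ball x hd.ne', mem_closedBall, dist_comm]
      exact hpd.symm.le
    exact closure_mono (h.ball_dd_subset x) this
  unfold npt
  rw [dif_pos hex]
  exact hex.choose_spec

lemma TB.dd_frontier (h : TB Ω R nu) {p : Euc m} (hp : p ∈ frontier Ω) : dd Ω p = 0 := by
  rw [h.op.frontier_eq] at hp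
  have := (h.dd_pos_iff (x := p)).not.2 hp.2
  linarith [dd_nonneg (Ω := Ω) p, not_lt.1 this]

lemma TB.le_out (h : TB Ω R nu) {p y : Euc m} (hp : p ∈ frontier Ω) (hy : y ∈ Ω) :
    dd Ω y + R ≤ dist y (p - R • nu p) := by
  rw [← disjoint_ball_ball_iff (h.dd_pos_iff.2 hy) h.Rpos, Set.disjoint_left]
  exact fun x hx hx' => h.out p hp x hx' (h.ball_dd_subset y hx)

lemma TB.le_inn (h : TB Ω R nu) {p : Euc m} (y : Euc m) (hp : p ∈ frontier Ω) :
    R - dist y (p + R • nu p) ≤ dd Ω y := by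
  have h1 := le_dd_of_ball h.cne (h.inn p hp)
  have h2 := dd_le_add (Ω := Ω) (p + R • nu p) y
  rw [dist_comm] at h2
  linarith

lemma TB.unit_NN (h : TB Ω R nu) {x : Euc m} (hx : x ∈ Ω) : ‖NN Ω nu x‖ = 1 :=
  h.unit _ (h.npt_spec hx).1

lemma TB.eq_npt (h : TB Ω R nu) {x : Euc m} (hx : x ∈ Ω) :
    x = npt Ω x + dd Ω x • NN Ω nu x := by
  obtain ⟨hp, hpd⟩ := h.npt_spec hx
  set p := npt Ω x with hpdef
  set d := dd Ω x with hd
  have hd0 : 0 < d := h.dd_pos_iff.2 hx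
  have hR := h.Rpos
  have hu := h.unit p hp
  have h1 := h.le_out hp hx
  have hv : ‖x - p‖ = d := by rw [← dist_eq_norm, hpd]
  have h2 : dist x (p - R • nu p) ^ 2 = d ^ 2 + 2 * R * ⟪x - p, nu p⟫ + R ^ 2 := by
    rw [dist_eq_norm, show x - (p - R • nu p) = (x - p) + R • nu p by abel, norm_add_sq_real, hv,
      norm_smul, hu, inner_smul_right, Real.norm_of_nonneg hR.le]
    ring
  have h3 : d ≤ ⟪x - p, nu p⟫ := by
    have : (d + R) ^ 2 ≤ dist x (p - R • nu p) ^ 2 := pow_le_pow_left₀ (by positivity) h1 2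
    rw [h2] at this
    have h4 : 0 ≤ 2 * R * (⟪x - p, nu p⟫ - d) := by nlinarith
    have := (mul_nonneg_iff_of_pos_left (by positivity : 0 < 2 * R)).1 h4
    linarith
  have h4 : ‖(x - p) - d • nu p‖ ^ 2 ≤ 0 := by
    rw [norm_sub_sq_real, hv, norm_smul, hu, inner_smul_right, Real.norm_of_nonneg hd0.le]
    nlinarith
  have h5 : (x - p) - d • nu p = 0 := by
    rw [← norm_eq_zero]
    nlinarith [norm_nonneg ((x - p) - d • nu p)]
  unfold NN
  rw [← hpdef, ← sub_eq_zero, ← h5]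
  abel

/-- collar -/
def collar (Ω : Set (Euc m)) (R : ℝ) : Set (Euc m) := {x ∈ Ω | dd Ω x < R / 2}

lemma TB.fol (h : TB Ω R nu) : Fol (collar Ω R) (dd Ω) (NN Ω nu) (2 / R) where
  op := h.op.inter (isOpen_lt dd_cont continuous_const)
  Kpos := by have := h.Rpos; positivity
  unit x hx := h.unit_NN hx.1
  quad x hx y hy := by
    have hR := h.Rpos
    obtain ⟨hp, hpd⟩ := h.npt_spec hx.1
    have hd0 : 0 < dd Ω x := h.dd_pos_iff.2 hx.1
    have hd1 : dd Ω x < R / 2 := hx.2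
    have hxe := h.eq_npt hx.1
    have hu := h.unit_NN hx.1
    have h1 := h.le_out hp hy.1
    have h2 := h.le_inn y hp
    rw [show nu (npt Ω x) = NN Ω nu x from rfl] at h1 h2
    set d := dd Ω x with hd
    set e := NN Ω nu x with he
    set p := npt Ω x
    set X1 := (d + R) • e with hX1
    set X2 := -((R - d) • e) with hX2
    have n1 : ‖X1‖ = d + R := by
      rw [hX1, norm_smul, hu, Real.norm_of_nonneg (by linarith), mul_one]
    have n2 : ‖X2‖ = R - d := by
      rw [hX2, norm_neg, norm_smul, hu, Real.norm_of_nonneg (by linarith), mul_one]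
    have t1 := norm_taylor (X := X1) (Y := X1 + (y - x)) (by positivity : 0 < R / 2) (by linarith)
    have t2 := norm_taylor (X := X2) (Y := X2 + (y - x)) (by positivity : 0 < R / 2) (by linarith)
    rw [add_sub_cancel_left, n1] at t1
    rw [add_sub_cancel_left, n2] at t2
    have i1 : (1 / (d + R)) • X1 = e := by
      rw [hX1, smul_smul, one_div_mul_cancel (by linarith), one_smul]
    have i2 : (1 / (R - d)) • X2 = -e := by
      rw [hX2, smul_neg, smul_smul, one_div_mul_cancel (by linarith), one_smul]
    have d1 : dist y (p - R • e) = ‖X1 + (y - x)‖ := by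
      rw [dist_eq_norm, hX1]; congr 1
      conv_rhs => rw [hxe]
      module
    have d2 : dist y (p + R • e) = ‖X2 + (y - x)‖ := by
      rw [dist_eq_norm, hX2]; congr 1
      conv_rhs => rw [hxe]
      module
    rw [i1] at t1
    rw [i2, inner_neg_left] at t2
    rw [d1] at h1
    rw [d2] at h2
    have e1 : 1 / (R / 2) = 2 / R := by field_simp
    rw [e1] at t1 t2
    have a1 := (abs_le.1 t1).2
    have a2 := (abs_le.1 t2).2
    rw [abs_le]
    constructor <;> linarith

lemma TB.push (h : TB Ω R nu) {x : Euc m} (hx : x ∈ Ω) {b : ℝ} (hb : dd Ω x ≤ b) (hbR : b ≤ R) :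
    b ≤ dd Ω (x + (b - dd Ω x) • NN Ω nu x) := by
  obtain ⟨hp, hpd⟩ := h.npt_spec hx
  have h2 := h.le_inn (x + (b - dd Ω x) • NN Ω nu x) hp
  rw [show nu (npt Ω x) = NN Ω nu x from rfl] at h2
  have hxe := h.eq_npt hx
  have hu := h.unit_NN hx
  have : dist (x + (b - dd Ω x) • NN Ω nu x) (npt Ω x + R • NN Ω nu x) = R - b := by
    have e : x + (b - dd Ω x) • NN Ω nu x - (npt Ω x + R • NN Ω nu x) = -((R - b) • NN Ω nu x) := by
      generalize NN Ω nu x = e at *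
      generalize npt Ω x = p at *
      generalize dd Ω x = d at *
      rw [hxe]; module
    rw [dist_eq_norm, e, norm_neg, norm_smul, hu, Real.norm_of_nonneg (by linarith), mul_one]
  rw [this] at h2
  linarith

/-- retraction onto `{dd ≥ b}` -/
def retr (Ω : Set (Euc m)) (nu : Euc m → Euc m) (b : ℝ) (x : Euc m) : Euc m :=
  x + (max (b - dd Ω x) 0) • NN Ω nu x

lemma TB.le_dd_retr (h : TB Ω R nu) {x : Euc m} (hx : x ∈ Ω) {b : ℝ} (hbR : b ≤ R) :
    b ≤ dd Ω (retr Ω nu b x) := by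
  unfold retr
  rcases le_total (dd Ω x) b with hb | hb
  · rw [max_eq_left (by linarith)]; exact h.push hx hb hbR
  · rw [max_eq_right (by linarith)]; simpa using hb

lemma TB.dist_retr (h : TB Ω R nu) {x : Euc m} (hx : x ∈ Ω) {b : ℝ} (hb : 0 ≤ b) :
    dist (retr Ω nu b x) x ≤ b := by
  unfold retr
  rw [dist_eq_norm, add_sub_cancel_left, norm_smul, h.unit_NN hx, mul_one,
    Real.norm_of_nonneg (le_max_right _ _)]
  exact max_le (by linarith [dd_nonneg (Ω := Ω) x]) hb

lemma TB.isPreconnected_core (h : TB Ω R nu) (hc : IsPreconnected Ω) {b : ℝ} (hb : 0 < b)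
    (hbR : b < R / 2) : IsPreconnected {x | b ≤ dd Ω x} := by
  have him : {x | b ≤ dd Ω x} = retr Ω nu b '' Ω := by
    ext x
    constructor
    · intro hx
      have hx' : b ≤ dd Ω x := hx
      refine ⟨x, h.dd_pos_iff.1 (by linarith), ?_⟩
      unfold retr
      rw [max_eq_right (by linarith)]; simp
    · rintro ⟨y, hy, rfl⟩
      exact h.le_dd_retr hy (by linarith [h.Rpos])
  rw [him]
  refine hc.image _ ?_
  intro x hx
  by_cases hxd : dd Ω x < R / 2
  · have hxW : x ∈ collar Ω R := ⟨hx, hxd⟩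
    have hN : ContinuousAt (NN Ω nu) x := (h.fol.locLip_N.continuousOn).continuousAt
      (h.fol.op.mem_nhds hxW)
    have hd : ContinuousAt (dd Ω) x := dd_cont.continuousAt
    have : ContinuousAt (retr Ω nu b) x := by
      unfold retr
      exact continuousAt_id.add (((continuousAt_const.sub hd).max continuousAt_const).smul hN)
    exact this.continuousWithinAt
  · have : ContinuousAt (retr Ω nu b) x := by
      refine continuousAt_id.congr ?_
      have : {y | b < dd Ω y} ∈ 𝓝 x := (isOpen_lt continuous_const dd_cont).mem_nhds (by
        push Not at hxd; exact lt_of_lt_of_le hbR hxd)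
      filter_upwards [this] with y hy
      have hy' : b < dd Ω y := hy
      unfold retr
      rw [max_eq_right (by linarith)]; simp
    exact this.continuousWithinAt

lemma TB.band_compact (h : TB Ω R nu) {δ : ℝ} (hδ : δ ≤ R / 2) {a b : ℝ} (ha : 0 < a) (hb : b < δ) :
    IsCompact (band {x ∈ Ω | dd Ω x < δ} (dd Ω) a b) := by
  have : band {x ∈ Ω | dd Ω x < δ} (dd Ω) a b = {x | a ≤ dd Ω x ∧ dd Ω x ≤ b} := by
    ext x
    constructor
    · exact fun h => h.2
    · intro hx
      exact ⟨⟨h.dd_pos_iff.1 (lt_of_lt_of_le ha hx.1), lt_of_le_of_lt hx.2 hb⟩, hx⟩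
  rw [this]
  refine Metric.isCompact_of_isClosed_isBounded ?_ ?_
  · exact (isClosed_le continuous_const dd_cont).inter (isClosed_le dd_cont continuous_const)
  · exact h.bdd.subset fun x hx => h.dd_pos_iff.1 (lt_of_lt_of_le ha hx.1)

end distfun

section boundary

variable {m : ℕ}

/-- Neumann type control near the boundary. -/
structure NB (Ω : Set (Euc m)) (nu : Euc m → Euc m) (u : Euc m → ℝ) (g : Euc m → Euc m) : Prop where
  neu : ∀ ε > 0, ∃ δ > 0, ∀ x ∈ Ω, dd Ω x < δ → |⟪NN Ω nu x, g x⟫| ≤ ε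
  gb : ∃ G : ℝ, ∀ x ∈ Ω, ‖g x‖ ≤ G
  ub : ∀ x ∈ Ω, |u x| ≤ 1

variable {Ω W : Set (Euc m)} {R : ℝ} {nu : Euc m → Euc m} {η : Euc m → ℝ} {N : Euc m → Euc m} {K : ℝ}
  {u : Euc m → ℝ} {g : Euc m → Euc m} {B : Euc m → Euc m →L[ℝ] Euc m} {lam : ℝ}

lemma fol_ibp (hf : Fol W η N K) {ω ω' : ℝ → ℝ} (hω : ∀ s, HasDerivAt ω (ω' s) s)
    (hω' : Continuous ω') {S : Set (Euc m)} (hS : IsCompact S) (hSW : S ⊆ W)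
    (hsupp : ∀ x ∈ W, x ∉ S → ω (η x) = 0) :
    IntegrableOn (fun x => ω (η x) * Dv (fderiv ℝ N x)) W ∧
    ∫ x in W, ω (η x) * Dv (fderiv ℝ N x) = - ∫ x in W, ω' (η x) := by
  have hωC : ContDiff ℝ 1 ω := by
    rw [contDiff_one_iff_deriv]
    refine ⟨fun s => (hω s).differentiableAt, ?_⟩
    rwa [show deriv ω = ω' from funext fun s => (hω s).deriv]
  obtain ⟨i1, i2, i3⟩ := div_ibp hf.op hS hSW (w := fun x => ω (η x))
    (P := fun x => ω' (η x) • N x) (V := N)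
    (fun x hx => by
      have := (hω (η x)).comp_hasFDerivAt x (hf.hasFDerivAt hx)
      refine this.congr_fderiv ?_
      ext v
      simp [inner_smul_left])
    (locLipOn_comp hf.op hf.locLip_eta hωC) hf.locLip_N
    ((hω'.comp_continuousOn hf.continuousOn).smul hf.locLip_N.continuousOn) hsupp
  refine ⟨i1, ?_⟩
  rw [i3]
  congr 1
  refine setIntegral_congr_fun hf.op.measurableSet fun x hx => ?_
  rw [real_inner_smul_left, real_inner_self_eq_norm_sq, hf.unit x hx]
  ring

/-- the boundary layer cutoff -/
def bcut (ε σ s : ℝ) : ℝ := cut ε (2 * ε) s - cut (5 * σ) (6 * σ) s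
/-- its derivative -/
def bcut' (ε σ s : ℝ) : ℝ := cut' ε (2 * ε) s - cut' (5 * σ) (6 * σ) s

lemma hasDerivAt_bcut (ε σ s : ℝ) : HasDerivAt (bcut ε σ) (bcut' ε σ s) s :=
  (hasDerivAt_cut _ _ s).sub (hasDerivAt_cut _ _ s)

lemma continuous_bcut (ε σ : ℝ) : Continuous (bcut ε σ) :=
  (continuous_cut _ _).sub (continuous_cut _ _)

lemma continuous_bcut' (ε σ : ℝ) : Continuous (bcut' ε σ) :=
  (continuous_cut' _ _).sub (continuous_cut' _ _)

lemma bcut_nonneg {ε σ : ℝ} (hε : 0 < ε) (hεσ : 2 * ε ≤ 5 * σ) (s : ℝ) : 0 ≤ bcut ε σ s := by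
  unfold bcut
  rcases le_total s (5 * σ) with h | h
  · rw [cut_zero (by linarith) h]; linarith [cut_nonneg ε (2 * ε) s]
  · rw [cut_one (a := ε) (by linarith) (by linarith)]; linarith [cut_le_one (5 * σ) (6 * σ) s]

lemma bcut_le_one (ε σ s : ℝ) : bcut ε σ s ≤ 1 := by
  unfold bcut
  linarith [cut_le_one ε (2 * ε) s, cut_nonneg (5 * σ) (6 * σ) s]

lemma bcut_zero {ε σ s : ℝ} (hε : 0 < ε) (hεσ : 2 * ε ≤ 5 * σ) (h : s ≤ ε ∨ 6 * σ ≤ s) :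
    bcut ε σ s = 0 := by
  unfold bcut
  rcases h with h | h
  · rw [cut_zero (by linarith) h, cut_zero (by linarith) (by linarith)]; simp
  · rw [cut_one (a := ε) (by linarith) (by linarith), cut_one (by linarith) h]; simp

lemma bcut_one {ε σ s : ℝ} (hε : 0 < ε) (hεσ : 2 * ε ≤ 5 * σ) (h : 2 * ε ≤ s) (h' : s ≤ 5 * σ) :
    bcut ε σ s = 1 := by
  unfold bcut
  rw [cut_one (a := ε) (by linarith) h, cut_zero (by linarith) h']; simp

lemma flux_bound (hf : Fol W η N K) (hW : volume W ≠ ⊤) {ε σ : ℝ} (hε : 0 < ε)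
    (hεσ : 2 * ε ≤ 5 * σ) (hS : IsCompact (band W η ε (6 * σ))) :
    IntegrableOn (fun x => cut' ε (2 * ε) (η x)) W ∧
    ∫ x in W, cut' ε (2 * ε) (η x) ≤ (C0 / σ + m * (6 * K)) * volume.real W := by
  have hσ : 0 < σ := by linarith
  have hKp := hf.Kpos
  have hsupp : ∀ x ∈ W, x ∉ band W η ε (6 * σ) → η x ≤ ε ∨ 6 * σ ≤ η x := by
    intro x hx hxS
    by_contra hcon
    push Not at hcon
    exact hxS ⟨hx, hcon.1.le, hcon.2.le⟩
  obtain ⟨i1, i2⟩ := fol_ibp hf (hasDerivAt_bcut ε σ) (continuous_bcut' ε σ) hS (band_subset _ _)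
    (fun x hx hxS => bcut_zero hε hεσ (hsupp x hx hxS))
  have j1 : IntegrableOn (fun x => cut' ε (2 * ε) (η x)) W :=
    intOn_of_supp hf.op hS (band_subset _ _)
      ((continuous_cut' _ _).comp_continuousOn hf.continuousOn) fun x hx hxS => by
        rcases hsupp x hx hxS with h | h
        · exact cut'_zero (by linarith) (Or.inl h)
        · exact cut'_zero (by linarith) (Or.inr (by linarith))
  have j2 : IntegrableOn (fun x => cut' (5 * σ) (6 * σ) (η x)) W :=
    intOn_of_supp hf.op hS (band_subset _ _)
      ((continuous_cut' _ _).comp_continuousOn hf.continuousOn) fun x hx hxS => by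
        rcases hsupp x hx hxS with h | h
        · exact cut'_zero (by linarith) (Or.inl (by linarith))
        · exact cut'_zero (by linarith) (Or.inr (by linarith))
  refine ⟨j1, ?_⟩
  have e1 : ∫ x in W, bcut' ε σ (η x) =
      (∫ x in W, cut' ε (2 * ε) (η x)) - ∫ x in W, cut' (5 * σ) (6 * σ) (η x) :=
    integral_sub j1 j2
  have hcI : ∀ c : ℝ, IntegrableOn (fun _ : Euc m => c) W := fun c => integrableOn_const hW
  have e2 : ∫ x in W, cut' (5 * σ) (6 * σ) (η x) ≤ C0 / σ * volume.real W := by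
    calc _ ≤ ∫ x in W, C0 / σ := by
          refine setIntegral_mono_on j2 (hcI _) hf.op.measurableSet fun x hx => ?_
          have := abs_cut'_le (a := 5 * σ) (b := 6 * σ) (by linarith) (η x)
          rw [show 6 * σ - 5 * σ = σ by ring] at this
          exact (le_abs_self _).trans this
      _ = _ := by rw [setIntegral_const, smul_eq_mul, mul_comm]
  have e3 : -(m * (6 * K) * volume.real W) ≤ ∫ x in W, bcut ε σ (η x) * Dv (fderiv ℝ N x) := by
    calc -(m * (6 * K) * volume.real W) = ∫ x in W, -(m * (6 * K)) := by
          rw [setIntegral_const, smul_eq_mul]; ring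
      _ ≤ _ := by
          refine setIntegral_mono_on (hcI _) i1 hf.op.measurableSet fun x hx => ?_
          have h1 := abs_Dv_le (fderiv ℝ N x)
          have h2 := hf.fderiv_N_le hx
          have h3 : |Dv (fderiv ℝ N x)| ≤ m * (6 * K) := h1.trans (by gcongr)
          have h4 := bcut_nonneg hε hεσ (η x)
          have h5 := bcut_le_one ε σ (η x)
          have h6 := (abs_le.1 h3).1
          have h7 : (0:ℝ) ≤ m * (6 * K) := by positivity
          nlinarith
  rw [i2, e1] at e3
  linarith

lemma cV_small (hf : Fol W η N K) (τ γ β lam G θ : ℝ) (hβ0 : 0 ≤ β) (hβ : β ≤ 2) (hlam : 0 ≤ lam)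
    (hθ : 0 < θ) (hτ : 0 < τ) (hγ : 0 ≤ γ) :
    ∃ δ > 0, ∀ x ∈ W, 0 ≤ η x → η x < δ → |u x| ≤ 1 → ‖g x‖ ≤ G → |⟪N x, g x⟫| ≤ θ / 8 →
      |⟪N x, cV τ γ β lam η N u g x⟫| ≤ θ := by
  have c1 : ContinuousAt (fun s => cG τ γ s * (3 * G ^ 2 + lam) + 1 / 2 * cH1 τ γ s) 0 :=
    (((cG_contDiff τ γ).continuous.mul continuous_const).add
      (continuous_const.mul (cH1_contDiff τ γ).continuous)).continuousAt
  have c2 : ContinuousAt (cH τ γ) 0 := (cH_contDiff τ γ).continuous.continuousAt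
  have e1 := c1.eventually_lt (g := fun _ => θ / 2) continuousAt_const (by
    simp only [cG_zero, cH1_zero]; simpa using hθ)
  have e2 := c2.eventually_lt (g := fun _ => (2:ℝ)) continuousAt_const (by
    simp only [cH_zero]; norm_num)
  obtain ⟨δ, hδ, h⟩ := Metric.eventually_nhds_iff.1 (e1.and e2)
  refine ⟨δ, hδ, fun x hx h0 h1 hu hg hp => ?_⟩
  obtain ⟨k1, k2⟩ := h (y := η x) (by rw [dist_zero_right, Real.norm_of_nonneg h0]; exact h1)
  have hNN : ⟪N x, N x⟫ = (1 : ℝ) := by rw [real_inner_self_eq_norm_sq, hf.unit x hx]; norm_num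
  have hH := cH_pos τ γ (η x)
  have hG := cG_nonneg τ γ h0
  have hH1 := cH1_nonneg hτ hγ h0
  have hp2 : |⟪N x, g x⟫| ≤ ‖g x‖ := by
    have := abs_real_inner_le_norm (N x) (g x)
    rwa [hf.unit x hx, one_mul] at this
  have hp3 : ⟪N x, g x⟫ ^ 2 ≤ G ^ 2 := by
    rw [← sq_abs]
    exact pow_le_pow_left₀ (abs_nonneg _) (hp2.trans hg) 2
  have hg2 : ‖g x‖ ^ 2 ≤ G ^ 2 := pow_le_pow_left₀ (norm_nonneg _) hg 2
  have hg20 : 0 ≤ ‖g x‖ ^ 2 := by positivity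
  unfold cV
  rw [inner_add_right, inner_smul_right, inner_smul_right, hNN, real_inner_self_eq_norm_sq,
    real_inner_comm (N x) (g x)]
  set p : ℝ := ⟪N x, g x⟫
  set Gx := cG τ γ (η x)
  set H := cH τ γ (η x)
  set H1 := cH1 τ γ (η x)
  set U := u x
  set g2 := ‖g x‖ ^ 2
  have hU2 : U ^ 2 ≤ 1 := by rw [← sq_abs]; exact pow_le_one₀ (abs_nonneg _) hu
  have t1 : |β * H * U * p| ≤ θ / 2 := by
    rw [abs_mul, abs_mul, abs_mul, abs_of_nonneg hβ0, abs_of_pos hH]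
    calc β * H * |U| * |p| ≤ 2 * 2 * 1 * (θ / 8) := by gcongr
      _ = _ := by ring
  have hp0 := sq_nonneg p
  have hU0 := sq_nonneg U
  have b1 : Gx * p ^ 2 ≤ Gx * G ^ 2 := by gcongr
  have b2 : Gx * g2 ≤ Gx * G ^ 2 := by gcongr
  have b3 : Gx * (lam * U ^ 2) ≤ Gx * (lam * 1) := by gcongr
  have b4 : H1 * U ^ 2 ≤ H1 * 1 := by gcongr
  have b1' : 0 ≤ Gx * p ^ 2 := by positivity
  have b2' : 0 ≤ Gx * g2 := by positivity
  have b3' : 0 ≤ Gx * (lam * U ^ 2) := by positivity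
  have b4' : 0 ≤ H1 * U ^ 2 := by positivity
  have b5 : 0 ≤ Gx * G ^ 2 := by positivity
  have e : (2 * Gx * p + β * H * U) * p + (-(Gx * (g2 - lam * U ^ 2)) + 1 / 2 * H1 * U ^ 2) * 1 =
      β * H * U * p + (2 * (Gx * p ^ 2) - Gx * g2 + Gx * (lam * U ^ 2) + 1 / 2 * (H1 * U ^ 2)) := by
    ring
  rw [e, abs_le]
  obtain ⟨s1, s2⟩ := abs_le.1 t1
  constructor <;> linarith

end boundary

section boundary2

variable {m : ℕ}
variable {Ω W : Set (Euc m)} {R : ℝ} {nu : Euc m → Euc m} {η : Euc m → ℝ} {N : Euc m → Euc m} {K : ℝ}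
  {u : Euc m → ℝ} {g : Euc m → Euc m} {B : Euc m → Euc m →L[ℝ] Euc m} {lam : ℝ}

/-- Boundary Carleman estimate. -/
lemma bdry_carleman (hf : Fol W η N K) (hu : Eig W u g B lam) {τ γ Q σ : ℝ} (hσ : 0 < σ)
    (hlam : 0 ≤ lam) (hτ1 : 1 ≤ τ) (hQ : Q = (2 + m) * (6 * K))
    (hγ : γ = 30 * Q) (hτQ : Q ≤ τ) (hlamτ : lam ≤ τ ^ 2) (hη0 : ∀ x ∈ W, 0 ≤ η x)
    (hη1 : ∀ x ∈ W, γ * η x ≤ 1) (hW : volume W ≠ ⊤)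
    (hc : ∀ a b, 0 < a → b ≤ 9 * σ → IsCompact (band W η a b))
    (hsm : ∀ θ > 0, ∃ δ > 0, ∀ x ∈ W, η x < δ →
      |⟪N x, cV τ γ (1 + Q / τ) lam η N u g x⟫| ≤ θ) {ε : ℝ} (hε : 0 < ε) :
    1 / 2 * γ * ∫ x in band W η ε (5 * σ), u x ^ 2 ≤
      (4 * C0 / σ) * (1 + (2 * lam + 4 * (2 * C0 / σ) ^ 2)) *
       (cH τ γ (6 * σ) * ∫ x in band W η (4 * σ) (7 * σ), u x ^ 2) := by
  have hτ : 0 < τ := by linarith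
  have hηc := hf.continuousOn
  have huc := hu.continuousOn_u
  have hgc := hu.continuousOn_g
  have hKp := hf.Kpos
  have hQ0 : 0 < Q := by rw [hQ]; positivity
  have hγ0 : 0 ≤ γ := by rw [hγ]; positivity
  have hC0 := C0_pos
  refine le_of_mul_le_mul_left (a := τ) ?_ hτ
  refine le_of_forall_pos_le_add fun θ hθ => ?_
  set Cv := (C0 / σ + m * (6 * K)) * volume.real W with hCv
  have hCv0 : 0 ≤ Cv := by positivity
  obtain ⟨δ, hδ, hsmall⟩ := hsm (θ / (Cv + 1)) (by positivity)
  obtain ⟨e, he, he1, he2, he3⟩ : ∃ e > 0, 2 * e ≤ ε ∧ 2 * e < δ ∧ 2 * e ≤ 5 * σ := by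
    refine ⟨min (ε / 2) (min (δ / 4) (σ / 2)), by positivity, ?_, ?_, ?_⟩
    · linarith [min_le_left (ε / 2) (min (δ / 4) (σ / 2))]
    · linarith [min_le_right (ε / 2) (min (δ / 4) (σ / 2)), min_le_left (δ / 4) (σ / 2)]
    · linarith [min_le_right (ε / 2) (min (δ / 4) (σ / 2)), min_le_right (δ / 4) (σ / 2)]
  set ω := bcut e σ with hω
  set ω' := bcut' e σ with hω'
  set S := band W η e (6 * σ) with hS
  have hSc : IsCompact S := hc _ _ he (by linarith)
  obtain ⟨i1, i2, i3⟩ := carleman_int hf hu hlam hτ hQ hγ hτQ hlamτ hη0 hη1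
    (ω := ω) (ω' := ω') (hasDerivAt_bcut _ _) (continuous_bcut' _ _) (bcut_nonneg he he3)
    hSc (band_subset _ _) (fun x hx hxS => bcut_zero he he3 (by
      by_contra hcon
      push Not at hcon
      exact hxS ⟨hx, by linarith [hcon.1], by linarith [hcon.2]⟩))
  obtain ⟨f1, f2⟩ := flux_bound hf hW he he3 hSc
  -- lower bound
  have lo : τ * (1 / 2 * γ * ∫ x in band W η ε (5 * σ), u x ^ 2) ≤
      ∫ x in W, ω (η x) * (1 / 2 * γ * τ * cH τ γ (η x) * u x ^ 2) := by
    have hcb := hc ε (5 * σ) hε (by linarith)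
    calc _ = ∫ x in band W η ε (5 * σ), 1 / 2 * γ * τ * 1 * u x ^ 2 := by
          rw [integral_const_mul]; ring
      _ ≤ ∫ x in band W η ε (5 * σ), ω (η x) * (1 / 2 * γ * τ * cH τ γ (η x) * u x ^ 2) := by
          refine setIntegral_mono_on
            ((((huc.mono (band_subset _ _)).pow 2).integrableOn_compact hcb).const_mul _)
            (i1.mono_set (band_subset _ _)) hcb.measurableSet fun x hx => ?_
          rw [hω, bcut_one he he3 (by linarith [hx.2.1]) hx.2.2, one_mul]
          have := cH_mono hτ hγ0 (mem_Ici.2 (le_refl (0:ℝ))) (mem_Ici.2 (hη0 x hx.1)) (hη0 x hx.1)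
          rw [cH_zero] at this
          gcongr
      _ ≤ _ := by
          refine setIntegral_mono_set i1 (Eventually.of_forall fun x => ?_)
            (band_subset _ _).eventuallyLE
          have := cH_pos τ γ (η x)
          have := bcut_nonneg he he3 (η x)
          simp only [Pi.zero_apply]
          positivity
  -- upper bound
  set f : Euc m → ℝ := fun x => u x ^ 2 + ‖g x‖ ^ 2 with hf'
  have hfc : ContinuousOn f W := (huc.pow 2).add (hgc.norm.pow 2)
  set b2 := band W η (5 * σ) (6 * σ) with hb2
  have hb2c : IsCompact b2 := hc _ _ (by linarith) (by linarith)
  have fi2 : IntegrableOn f b2 := (hfc.mono (band_subset _ _)).integrableOn_compact hb2c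
  set c := C0 / σ * (4 * τ) with hcdef
  have hc0 : 0 ≤ c := by positivity
  have hup : -∫ x in W, ω' (η x) * ⟪N x, cV τ γ (1 + Q / τ) lam η N u g x⟫ ≤
      θ + c * cH τ γ (6 * σ) * ∫ x in b2, f x := by
    have hF1 : IntegrableOn (fun x => θ / (Cv + 1) * cut' e (2 * e) (η x)) W := f1.const_mul _
    have hF2 : IntegrableOn (b2.indicator fun x => c * cH τ γ (6 * σ) * f x) W :=
      ((integrable_indicator_iff hb2c.measurableSet).2 (fi2.const_mul _)).integrableOn
    have e1 : ∫ x in W, θ / (Cv + 1) * cut' e (2 * e) (η x) ≤ θ := by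
      rw [integral_const_mul]
      calc _ ≤ θ / (Cv + 1) * Cv := by gcongr
        _ ≤ θ := by
          rw [div_mul_eq_mul_div, div_le_iff₀ (by positivity)]
          nlinarith
    have e2 : ∫ x in W, b2.indicator (fun x => c * cH τ γ (6 * σ) * f x) x =
        c * cH τ γ (6 * σ) * ∫ x in b2, f x := by
      rw [setIntegral_indicator hb2c.measurableSet, inter_eq_right.2 (band_subset _ _),
        integral_const_mul]
    rw [← e2]
    refine le_trans ?_ (add_le_add_left e1 _)
    rw [← integral_add hF1 hF2, ← integral_neg]
    refine setIntegral_mono_on i2.neg (hF1.add hF2) hf.op.measurableSet fun x hx => ?_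
    have hn1 : 0 ≤ θ / (Cv + 1) * cut' e (2 * e) (η x) := by
      have := cut'_nonneg (a := e) (b := 2 * e) (by linarith) (η x)
      positivity
    have hn2 : 0 ≤ b2.indicator (fun x => c * cH τ γ (6 * σ) * f x) x :=
      indicator_nonneg (fun x _ => by have := cH_pos τ γ (6 * σ); positivity) x
    have hq : Q / τ ≤ 1 := (div_le_one hτ).2 hτQ
    have hsp : ω' (η x) = cut' e (2 * e) (η x) - cut' (5 * σ) (6 * σ) (η x) := rfl
    have p1 : -(cut' e (2 * e) (η x) * ⟪N x, cV τ γ (1 + Q / τ) lam η N u g x⟫) ≤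
        θ / (Cv + 1) * cut' e (2 * e) (η x) := by
      by_cases h1 : η x < 2 * e
      · have h2 := hsmall x hx (by linarith)
        have h3 := cut'_nonneg (a := e) (b := 2 * e) (by linarith) (η x)
        nlinarith [(abs_le.1 h2).1]
      · rw [cut'_zero (by linarith) (Or.inr (not_lt.1 h1))]; simp
    have p2 : cut' (5 * σ) (6 * σ) (η x) * ⟪N x, cV τ γ (1 + Q / τ) lam η N u g x⟫ ≤
        b2.indicator (fun x => c * cH τ γ (6 * σ) * f x) x := by
      by_cases h2 : x ∈ b2
      · rw [indicator_of_mem h2]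
        refine (le_abs_self _).trans ?_
        rw [abs_mul]
        have hab := abs_cut'_le (a := 5 * σ) (b := 6 * σ) (by linarith) (η x)
        rw [show 6 * σ - 5 * σ = σ by ring] at hab
        have hcv := abs_inner_cV_le (u := u) (g := g) (β := 1 + Q / τ) hf hx hlam hτ1 hγ0
          (by positivity) (by linarith) hlamτ (hη0 x hx) (hη1 x hx)
        have hfx : 0 ≤ f x := by positivity
        have := cH_mono hτ hγ0 (mem_Ici.2 (hη0 x hx)) (mem_Ici.2 ((hη0 x hx).trans h2.2.2)) h2.2.2
        calc _ ≤ C0 / σ * (4 * τ * cH τ γ (η x) * f x) := by gcongr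
          _ ≤ C0 / σ * (4 * τ * cH τ γ (6 * σ) * f x) := by gcongr
          _ = _ := by rw [hcdef]; ring
      · rw [indicator_of_notMem h2, cut'_zero (by linarith) (by
          by_contra hcon
          push Not at hcon
          exact h2 ⟨hx, hcon.1.le, hcon.2.le⟩)]
        simp
    rw [hsp]
    linarith
  have g2 : ∫ x in b2, f x ≤
      (1 + (2 * lam + 4 * (2 * C0 / σ) ^ 2)) * ∫ x in band W η (4 * σ) (7 * σ), u x ^ 2 := by
    have k2 := hc (4 * σ) (7 * σ) (by linarith) (by linarith)
    have ui : IntegrableOn (fun x => u x ^ 2) (band W η (4 * σ) (7 * σ)) :=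
      ((huc.mono (band_subset _ _)).pow 2).integrableOn_compact k2
    have hsub : b2 ⊆ band W η (4 * σ) (7 * σ) := band_mono (by linarith) (by linarith)
    have gi : IntegrableOn (fun x => ‖g x‖ ^ 2) b2 :=
      ((hgc.mono (band_subset _ _)).norm.pow 2).integrableOn_compact hb2c
    rw [hf', integral_add (ui.mono_set hsub) gi, add_mul, one_mul]
    refine add_le_add ?_ ?_
    · exact setIntegral_mono_set ui (Eventually.of_forall fun x => by positivity) hsub.eventuallyLE
    · have hp : 4 * σ = 5 * σ - σ := by ring
      have hq : 7 * σ = 6 * σ + σ := by ring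
      rw [hp, hq] at k2 ⊢
      exact grad_band hf hu hσ hlam k2 hb2c
  have hH6 := cH_pos τ γ (6 * σ)
  refine lo.trans (i3.trans (hup.trans ?_))
  calc _ ≤ θ + c * cH τ γ (6 * σ) * ((1 + (2 * lam + 4 * (2 * C0 / σ) ^ 2)) *
        ∫ x in band W η (4 * σ) (7 * σ), u x ^ 2) := by gcongr
    _ = _ := by rw [hcdef]; ring

/-- depth at which the boundary layer is left -/
def dep (m : ℕ) (R : ℝ) : ℝ := R / (900 * (m + 2))

lemma dep_pos (m : ℕ) {R : ℝ} (hR : 0 < R) : 0 < dep m R := by unfold dep; positivity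

lemma TB.core_compact (h : TB Ω R nu) (a : ℝ) (ha : 0 < a) : IsCompact {x | a ≤ dd Ω x} := by
  refine Metric.isCompact_of_isClosed_isBounded (isClosed_le continuous_const dd_cont) ?_
  exact h.bdd.subset fun x hx => h.dd_pos_iff.1 (lt_of_lt_of_le ha hx)

lemma TB.core_subset (h : TB Ω R nu) {a : ℝ} (ha : 0 < a) : {x | a ≤ dd Ω x} ⊆ Ω :=
  fun _ hx => h.dd_pos_iff.1 (lt_of_lt_of_le ha hx)

lemma setIntegral_union_le {f : Euc m → ℝ} {S T : Set (Euc m)} (hS : MeasurableSet S)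
    (hT : MeasurableSet T) (h1 : IntegrableOn f S) (h2 : IntegrableOn f T) (h0 : ∀ x, 0 ≤ f x) :
    ∫ x in S ∪ T, f x ≤ (∫ x in S, f x) + ∫ x in T, f x := by
  rw [← union_sdiff_self, setIntegral_union disjoint_sdiff_self_right (hT.diff hS) h1
    (h2.mono_set sdiff_subset)]
  refine add_le_add_right (setIntegral_mono_set h2 (Eventually.of_forall h0)
    (HasSubset.Subset.eventuallyLE sdiff_subset)) _

set_option maxHeartbeats 1000000 in
/-- Mass cannot concentrate near the boundary. -/
lemma bdry_mass (m : ℕ) {R : ℝ} (hR : 0 < R) : ∃ A : ℝ, ∀ (Ω : Set (Euc m)) (nu : Euc m → Euc m)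
    (u : Euc m → ℝ) (g : Euc m → Euc m) (B : Euc m → Euc m →L[ℝ] Euc m) (lam : ℝ),
    TB Ω R nu → Eig Ω u g B lam → 0 ≤ lam → NB Ω nu u g → ∀ ε > 0,
    ∫ x in {x | ε ≤ dd Ω x}, u x ^ 2 ≤
      Real.exp (A * (1 + √lam)) * ∫ x in {x | dep m R ≤ dd Ω x}, u x ^ 2 := by
  set K := 2 / R with hK
  set Q := (2 + m) * (6 * K) with hQ
  set γ := 30 * Q with hγ
  set δ := R / (360 * (m + 2)) with hδ
  set σ := δ / 10 with hσd
  have hC0 := C0_pos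
  have hKp : 0 < K := by positivity
  have hQp : 0 < Q := by positivity
  have hγp : 0 < γ := by positivity
  have hδp : 0 < δ := by positivity
  have hσ : 0 < σ := by positivity
  have hγδ : γ * δ = 1 := by rw [hγ, hQ, hK, hδ]; field_simp; ring
  have hdep : dep m R = 4 * σ := by rw [hσd, hδ, dep]; field_simp; ring
  have hδR : δ ≤ R / 2 := by
    rw [hδ]
    refine div_le_div_of_nonneg_left hR.le (by norm_num) ?_
    have : (0:ℝ) ≤ m := by positivity
    linarith
  set E := 4 * (2 * C0 / σ) ^ 2 with hE
  have hEp : 0 ≤ E := by positivity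
  set c1 := 2 / γ * (4 * C0 / σ) * (3 + E) with hc1
  have hc1p : 0 ≤ c1 := by positivity
  refine ⟨c1 + 2 + 18 * σ * (1 + Q) + 1, fun Ω nu u g B lam hT hu hlam hN ε hε => ?_⟩
  set s := 1 + √lam with hs
  have hs1 : 1 ≤ s := by rw [hs]; linarith [Real.sqrt_nonneg lam]
  have hlams : lam ≤ s ^ 2 := by
    have h1 := Real.sq_sqrt hlam
    have h2 := Real.sqrt_nonneg lam
    rw [hs]; nlinarith
  set τ := (1 + Q) * s with hτd
  have hτ1 : 1 ≤ τ := by rw [hτd]; nlinarith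
  have hτQ : Q ≤ τ := by rw [hτd]; nlinarith
  have hτ0 : 0 < τ := by linarith
  have hsτ : s ≤ τ := by rw [hτd]; nlinarith
  have hlamτ : lam ≤ τ ^ 2 := hlams.trans (by gcongr)
  set W := {x ∈ Ω | dd Ω x < δ} with hW
  have hWo : IsOpen W := hT.op.inter (isOpen_lt dd_cont continuous_const)
  have hWc : W ⊆ collar Ω R := fun x hx => ⟨hx.1, lt_of_lt_of_le hx.2 hδR⟩
  have hf : Fol W (dd Ω) (NN Ω nu) K := hT.fol.mono hWo hWc
  have huW : Eig W u g B lam := hu.mono hWo fun x hx => hx.1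
  have hη0 : ∀ x ∈ W, 0 ≤ dd Ω x := fun x _ => dd_nonneg x
  have hη1 : ∀ x ∈ W, γ * dd Ω x ≤ 1 := fun x hx => by
    rw [← hγδ]; exact mul_le_mul_of_nonneg_left hx.2.le hγp.le
  have hWv : volume W ≠ ⊤ := ((hT.bdd.subset fun x hx => hx.1).measure_lt_top).ne
  have hc : ∀ a b, 0 < a → b ≤ 9 * σ → IsCompact (band W (dd Ω) a b) := fun a b ha hb =>
    hT.band_compact hδR ha (by rw [hσd] at hb; linarith)
  obtain ⟨G, hG⟩ := hN.gb
  have hq : Q / τ ≤ 1 := (div_le_one hτ0).2 hτQ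
  have hsm : ∀ θ > 0, ∃ δ > 0, ∀ x ∈ W, dd Ω x < δ →
      |⟪NN Ω nu x, cV τ γ (1 + Q / τ) lam (dd Ω) (NN Ω nu) u g x⟫| ≤ θ := by
    intro θ hθ
    obtain ⟨δ1, h1, k1⟩ := cV_small (u := u) (g := g) hf τ γ (1 + Q / τ) lam G θ (by positivity)
      (by linarith) hlam hθ hτ0 hγp.le
    obtain ⟨δ2, h2, k2⟩ := hN.neu (θ / 8) (by positivity)
    exact ⟨min δ1 δ2, by positivity, fun x hx hxd => k1 x hx (hη0 x hx)
      (lt_of_lt_of_le hxd (min_le_left _ _)) (hN.ub x hx.1) (hG x hx.1)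
      (k2 x hx.1 (lt_of_lt_of_le hxd (min_le_right _ _)))⟩
  have main := bdry_carleman hf huW hσ hlam hτ1 hQ hγ hτQ hlamτ hη0 hη1 hWv hc hsm hε
  have huc := hu.continuousOn_u
  have hintg : ∀ a > 0, IntegrableOn (fun x => u x ^ 2) {x | a ≤ dd Ω x} := fun a ha =>
    ((huc.mono (hT.core_subset ha)).pow 2).integrableOn_compact (hT.core_compact a ha)
  set J := ∫ x in {x | dep m R ≤ dd Ω x}, u x ^ 2 with hJ
  have hJ0 : 0 ≤ J := integral_nonneg fun x => by positivity
  have hd0 := dep_pos m hR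
  have bJ : ∫ x in band W (dd Ω) (4 * σ) (7 * σ), u x ^ 2 ≤ J :=
    setIntegral_mono_set (hintg _ hd0) (Eventually.of_forall fun x => by positivity)
      (HasSubset.Subset.eventuallyLE fun x hx => by
        show dep m R ≤ dd Ω x
        rw [hdep]; exact hx.2.1)
  set I := ∫ x in band W (dd Ω) ε (5 * σ), u x ^ 2 with hI
  have hHu : cH τ γ (6 * σ) ≤ Real.exp (3 * τ * (6 * σ)) := cH_upper hτ0 (by positivity) (by
    have e : γ * (6 * σ) = 6 / 10 * (γ * δ) := by rw [hσd]; ring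
    rw [e, hγδ]; norm_num)
  have hI1 : I ≤ c1 * s ^ 2 * Real.exp (3 * τ * (6 * σ)) * J := by
    have hH6 := cH_pos τ γ (6 * σ)
    have e1 : I = 2 / γ * (1 / 2 * γ * I) := by field_simp
    have hlamE : 1 + (2 * lam + E) ≤ (3 + E) * s ^ 2 := by nlinarith [mul_nonneg hEp (sub_nonneg.2 (one_le_pow₀ hs1 : (1:ℝ) ≤ s ^ 2)), (one_le_pow₀ hs1 : (1:ℝ) ≤ s ^ 2)]
    rw [e1]
    calc _ ≤ 2 / γ * ((4 * C0 / σ) * (1 + (2 * lam + E)) *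
       (cH τ γ (6 * σ) * ∫ x in band W (dd Ω) (4 * σ) (7 * σ), u x ^ 2)) := by gcongr
      _ ≤ 2 / γ * ((4 * C0 / σ) * ((3 + E) * s ^ 2) *
       (Real.exp (3 * τ * (6 * σ)) * J)) := by gcongr
      _ = _ := by rw [hc1]; ring
  have hIJ : ∫ x in {x | ε ≤ dd Ω x}, u x ^ 2 ≤ I + J := by
    have hb := hc ε (5 * σ) hε (by linarith)
    have hbi : IntegrableOn (fun x => u x ^ 2) (band W (dd Ω) ε (5 * σ)) :=
      ((huc.mono fun x hx => hx.1.1).pow 2).integrableOn_compact hb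
    calc _ ≤ ∫ x in band W (dd Ω) ε (5 * σ) ∪ {x | dep m R ≤ dd Ω x}, u x ^ 2 := by
          refine setIntegral_mono_set (hbi.union (hintg _ hd0))
            (Eventually.of_forall fun x => by positivity) (HasSubset.Subset.eventuallyLE fun x hx => ?_)
          by_cases h4 : dep m R ≤ dd Ω x
          · exact Or.inr h4
          · rw [hdep] at h4
            refine Or.inl ⟨⟨hT.dd_pos_iff.1 (lt_of_lt_of_le hε hx), ?_⟩, hx, by linarith⟩
            rw [hσd] at h4; linarith
      _ ≤ _ := by
          exact setIntegral_union_le hb.measurableSet (hT.core_compact _ hd0).measurableSet hbi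
            (hintg _ hd0) fun x => sq_nonneg _
  refine hIJ.trans ?_
  have hexp1 : c1 * s ^ 2 ≤ Real.exp (c1 * s + 2 * s) := by
    have a1 : c1 ≤ Real.exp (c1 * s) := by
      have := Real.add_one_le_exp (c1 * s)
      nlinarith
    have a2 : s ^ 2 ≤ Real.exp (2 * s) := by
      have := Real.add_one_le_exp s
      rw [two_mul, Real.exp_add, sq]
      gcongr <;> linarith
    rw [Real.exp_add]
    gcongr
  have hX : c1 * s ^ 2 * Real.exp (3 * τ * (6 * σ)) ≤
      Real.exp ((c1 + 2 + 18 * σ * (1 + Q)) * s) := by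
    calc _ ≤ Real.exp (c1 * s + 2 * s) * Real.exp (3 * τ * (6 * σ)) := by gcongr
      _ = _ := by rw [← Real.exp_add, hτd]; congr 1; ring
  have h1 : (1:ℝ) ≤ Real.exp ((c1 + 2 + 18 * σ * (1 + Q)) * s) := Real.one_le_exp (by positivity)
  have h2 : (2:ℝ) ≤ Real.exp s := by linarith [Real.add_one_le_exp s]
  set Y := Real.exp ((c1 + 2 + 18 * σ * (1 + Q)) * s)
  have h3 : Real.exp ((c1 + 2 + 18 * σ * (1 + Q) + 1) * s) = Y * Real.exp s := by
    rw [← Real.exp_add]; congr 1; ring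
  rw [h3]
  calc I + J ≤ Y * J + Y * J := by
        refine add_le_add (hI1.trans (by gcongr)) ?_
        nlinarith
    _ = Y * 2 * J := by ring
    _ ≤ _ := by gcongr

end boundary2

section meanvalue

variable {m : ℕ}

/-- radial bump -/
def Kb (y : Euc m) : ℝ := 1 - cut 0 1 (‖y‖ ^ 2)
/-- its radial derivative -/
def kb (y : Euc m) : ℝ := 2 * cut' 0 1 (‖y‖ ^ 2)

lemma kb_nonneg (y : Euc m) : 0 ≤ kb y := by
  have := cut'_nonneg (a := 0) (b := 1) (by norm_num) (‖y‖ ^ 2)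
  unfold kb; linarith

lemma kb_le (y : Euc m) : kb y ≤ 2 * C0 := by
  have := abs_cut'_le (a := 0) (b := 1) (by norm_num) (‖y‖ ^ 2)
  unfold kb
  have := (le_abs_self _).trans this
  simp at this
  linarith

lemma Kb_nonneg (y : Euc m) : 0 ≤ Kb y := by
  unfold Kb; linarith [cut_le_one 0 1 (‖y‖ ^ 2)]

lemma Kb_continuous : Continuous (Kb : Euc m → ℝ) :=
  continuous_const.sub ((continuous_cut _ _).comp (continuous_norm.pow 2))

lemma kb_continuous : Continuous (kb : Euc m → ℝ) :=
  continuous_const.mul ((continuous_cut' _ _).comp (continuous_norm.pow 2))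

lemma Kb_zero {y : Euc m} (h : y ∉ closedBall (0 : Euc m) 1) : Kb y = 0 := by
  rw [mem_closedBall_zero_iff, not_le] at h
  unfold Kb
  rw [cut_one (by norm_num) (by nlinarith)]; simp

lemma kb_zero {y : Euc m} (h : y ∉ closedBall (0 : Euc m) 1) : kb y = 0 := by
  rw [mem_closedBall_zero_iff, not_le] at h
  unfold kb
  rw [cut'_zero (by norm_num) (Or.inr (by nlinarith))]; simp

lemma bump_ibp {W : Set (Euc m)} (hW : IsOpen W) (hS : closedBall (0 : Euc m) 1 ⊆ W)
    {V : Euc m → Euc m} (hV : LocallyLipschitzOn W V) :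
    ∫ y in closedBall (0 : Euc m) 1, Kb y * Dv (fderiv ℝ V y) =
      ∫ y in closedBall (0 : Euc m) 1, kb y * ⟪y, V y⟫ := by
  have hd : ∀ x ∈ W, HasFDerivAt (Kb : Euc m → ℝ) (innerSL ℝ (-(kb x) • x)) x := by
    intro x _
    have h1 : HasFDerivAt (fun y : Euc m => ‖y‖ ^ 2) (2 • innerSL ℝ x) x :=
      (hasStrictFDerivAt_norm_sq x).hasFDerivAt
    have h2 := ((hasDerivAt_cut 0 1 (‖x‖ ^ 2)).comp_hasFDerivAt x h1).const_sub 1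
    refine h2.congr_fderiv ?_
    ext v
    simp [kb]
    ring
  have hCK : LocallyLipschitzOn W (Kb : Euc m → ℝ) := by
    have : ContDiff ℝ 1 (Kb : Euc m → ℝ) := by
      unfold Kb
      refine contDiff_const.sub ?_
      have hc : ContDiff ℝ 1 (cut 0 1) := by
        rw [contDiff_one_iff_deriv]
        refine ⟨fun s => (hasDerivAt_cut 0 1 s).differentiableAt, ?_⟩
        rw [show deriv (cut 0 1) = cut' 0 1 from funext fun s => (hasDerivAt_cut 0 1 s).deriv]
        exact continuous_cut' _ _
      exact hc.comp (contDiff_norm_sq ℝ)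
    exact (this.locallyLipschitz).locallyLipschitzOn
  obtain ⟨_, _, h⟩ := div_ibp hW (isCompact_closedBall _ _) hS hd hCK hV
    ((kb_continuous.neg.smul continuous_id).continuousOn) (fun x _ hx => Kb_zero hx)
  rw [← setIntegral_eq_of_subset_of_forall_sdiff_eq_zero hW.measurableSet hS (fun x hx => by
      simp [Kb_zero hx.2]),
    ← setIntegral_eq_of_subset_of_forall_sdiff_eq_zero hW.measurableSet hS (fun x hx => by
      simp [kb_zero hx.2]), h, ← integral_neg]
  refine setIntegral_congr_fun hW.measurableSet fun x _ => ?_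
  simp [inner_neg_left, real_inner_smul_left]

lemma Kb_int_pos : 0 < ∫ y in closedBall (0 : Euc m) 1, Kb y := by
  refine (setIntegral_pos_iff_support_of_nonneg_ae (Eventually.of_forall fun y => Kb_nonneg y)
    (Kb_continuous.continuousOn.integrableOn_compact (isCompact_closedBall _ _))).2 ?_
  have ho : IsOpen (Function.support (Kb : Euc m → ℝ) ∩ ball 0 1) :=
    (Kb_continuous.isOpen_support).inter isOpen_ball
  refine lt_of_lt_of_le (ho.measure_pos volume ⟨0, ?_, by simp⟩)
    (measure_mono (inter_subset_inter_right _ ball_subset_closedBall))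
  simp [Kb, cut_zero (show (0:ℝ) < 1 by norm_num) le_rfl]

lemma Kb_le_kb (hm : 1 ≤ m) : ∫ y in closedBall (0 : Euc m) 1, Kb y ≤
    ∫ y in closedBall (0 : Euc m) 1, kb y := by
  have h := bump_ibp (m := m) isOpen_univ (subset_univ _) (V := id)
    (LipschitzWith.id.locallyLipschitz.locallyLipschitzOn)
  have hD : ∀ y : Euc m, Dv (fderiv ℝ id y) = m := by
    intro y; rw [fderiv_id]; simp [Dv]
  simp only [hD, id] at h
  have hKi : IntegrableOn (Kb : Euc m → ℝ) (closedBall 0 1) :=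
    Kb_continuous.continuousOn.integrableOn_compact (isCompact_closedBall _ _)
  calc _ ≤ ∫ y in closedBall (0 : Euc m) 1, Kb y * m := by
        refine setIntegral_mono hKi (hKi.mul_const _) fun y => ?_
        have := Kb_nonneg y
        have hm' : (1:ℝ) ≤ m := by exact_mod_cast hm
        show Kb y ≤ Kb y * m
        nlinarith
    _ = _ := h
    _ ≤ _ := by
        refine setIntegral_mono_on ((kb_continuous.mul (continuous_id.inner continuous_id)).continuousOn.integrableOn_compact
          (isCompact_closedBall _ _)) (kb_continuous.continuousOn.integrableOn_compact
          (isCompact_closedBall _ _)) measurableSet_closedBall fun y hy => ?_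
        have h1 : ‖y‖ ≤ 1 := by simpa using hy
        have := kb_nonneg y
        show kb y * ⟪y, y⟫ ≤ kb y
        rw [real_inner_self_eq_norm_sq]
        have : ‖y‖ ^ 2 ≤ 1 := pow_le_one₀ (norm_nonneg _) h1
        nlinarith

variable {Ω : Set (Euc m)} {u : Euc m → ℝ} {g : Euc m → Euc m} {B : Euc m → Euc m →L[ℝ] Euc m}
  {lam : ℝ}

lemma locLip_affine {W : Set (Euc m)} (hW : IsOpen W) {g : Euc m → Euc m}
    (hg : LocallyLipschitzOn W g) (x : Euc m) (s : ℝ) :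
    LocallyLipschitzOn {y | x + s • y ∈ W} (fun y => g (x + s • y)) := by
  intro y hy
  obtain ⟨K, t, ht, hK⟩ := hg hy
  have hc : Continuous fun y : Euc m => x + s • y := by fun_prop
  have hL : LipschitzWith ‖s‖₊ fun y : Euc m => x + s • y := by
    refine LipschitzWith.of_dist_le_mul fun a b => ?_
    rw [dist_add_left, dist_smul₀]; simp
  refine ⟨K * ‖s‖₊, (fun y => x + s • y) ⁻¹' t, ?_, hK.comp hL.lipschitzOnWith fun a ha => ha⟩
  have : t ∈ 𝓝 (x + s • y) := by rwa [hW.nhdsWithin_eq hy] at ht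
  exact mem_nhdsWithin_of_mem_nhds (hc.continuousAt this)

/-- derivative of the radial averages -/
lemma avg_deriv (hu : Eig Ω u g B lam) {x : Euc m} {R : ℝ}
    (hb : closedBall x R ⊆ Ω) {s : ℝ} (hs : |s| < R) :
    HasDerivAt (fun s => ∫ y in closedBall (0 : Euc m) 1, u (x + s • y) * kb y)
      (-(s * lam) * ∫ y in closedBall (0 : Euc m) 1, Kb y * u (x + s • y)) s := by
  have hR : 0 < R := lt_of_le_of_lt (abs_nonneg s) hs
  have hmem : ∀ t, |t| < R → ∀ y ∈ closedBall (0 : Euc m) 1, x + t • y ∈ closedBall x R := by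
    intro t ht y hy
    rw [mem_closedBall_zero_iff] at hy
    rw [mem_closedBall, dist_eq_norm, add_sub_cancel_left, norm_smul, Real.norm_eq_abs]
    nlinarith [norm_nonneg y, abs_nonneg t]
  have huc := hu.continuousOn_u.mono hb
  have hgc := hu.continuousOn_g.mono hb
  obtain ⟨G, hG⟩ := (isCompact_closedBall x R).exists_bound_of_continuousOn hgc
  have haff : ∀ t : ℝ, Continuous fun y : Euc m => x + t • y := fun t => by fun_prop
  have cu : ∀ t, |t| < R → ContinuousOn (fun y : Euc m => u (x + t • y)) (closedBall 0 1) :=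
    fun t ht => huc.comp (haff t).continuousOn (hmem t ht)
  have cg : ∀ t, |t| < R → ContinuousOn (fun y : Euc m => g (x + t • y)) (closedBall 0 1) :=
    fun t ht => hgc.comp (haff t).continuousOn (hmem t ht)
  have hms := measurableSet_closedBall (x := (0 : Euc m)) (ε := 1)
  have hcpt := isCompact_closedBall (0 : Euc m) 1
  have hopen : {t : ℝ | |t| < R} ∈ 𝓝 s := (isOpen_lt continuous_abs continuous_const).mem_nhds hs
  have key := (hasDerivAt_integral_of_dominated_loc_of_deriv_le
    (μ := volume.restrict (closedBall (0 : Euc m) 1)) (s := {t : ℝ | |t| < R})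
    (F := fun t y => u (x + t • y) * kb y) (F' := fun t y => ⟪g (x + t • y), y⟫ * kb y)
    (bound := fun _ => |G| * (2 * C0)) hopen
    (by
      filter_upwards [hopen] with t ht
      exact ((cu t ht).mul kb_continuous.continuousOn).aestronglyMeasurable hms)
    (((cu s hs).mul kb_continuous.continuousOn).integrableOn_compact hcpt)
    ((((cg s hs).inner (𝕜 := ℝ) continuousOn_id).mul kb_continuous.continuousOn).aestronglyMeasurable hms)
    (by
      refine (ae_restrict_iff' hms).2 (Eventually.of_forall fun y hy t ht => ?_)
      have h1 : |⟪g (x + t • y), y⟫| ≤ |G| := by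
        refine (abs_real_inner_le_norm _ _).trans ?_
        have h2 := (hG _ (hmem t ht y hy)).trans (le_abs_self G)
        have h3 : ‖y‖ ≤ 1 := by simpa using hy
        nlinarith [norm_nonneg y, norm_nonneg (g (x + t • y))]
      rw [Real.norm_eq_abs, abs_mul, abs_of_nonneg (kb_nonneg y)]
      exact mul_le_mul h1 (kb_le y) (kb_nonneg y) (abs_nonneg G))
    (integrableOn_const (isCompact_closedBall _ _).measure_lt_top.ne)
    (by
      refine (ae_restrict_iff' hms).2 (Eventually.of_forall fun y hy t ht => ?_)
      have h1 : HasDerivAt (fun t : ℝ => x + t • y) y t := by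
        simpa using ((hasDerivAt_id t).smul_const y).const_add x
      have h2 := (hu.du _ (hb (hmem t ht y hy))).comp_hasDerivAt t h1
      exact (h2.congr_deriv (by simp)).mul_const (kb y))).2
  refine key.congr_deriv ?_
  have hWo : IsOpen {y : Euc m | x + s • y ∈ Ω} := hu.op.preimage (haff s)
  have ib := bump_ibp hWo (fun y hy => hb (hmem s hs y hy)) (locLip_affine hu.op hu.gL x s)
  have e1 : ∫ y in closedBall (0 : Euc m) 1, ⟪g (x + s • y), y⟫ * kb y =
      ∫ y in closedBall (0 : Euc m) 1, kb y * ⟪y, g (x + s • y)⟫ := by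
    refine setIntegral_congr_fun hms fun y _ => ?_
    show _ * _ = _ * _
    rw [real_inner_comm, mul_comm]
  rw [e1, ← ib, ← integral_const_mul]
  refine setIntegral_congr_fun hms fun y hy => ?_
  have hd : HasFDerivAt (fun y : Euc m => g (x + s • y))
      ((B (x + s • y)).comp (s • ContinuousLinearMap.id ℝ (Euc m))) y := by
    have h1 : HasFDerivAt (fun y : Euc m => x + s • y) (s • ContinuousLinearMap.id ℝ (Euc m)) y :=
      ((hasFDerivAt_id y).const_smul s).const_add x
    exact (hu.dg _ (hb (hmem s hs y hy))).comp y h1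
  show Kb y * _ = _
  rw [hd.fderiv, ContinuousLinearMap.comp_smul, ContinuousLinearMap.comp_id, Dv_smul,
    hu.tr _ (hb (hmem s hs y hy))]
  ring

open scoped Pointwise in
/-- a point where `u` is large carries mass around it -/
lemma mean_mass (hm : 1 ≤ m) : ∃ c > 0, ∀ (Ω : Set (Euc m)) (u : Euc m → ℝ) (g : Euc m → Euc m)
    (B : Euc m → Euc m →L[ℝ] Euc m) (lam : ℝ) (x : Euc m) (r : ℝ), Eig Ω u g B lam → 0 ≤ lam →
    0 < r → closedBall x (2 * r) ⊆ Ω → (∀ x ∈ Ω, |u x| ≤ 1) → lam * r ^ 2 ≤ 1 / 4 →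
    3 / 4 ≤ u x → c * r ^ m ≤ ∫ y in closedBall x r, u y ^ 2 := by
  set k0 := ∫ y in closedBall (0 : Euc m) 1, kb y with hk0
  have hk0p : 0 < k0 := lt_of_lt_of_le Kb_int_pos (Kb_le_kb hm)
  have hC0 := C0_pos
  refine ⟨k0 / 4 / (2 * C0), by positivity, fun Ω u g B lam x r hu hlam hr hb hu1 hlr hux => ?_⟩
  have hcpt := isCompact_closedBall (0 : Euc m) 1
  have hms := measurableSet_closedBall (x := (0 : Euc m)) (ε := 1)
  have hmem : ∀ t, |t| ≤ 2 * r → ∀ y ∈ closedBall (0 : Euc m) 1, x + t • y ∈ closedBall x (2 * r) := by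
    intro t ht y hy
    rw [mem_closedBall_zero_iff] at hy
    rw [mem_closedBall, dist_eq_norm, add_sub_cancel_left, norm_smul, Real.norm_eq_abs]
    nlinarith [norm_nonneg y, abs_nonneg t]
  have haff : ∀ t : ℝ, Continuous fun y : Euc m => x + t • y := fun t => by fun_prop
  have cu : ∀ t, |t| ≤ 2 * r → ContinuousOn (fun y : Euc m => u (x + t • y)) (closedBall 0 1) :=
    fun t ht => (hu.continuousOn_u.mono hb).comp (haff t).continuousOn (hmem t ht)
  have hKi : IntegrableOn (Kb : Euc m → ℝ) (closedBall 0 1) :=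
    Kb_continuous.continuousOn.integrableOn_compact hcpt
  have hki : IntegrableOn (kb : Euc m → ℝ) (closedBall 0 1) :=
    kb_continuous.continuousOn.integrableOn_compact hcpt
  set A : ℝ → ℝ := fun s => ∫ y in closedBall (0 : Euc m) 1, u (x + s • y) * kb y with hA
  have hA0 : A 0 = u x * k0 := by
    simp only [hA, zero_smul, add_zero]
    rw [integral_const_mul]
  have hbound : ∀ s ∈ Icc 0 r, ‖-(s * lam) * ∫ y in closedBall (0 : Euc m) 1, Kb y * u (x + s • y)‖ ≤
      r * lam * k0 := by
    intro s hs
    have hsr : |s| ≤ 2 * r := by rw [abs_of_nonneg hs.1]; linarith [hs.2]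
    have h1 : ‖∫ y in closedBall (0 : Euc m) 1, Kb y * u (x + s • y)‖ ≤ k0 := by
      refine (norm_integral_le_integral_norm _).trans (le_trans ?_ (Kb_le_kb hm))
      refine setIntegral_mono_on
        ((Kb_continuous.continuousOn.mul (cu s hsr)).norm.integrableOn_compact hcpt) hKi hms
        fun y hy => ?_
      rw [norm_mul, Real.norm_of_nonneg (Kb_nonneg y), Real.norm_eq_abs]
      have := hu1 _ (hb (hmem s hsr y hy))
      nlinarith [Kb_nonneg y]
    rw [norm_mul, norm_neg, norm_mul, Real.norm_of_nonneg hs.1, Real.norm_of_nonneg hlam]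
    have := hs.2
    gcongr
  have hmv := Convex.norm_image_sub_le_of_norm_hasDerivWithin_le (f := A) (s := Icc 0 r)
    (x := 0) (y := r) (fun s hs => (avg_deriv hu hb (s := s) (by
      rw [abs_of_nonneg hs.1]; linarith [hs.2])).hasDerivWithinAt) hbound (convex_Icc 0 r)
    ⟨le_rfl, hr.le⟩ ⟨hr.le, le_rfl⟩
  rw [hA0, sub_zero, Real.norm_eq_abs, Real.norm_of_nonneg hr.le] at hmv
  have hAr : k0 / 2 ≤ A r := by
    have h1 := (abs_le.1 hmv).1
    have h2 : r * lam * k0 * r = lam * r ^ 2 * k0 := by ring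
    rw [h2] at h1
    nlinarith [mul_le_mul_of_nonneg_right hlr hk0p.le, mul_le_mul_of_nonneg_right hux hk0p.le]
  have hrr : |r| ≤ 2 * r := by rw [abs_of_pos hr]; linarith
  have cur := cu r hrr
  have hi2 : IntegrableOn (fun y : Euc m => u (x + r • y) ^ 2) (closedBall 0 1) :=
    (cur.pow 2).integrableOn_compact hcpt
  have hAle : A r ≤ k0 / 4 + 2 * C0 * ∫ y in closedBall (0 : Euc m) 1, u (x + r • y) ^ 2 := by
    have e : k0 / 4 + 2 * C0 * ∫ y in closedBall (0 : Euc m) 1, u (x + r • y) ^ 2 =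
        ∫ y in closedBall (0 : Euc m) 1, (kb y * (1 / 4) + 2 * C0 * u (x + r • y) ^ 2) := by
      rw [integral_add (hki.mul_const _) (hi2.const_mul _), integral_mul_const, integral_const_mul]
      ring
    rw [e]
    refine setIntegral_mono_on ((cur.mul kb_continuous.continuousOn).integrableOn_compact hcpt)
      ((hki.mul_const _).add (hi2.const_mul _)) hms fun y hy => ?_
    set a := u (x + r • y)
    have h1 : a ≤ 1 / 4 + a ^ 2 := by nlinarith [sq_nonneg (a - 1 / 2)]
    have h2 := kb_nonneg y
    have h3 := kb_le y
    nlinarith [sq_nonneg a]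
  have hsc := Measure.setIntegral_comp_smul_of_pos (volume : Measure (Euc m))
    (fun z => u (x + z) ^ 2) (closedBall 0 1) hr
  have htr : ∫ z in r • closedBall (0 : Euc m) 1, u (x + z) ^ 2 = ∫ y in closedBall x r, u y ^ 2 := by
    rw [_root_.smul_closedBall _ _ zero_le_one, smul_zero, Real.norm_of_nonneg hr.le, mul_one,
      ← (measurePreserving_add_left volume x).setIntegral_preimage_emb
        (measurableEmbedding_addLeft x) (fun y => u y ^ 2) (closedBall x r)]
    congr 2
    ext z; simp
  rw [htr, finrank_euclideanSpace_fin, smul_eq_mul] at hsc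
  rw [hsc] at hAle
  have hrm : 0 < r ^ m := by positivity
  have h5 : k0 / 4 ≤ 2 * C0 * ((r ^ m)⁻¹ * ∫ y in closedBall x r, u y ^ 2) := by linarith
  rw [div_mul_eq_mul_div, div_le_iff₀ (by positivity)]
  calc k0 / 4 * r ^ m ≤ 2 * C0 * ((r ^ m)⁻¹ * ∫ y in closedBall x r, u y ^ 2) * r ^ m := by gcongr
    _ = _ := by field_simp

end meanvalue

section barrier

variable {m : ℕ}

lemma second_deriv_nonneg {f f' : ℝ → ℝ} {c : ℝ} (h1 : ∀ᶠ t in 𝓝 (0:ℝ), HasDerivAt f (f' t) t)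
    (h2 : HasDerivAt f' c 0) (hmin : IsLocalMin f 0) : 0 ≤ c := by
  by_contra hc
  push Not at hc
  have e1 : deriv f =ᶠ[𝓝 0] f' := h1.mono fun t ht => ht.deriv
  have e2 : deriv (deriv f) 0 = c := by rw [e1.deriv_eq, h2.deriv]
  have e3 : deriv f 0 = 0 := hmin.deriv_eq_zero
  have hmax : IsLocalMax f 0 := isLocalMax_of_deriv_deriv_neg (by rw [e2]; exact hc) e3
    h1.self_of_nhds.continuousAt
  have hconst : f =ᶠ[𝓝 0] fun _ => f 0 := by
    filter_upwards [hmin, hmax] with t a b using le_antisymm b a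
  have : deriv f =ᶠ[𝓝 0] fun _ => 0 := by
    have := hconst.deriv
    simpa using this
  rw [this.deriv_eq] at e2
  simp at e2
  linarith

lemma trace_nonneg_of_min {F : Euc m → ℝ} {G : Euc m → Euc m} {H : Euc m →L[ℝ] Euc m} {x : Euc m}
    (h1 : ∀ᶠ y in 𝓝 x, HasFDerivAt F (innerSL ℝ (G y)) y) (h2 : HasFDerivAt G H x)
    (hmin : IsLocalMin F x) : 0 ≤ Dv H := by
  refine Finset.sum_nonneg fun i _ => ?_
  set e : Euc m := EuclideanSpace.single i 1 with he
  have hl : ∀ t : ℝ, HasDerivAt (fun t : ℝ => x + t • e) e t := fun t => by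
    simpa using ((hasDerivAt_id t).smul_const e).const_add x
  have hl0 : Tendsto (fun t : ℝ => x + t • e) (𝓝 0) (𝓝 x) := by
    have := (hl 0).continuousAt.tendsto
    simpa using this
  refine second_deriv_nonneg (f := fun t => F (x + t • e)) (f' := fun t => ⟪G (x + t • e), e⟫) ?_ ?_ ?_
  · filter_upwards [hl0.eventually h1] with t ht
    exact (ht.comp_hasDerivAt t (hl t)).congr_deriv (by simp)
  · have h3 : HasFDerivAt G H (x + (0:ℝ) • e) := by simpa using h2
    have h4 := (h3.comp_hasDerivAt (0:ℝ) (hl 0)).inner ℝ (hasDerivAt_const (0:ℝ) e)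
    refine h4.congr_deriv ?_
    simp [he, EuclideanSpace.inner_single_right]
  · have : ∀ᶠ t in 𝓝 (0:ℝ), F x ≤ F (x + t • e) := hl0.eventually hmin
    simpa [IsLocalMin, IsMinFilter] using this

/-- the barrier -/
def ph (a : ℝ) (z y : Euc m) : ℝ := Real.exp (-(a * ‖y - z‖ ^ 2))

lemma ph_deriv (a : ℝ) (z y : Euc m) :
    HasFDerivAt (ph a z) (innerSL ℝ ((-(2 * a) * ph a z y) • (y - z))) y := by
  have h0 : HasFDerivAt (fun y : Euc m => y - z) (ContinuousLinearMap.id ℝ (Euc m)) y :=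
    (hasFDerivAt_id y).sub_const z
  have h1 := (((h0.norm_sq).const_mul a).neg).exp
  refine h1.congr_fderiv ?_
  ext v
  simp [ph]
  ring

lemma ph_deriv2 (a : ℝ) (z y : Euc m) :
    ∃ H : Euc m →L[ℝ] Euc m, HasFDerivAt (fun y => (-(2 * a) * ph a z y) • (y - z)) H y ∧
      Dv H = ph a z y * (4 * a ^ 2 * ‖y - z‖ ^ 2 - 2 * a * m) := by
  have h0 : HasFDerivAt (fun y : Euc m => y - z) (ContinuousLinearMap.id ℝ (Euc m)) y :=
    (hasFDerivAt_id y).sub_const z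
  refine ⟨_, ((ph_deriv a z y).const_mul (-(2 * a))).smul h0, ?_⟩
  rw [Dv_add, Dv_smul, Dv_smulRight]
  have : Dv (ContinuousLinearMap.id ℝ (Euc m)) = m := by simp [Dv]
  rw [this]
  simp only [ContinuousLinearMap.smul_apply, innerSL_apply_apply, real_inner_smul_left,
    real_inner_self_eq_norm_sq, smul_eq_mul]
  ring

variable {Ω : Set (Euc m)} {R : ℝ} {nu : Euc m → Euc m}
variable {u : Euc m → ℝ} {g : Euc m → Euc m} {B : Euc m → Euc m →L[ℝ] Euc m} {lam : ℝ}

lemma TB.inner_pos (h : TB Ω R nu) {x z : Euc m} {s : ℝ} (hx : x ∈ frontier Ω) (hs : 0 < s)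
    (hsR : s ≤ R / 8) (hz : s ≤ dd Ω z) (hxz : ‖x - z‖ ≤ 2 * s) : ⟪nu x, x - z⟫ < 0 := by
  have hzΩ : z ∈ Ω := h.dd_pos_iff.1 (hs.trans_le hz)
  have h1 := h.le_out hx hzΩ
  have hR := h.Rpos
  have h2 : (s + R) ^ 2 ≤ ‖(z - x) + R • nu x‖ ^ 2 := by
    refine pow_le_pow_left₀ (by positivity) ?_ 2
    rw [dist_eq_norm] at h1
    rw [show z - x + R • nu x = z - (x - R • nu x) by abel]
    linarith
  rw [norm_add_sq_real, norm_smul, h.unit x hx, mul_one, real_inner_smul_right, norm_sub_rev,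
    Real.norm_eq_abs, sq_abs] at h2
  have h3 : ‖x - z‖ ^ 2 ≤ (2 * s) ^ 2 := pow_le_pow_left₀ (norm_nonneg _) hxz 2
  have h4 : ⟪nu x, x - z⟫ = -⟪z - x, nu x⟫ := by
    rw [real_inner_comm, ← inner_neg_left]; simp
  rw [h4]
  have : 0 < 2 * (R * ⟪z - x, nu x⟫) := by nlinarith
  have : 0 < ⟪z - x, nu x⟫ := by
    by_contra hcon
    push Not at hcon
    nlinarith
  linarith

set_option maxHeartbeats 2000000 in
lemma barrier (h : TB Ω R nu) (hu : Eig Ω u g B lam) (hlam : 0 ≤ lam)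
    (hc : ContinuousOn u (closure Ω)) (hu1 : ∀ x ∈ closure Ω, u x ≤ 1)
    (hN : ∀ x ∈ frontier Ω, ∃ L : Euc m →L[ℝ] ℝ, HasFDerivWithinAt u L (closure Ω) x ∧ L (nu x) = 0)
    {x₀ : Euc m} (hx₀ : x₀ ∈ closure Ω) (hux₀ : u x₀ = 1) {s : ℝ} (hs : 0 < s) (hsR : s ≤ R / 8)
    (hls : lam * s ^ 2 < Real.exp (-(4 * (2 * m + 1))) / 4) :
    ∃ x₁, 3 / 4 ≤ u x₁ ∧ s / 2 ≤ dd Ω x₁ := by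
  by_cases hd : s / 2 ≤ dd Ω x₀
  · exact ⟨x₀, by rw [hux₀]; norm_num, hd⟩
  push Not at hd
  have hR := h.Rpos
  obtain ⟨p, hp, hxp⟩ : ∃ p ∈ frontier Ω, x₀ = p + dd Ω x₀ • nu p := by
    by_cases hxΩ : x₀ ∈ Ω
    · exact ⟨npt Ω x₀, (h.npt_spec hxΩ).1, h.eq_npt hxΩ⟩
    · have : x₀ ∈ frontier Ω := by rw [h.op.frontier_eq]; exact ⟨hx₀, hxΩ⟩
      exact ⟨x₀, this, by rw [h.dd_frontier this]; simp⟩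
  set d := dd Ω x₀ with hdd
  have hd0 : 0 ≤ d := dd_nonneg _
  set z := p + s • nu p with hz
  have hzd : s ≤ dd Ω z := by
    have := h.le_inn z hp
    rw [hz, dist_eq_norm, show p + s • nu p - (p + R • nu p) = (s - R) • nu p by module, norm_smul,
      h.unit p hp, mul_one, Real.norm_eq_abs, abs_of_neg (by linarith)] at this
    linarith
  have hx0z : ‖x₀ - z‖ = s - d := by
    rw [hxp, hz, show p + d • nu p - (p + s • nu p) = (d - s) • nu p by module, norm_smul,
      h.unit p hp, mul_one, Real.norm_eq_abs, abs_of_neg (by linarith)]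
    ring
  by_contra hcon
  push Not at hcon
  -- `w > 1/4` on the inner ball
  have hw : ∀ x, ‖x - z‖ ≤ s / 2 → u x < 3 / 4 := by
    intro x hx
    by_contra h34
    push Not at h34
    have := hcon x h34
    have h2 := dd_le_add (Ω := Ω) z x
    rw [dist_comm, dist_eq_norm] at h2
    linarith
  set α : ℝ := 2 * m + 1 with hα
  have hα1 : 1 ≤ α := by rw [hα]; linarith [(Nat.cast_nonneg m : (0:ℝ) ≤ m)]
  set a := α / s ^ 2 with ha
  have ha0 : 0 < a := by positivity
  have has : a * s ^ 2 = α := by rw [ha]; field_simp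
  set e0 := Real.exp (-(4 * α)) with he0
  have he0p : 0 < e0 := Real.exp_pos _
  set F : Euc m → ℝ := fun y => 1 - u y - 1 / 4 * (ph a z y - e0) with hF
  set A := {x ∈ closure Ω | s / 2 ≤ ‖x - z‖ ∧ ‖x - z‖ ≤ 2 * s} with hA
  have hAc : IsCompact A := by
    refine (h.bdd.isCompact_closure).inter_right ?_
    have hcn : Continuous fun x : Euc m => ‖x - z‖ := by fun_prop
    exact (isClosed_le continuous_const hcn).inter (isClosed_le hcn continuous_const)
  have hphc : Continuous (ph a z) :=
    continuous_iff_continuousAt.2 fun y => (ph_deriv a z y).continuousAt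
  have hFc : ContinuousOn F A := by
    refine ContinuousOn.sub (continuousOn_const.sub (hc.mono fun x hx => hx.1)) ?_
    exact (continuous_const.mul (hphc.sub continuous_const)).continuousOn
  have hx0A : x₀ ∈ A := ⟨hx₀, by rw [hx0z]; linarith, by rw [hx0z]; linarith⟩
  obtain ⟨x, hxA, hmin⟩ := hAc.exists_isMinOn ⟨x₀, hx0A⟩ hFc
  have hFx0 : F x₀ < 0 := by
    have : e0 < ph a z x₀ := by
      rw [he0, ph]
      refine Real.exp_lt_exp.2 ?_
      rw [hx0z]
      have h1 : (s - d) ^ 2 ≤ s ^ 2 := pow_le_pow_left₀ (by linarith) (by linarith) 2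
      have h2 : a * (s - d) ^ 2 ≤ a * s ^ 2 := by gcongr
      linarith
    simp only [hF]
    rw [hux₀]
    linarith
  have hFx : F x < 0 := lt_of_le_of_lt (hmin hx0A) hFx0
  obtain ⟨hxΩ, hx1, hx2⟩ := hxA
  -- not on the inner sphere
  have hx1' : s / 2 < ‖x - z‖ := by
    refine lt_of_le_of_ne hx1 fun heq => ?_
    have h1 := hw x heq.symm.le
    have h2 : ph a z x ≤ 1 := by
      rw [ph]; exact Real.exp_le_one_iff.2 (by have : 0 ≤ a * ‖x - z‖ ^ 2 := by positivity
                                               linarith)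
    simp only [hF] at hFx
    linarith
  have hx2' : ‖x - z‖ < 2 * s := by
    refine lt_of_le_of_ne hx2 fun heq => ?_
    have h1 : ph a z x = e0 := by
      rw [ph, heq, he0]; congr 1; rw [← has]; ring
    have h2 := hu1 x hxΩ
    simp only [hF] at hFx
    rw [h1] at hFx
    linarith
  have hphp : 0 < ph a z x := Real.exp_pos _
  have hnear : ∀ᶠ y in 𝓝 x, s / 2 ≤ ‖y - z‖ ∧ ‖y - z‖ ≤ 2 * s := by
    have c1 : ContinuousAt (fun y : Euc m => ‖y - z‖) x := by fun_prop
    filter_upwards [c1.eventually_const_lt hx1', c1.eventually_lt_const hx2'] with y a b using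
      ⟨a.le, b.le⟩
  by_cases hxin : x ∈ Ω
  · -- interior minimum
    have hloc : IsLocalMin F x := by
      filter_upwards [hnear, h.op.mem_nhds hxin] with y hy hyΩ
      exact hmin ⟨subset_closure hyΩ, hy⟩
    obtain ⟨H, hH1, hH2⟩ := ph_deriv2 a z x
    have t := trace_nonneg_of_min (F := F)
      (G := fun y => -g y - (1 / 4 : ℝ) • ((-(2 * a) * ph a z y) • (y - z)))
      (H := -B x - (1 / 4 : ℝ) • H) ?_ ?_ hloc
    · rw [Dv_sub, Dv_smul, hH2, show -B x = (-1 : ℝ) • B x by ext v; simp, Dv_smul, hu.tr x hxin] at t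
      have hux := hu1 x hxΩ
      have e1 : e0 ≤ ph a z x := by
        rw [he0, ph]
        refine Real.exp_le_exp.2 ?_
        have h1 : ‖x - z‖ ^ 2 ≤ (2 * s) ^ 2 := pow_le_pow_left₀ (norm_nonneg _) hx2 2
        have h2 : a * ‖x - z‖ ^ 2 ≤ a * (2 * s) ^ 2 := by gcongr
        nlinarith
      have e2 : a ≤ 4 * a ^ 2 * ‖x - z‖ ^ 2 - 2 * a * m := by
        have h1 : (s / 2) ^ 2 ≤ ‖x - z‖ ^ 2 := pow_le_pow_left₀ (by positivity) hx1 2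
        have h2 : 4 * a ^ 2 * (s / 2) ^ 2 ≤ 4 * a ^ 2 * ‖x - z‖ ^ 2 := by gcongr
        have h3 : 4 * a ^ 2 * (s / 2) ^ 2 = a * α := by rw [← has]; ring
        rw [hα] at h3
        nlinarith
      have e3 : e0 * a ≤ ph a z x * (4 * a ^ 2 * ‖x - z‖ ^ 2 - 2 * a * m) := by
        gcongr
      have e4 : lam < 1 / 4 * (e0 * a) := by
        have h1 : lam * s ^ 2 < 1 / 4 * (e0 * a) * s ^ 2 := by
          have : 1 / 4 * (e0 * a) * s ^ 2 = 1 / 4 * e0 * α := by rw [← has]; ring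
          rw [this]
          have : e0 / 4 ≤ 1 / 4 * e0 * α := by nlinarith
          linarith
        exact lt_of_mul_lt_mul_right h1 (by positivity)
      have e5 : lam * u x ≤ lam := by nlinarith
      linarith
    · filter_upwards [h.op.mem_nhds hxin] with y hy
      have := ((hu.du y hy).const_sub 1).sub (((ph_deriv a z y).sub_const e0).const_mul (1 / 4))
      refine this.congr_fderiv ?_
      ext v
      simp [inner_sub_left, inner_smul_left, inner_neg_left]
    · exact ((hu.dg x hxin).neg).sub (hH1.const_smul (1 / 4 : ℝ))
  · -- boundary minimum
    have hxf : x ∈ frontier Ω := by rw [h.op.frontier_eq]; exact ⟨hxΩ, hxin⟩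
    obtain ⟨L, hL, hL0⟩ := hN x hxf
    have hFd : HasFDerivWithinAt F (-L - (1 / 4 : ℝ) • innerSL ℝ ((-(2 * a) * ph a z x) • (x - z)))
        (closure Ω) x :=
      (hL.const_sub 1).sub
        ((((ph_deriv a z x).sub_const e0).const_mul (1 / 4)).hasFDerivWithinAt)
    have hloc : IsLocalMinOn F (closure Ω) x := by
      have : ∀ᶠ y in 𝓝[closure Ω] x, s / 2 ≤ ‖y - z‖ ∧ ‖y - z‖ ≤ 2 * s :=
        mem_nhdsWithin_of_mem_nhds hnear
      filter_upwards [this, self_mem_nhdsWithin] with y hy hyΩ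
      exact hmin ⟨hyΩ, hy⟩
    have hcone : nu x ∈ posTangentConeAt (closure Ω) x := by
      refine mem_posTangentConeAt_of_frequently_mem (Eventually.frequently ?_)
      filter_upwards [Ioo_mem_nhdsGT hR] with t ht
      refine subset_closure (h.inn x hxf ?_)
      rw [mem_ball, dist_eq_norm, show x + t • nu x - (x + R • nu x) = (t - R) • nu x by module,
        norm_smul, h.unit x hxf, mul_one, Real.norm_eq_abs, abs_of_neg (by linarith [ht.2])]
      linarith [ht.1]
    have h1 := hloc.hasFDerivWithinAt_nonneg hFd hcone
    simp only [ContinuousLinearMap.sub_apply, ContinuousLinearMap.neg_apply, hL0,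
      ContinuousLinearMap.smul_apply, innerSL_apply_apply, real_inner_smul_left, smul_eq_mul] at h1
    have h2 := h.inner_pos hxf hs hsR hzd hx2
    rw [real_inner_comm] at h2
    have h3 : 0 < 2 * a * ph a z x := by positivity
    nlinarith

end barrier

section mkdata

variable {m : ℕ} {Ω : Set (Euc m)} {R lam : ℝ} {u : Euc m → ℝ} {nu : Euc m → Euc m}
  {g : Euc m → Euc m} {B : Euc m → Euc m →L[ℝ] Euc m}

lemma sum_single (v : Euc m) : v = ∑ i : Fin m, v i • EuclideanSpace.single i (1 : ℝ) := by
  ext j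
  simp [Finset.sum_apply, Pi.single_apply]

/-- the vector representing a linear form. -/
def vecOf (L : Euc m →L[ℝ] ℝ) : Euc m :=
  ∑ i : Fin m, (L (EuclideanSpace.single i 1)) • EuclideanSpace.single i (1 : ℝ)

lemma inner_vecOf (L : Euc m →L[ℝ] ℝ) (v : Euc m) : ⟪vecOf L, v⟫ = L v := by
  conv_rhs => rw [sum_single v]
  simp [vecOf, sum_inner, inner_smul_left, EuclideanSpace.inner_single_left, mul_comm]

lemma innerSL_vecOf (L : Euc m →L[ℝ] ℝ) : innerSL ℝ (vecOf L) = L := by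
  ext v
  exact inner_vecOf L v

lemma norm_vecOf_le (L : Euc m →L[ℝ] ℝ) : ‖vecOf L‖ ≤ ‖L‖ := by
  have h := innerSL_apply_norm (𝕜 := ℝ) (vecOf L)
  rw [innerSL_vecOf] at h
  exact h.symm.le

/-- second derivative, as an endomorphism. -/
def hessOf (u : Euc m → ℝ) (x : Euc m) : Euc m →L[ℝ] Euc m :=
  ∑ i : Fin m, (fderiv ℝ (fun y => fderiv ℝ u y (EuclideanSpace.single i 1)) x).smulRight
    (EuclideanSpace.single i (1 : ℝ))

lemma mk_Eig (ho : IsOpen Ω) (h2 : ContDiffOn ℝ 2 u Ω)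
    (hl : ∀ x ∈ Ω, laplacian u x + lam * u x = 0) :
    Eig Ω u (fun x => vecOf (fderiv ℝ u x)) (hessOf u) lam := by
  have hA : ∀ x ∈ Ω, ContDiffAt ℝ 2 u x := fun x hx => h2.contDiffAt (ho.mem_nhds hx)
  have hB : ∀ x ∈ Ω, ContDiffAt ℝ 1 (fderiv ℝ u) x := fun x hx =>
    (hA x hx).fderiv_right (by norm_num)
  have hC : ∀ x ∈ Ω, ∀ v, ContDiffAt ℝ 1 (fun y => fderiv ℝ u y v) x := fun x hx v =>
    (hB x hx).clm_apply contDiffAt_const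
  have hg : ∀ x ∈ Ω, ContDiffAt ℝ 1 (fun x => vecOf (fderiv ℝ u x)) x := by
    intro x hx
    unfold vecOf
    exact ContDiffAt.sum fun i _ => (hC x hx _).smul contDiffAt_const
  refine ⟨ho, ?_, ?_, ?_, ?_, ?_, ?_⟩
  · intro x hx
    rw [innerSL_vecOf]
    exact ((hA x hx).differentiableAt (by norm_num)).hasFDerivAt
  · intro x hx
    unfold vecOf hessOf
    refine HasFDerivAt.fun_sum fun i _ => ?_
    exact ((hC x hx _).differentiableAt (by norm_num)).hasFDerivAt.smul_const _
  · intro x hx v w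
    have key : ∀ v w, ⟪hessOf u x v, w⟫ = fderiv ℝ (fderiv ℝ u) x v w := by
      intro v w
      conv_rhs => rw [sum_single w]
      have e : ∀ i : Fin m, fderiv ℝ (fun y => fderiv ℝ u y (EuclideanSpace.single i 1)) x v
          = fderiv ℝ (fderiv ℝ u) x v (EuclideanSpace.single i 1) := by
        intro i
        rw [fderiv_clm_apply ((hB x hx).differentiableAt (by norm_num)) (by fun_prop)]
        simp
      simp [hessOf, sum_inner, inner_smul_left, EuclideanSpace.inner_single_left, mul_comm, e]
    rw [key, real_inner_comm, key]
    exact ((hA x hx).isSymmSndFDerivAt (by simp)) v w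
  · intro x hx
    have h1 := hl x hx
    have : Dv (hessOf u x) = laplacian u x := by
      have hs : ∀ (s : Finset (Fin m)) (f : Fin m → Euc m →L[ℝ] Euc m),
          Dv (∑ i ∈ s, f i) = ∑ i ∈ s, Dv (f i) := by
        intro s f
        simp only [Dv, ContinuousLinearMap.sum_apply]
        rw [Finset.sum_comm]
        simp
      unfold hessOf laplacian
      rw [hs]
      exact Finset.sum_congr rfl fun i _ => Dv_smulRight _ _
    linarith
  · intro x hx
    obtain ⟨K, t, ht, hK⟩ := ((hA x hx).of_le (by norm_num : (1 : WithTop ℕ∞) ≤ 2)).exists_lipschitzOnWith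
    exact ⟨K, t, mem_nhdsWithin_of_mem_nhds ht, hK⟩
  · intro x hx
    obtain ⟨K, t, ht, hK⟩ := (hg x hx).exists_lipschitzOnWith
    exact ⟨K, t, mem_nhdsWithin_of_mem_nhds ht, hK⟩

lemma Eig.neg (hu : Eig Ω u g B lam) :
    Eig Ω (fun x => -u x) (fun x => -g x) (fun x => (-1 : ℝ) • B x) lam := by
  refine ⟨hu.op, ?_, ?_, ?_, ?_, ?_, ?_⟩
  · intro x hx
    have := (hu.du x hx).neg
    refine this.congr_fderiv ?_
    ext v; simp
  · intro x hx
    have := (hu.dg x hx).neg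
    refine this.congr_fderiv ?_
    ext v; simp
  · intro x hx v w
    have := hu.symm x hx v w
    simp [this]
  · intro x hx
    rw [Dv_smul, hu.tr x hx]; ring
  · intro x hx
    obtain ⟨K, t, ht, hK⟩ := hu.uL hx
    exact ⟨K, t, ht, hK.neg⟩
  · intro x hx
    obtain ⟨K, t, ht, hK⟩ := hu.gL hx
    exact ⟨K, t, ht, hK.neg⟩

lemma NB.neg (hb : NB Ω nu u g) : NB Ω nu (fun x => -u x) (fun x => -g x) := by
  refine ⟨?_, ?_, ?_⟩
  · simpa using hb.neu
  · simpa using hb.gb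
  · simpa using hb.ub

lemma TB.uniqueDiff (h : TB Ω R nu) : UniqueDiffOn ℝ (closure Ω) := by
  intro x hx
  by_cases hxΩ : x ∈ Ω
  · exact uniqueDiffWithinAt_of_mem_nhds (mem_of_superset (h.op.mem_nhds hxΩ) subset_closure)
  have hxf : x ∈ frontier Ω := by rw [h.op.frontier_eq]; exact ⟨hx, hxΩ⟩
  have hR := h.Rpos
  have h1 : UniqueDiffWithinAt ℝ (ball (x + R • nu x) R) x := by
    refine uniqueDiffWithinAt_convex (convex_ball _ _) ?_ ?_
    · rw [isOpen_ball.interior_eq]; exact ⟨_, mem_ball_self hR⟩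
    · rw [closure_ball _ hR.ne', mem_closedBall, dist_eq_norm,
        show x - (x + R • nu x) = -(R • nu x) by abel, norm_neg, norm_smul, h.unit x hxf,
        Real.norm_eq_abs, abs_of_pos hR, mul_one]
  exact h1.mono ((h.inn x hxf).trans subset_closure)

lemma mk_NB (h : TB Ω R nu) (h1 : ContDiffOn ℝ 1 u (closure Ω))
    (hN : ∀ x ∈ frontier Ω, fderivWithin ℝ u (closure Ω) x (nu x) = 0)
    (ub : ∀ x ∈ Ω, |u x| ≤ 1) : NB Ω nu u (fun x => vecOf (fderiv ℝ u x)) := by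
  have hc : ContinuousOn (fderivWithin ℝ u (closure Ω)) (closure Ω) :=
    h1.continuousOn_fderivWithin h.uniqueDiff (by norm_num)
  have hK : IsCompact (closure Ω) := h.bdd.isCompact_closure
  have he : ∀ x ∈ Ω, fderivWithin ℝ u (closure Ω) x = fderiv ℝ u x := fun x hx =>
    fderivWithin_of_mem_nhds (mem_of_superset (h.op.mem_nhds hx) subset_closure)
  refine ⟨?_, ?_, ub⟩
  · intro ε hε
    have huc := hK.uniformContinuousOn_of_continuous hc
    obtain ⟨δ, hδ, H⟩ := Metric.uniformContinuousOn_iff_le.1 huc ε hε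
    refine ⟨δ, hδ, fun x hx hxd => ?_⟩
    have hp := h.npt_spec hx
    have hu1 : ‖NN Ω nu x‖ = 1 := h.unit_NN hx
    have h0 : fderivWithin ℝ u (closure Ω) (npt Ω x) (NN Ω nu x) = 0 := hN _ hp.1
    have hd : dist x (npt Ω x) ≤ δ := by
      rw [hp.2]; exact hxd.le
    have h2 := H x (subset_closure hx) (npt Ω x) (frontier_subset_closure hp.1) hd
    rw [real_inner_comm, inner_vecOf, ← he x hx]
    have h3 : fderivWithin ℝ u (closure Ω) x (NN Ω nu x) =
        (fderivWithin ℝ u (closure Ω) x - fderivWithin ℝ u (closure Ω) (npt Ω x)) (NN Ω nu x) := by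
      rw [ContinuousLinearMap.sub_apply, h0, sub_zero]
    rw [h3]
    have h4 := ContinuousLinearMap.le_opNorm
      (fderivWithin ℝ u (closure Ω) x - fderivWithin ℝ u (closure Ω) (npt Ω x)) (NN Ω nu x)
    rw [hu1, mul_one, ← dist_eq_norm] at h4
    exact h4.trans h2
  · obtain ⟨G, hG⟩ := hK.exists_bound_of_continuousOn hc
    refine ⟨G, fun x hx => (norm_vecOf_le _).trans ?_⟩
    rw [← he x hx]
    exact hG x (subset_closure hx)

end mkdata

section assembly

/-- Hypotheses on a normalised eigenfunction used in the final argument. -/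
structure NE {m : ℕ} (Ω : Set (Euc m)) (R : ℝ) (nu : Euc m → Euc m) (u : Euc m → ℝ)
    (g : Euc m → Euc m) (B : Euc m → Euc m →L[ℝ] Euc m) (lam : ℝ) : Prop where
  tb : TB Ω R nu
  eig : Eig Ω u g B lam
  lam0 : 0 ≤ lam
  nb : NB Ω nu u g
  cont : ContinuousOn u (closure Ω)
  le1 : ∀ x ∈ closure Ω, u x ≤ 1
  neum : ∀ x ∈ frontier Ω, ∃ L : Euc m →L[ℝ] ℝ, HasFDerivWithinAt u L (closure Ω) x ∧ L (nu x) = 0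
  att : ∃ x ∈ closure Ω, u x = 1

variable {m : ℕ}

lemma exp_lower {c L : ℝ} (hc : 0 < c) (hL : 1 ≤ L) : Real.exp (-(|Real.log c| * L)) ≤ c := by
  have h1 : -(|Real.log c| * L) ≤ Real.log c := by
    have := neg_abs_le (Real.log c)
    nlinarith [abs_nonneg (Real.log c)]
  calc Real.exp (-(|Real.log c| * L)) ≤ Real.exp (Real.log c) := Real.exp_le_exp.2 h1
    _ = c := Real.exp_log hc

lemma start_mass (hm : 1 ≤ m) {R : ℝ} (hR : 0 < R) : ∃ A : ℝ, ∀ (Ω : Set (Euc m))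
    (nu : Euc m → Euc m) (u : Euc m → ℝ) (g : Euc m → Euc m) (B : Euc m → Euc m →L[ℝ] Euc m)
    (lam : ℝ), NE Ω R nu u g B lam →
    Real.exp (-(A * (1 + √lam))) ≤ ∫ x in {x | dep m R ≤ dd Ω x}, u x ^ 2 := by
  obtain ⟨A, hA⟩ := bdry_mass m hR
  obtain ⟨c, hc, hmean⟩ := mean_mass hm
  set κ := min (R / 8) (Real.exp (-(2 * (2 * m + 1))) / 4) with hκ
  have hκ0 : 0 < κ := lt_min (by positivity) (by positivity)
  have hκR : κ ≤ R / 8 := min_le_left _ _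
  have hκe : κ ≤ Real.exp (-(2 * (2 * m + 1))) / 4 := min_le_right _ _
  set c0 := c * (κ / 8) ^ m with hc0
  have hc0p : 0 < c0 := by positivity
  refine ⟨A + m + |Real.log c0|, fun Ω nu u g B lam h => ?_⟩
  set q := √lam with hq
  have hq0 : 0 ≤ q := Real.sqrt_nonneg _
  have hqq : q ^ 2 = lam := Real.sq_sqrt h.lam0
  set s := κ / (1 + q) with hs
  have hs0 : 0 < s := by positivity
  have hsκ : s ≤ κ := div_le_self hκ0.le (by linarith)
  have hls : lam * s ^ 2 < Real.exp (-(4 * (2 * m + 1))) / 4 := by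
    have e1 : q * s ≤ κ := by
      rw [hs, mul_div_assoc', div_le_iff₀ (by positivity)]
      nlinarith
    have e2 : (q * s) ^ 2 ≤ (Real.exp (-(2 * (2 * m + 1))) / 4) ^ 2 :=
      pow_le_pow_left₀ (by positivity) (e1.trans hκe) 2
    have e3 : (Real.exp (-(2 * (2 * m + 1)))) ^ 2 = Real.exp (-(4 * (2 * (m:ℝ) + 1))) := by
      rw [← Real.exp_nat_mul]; congr 1; push_cast; ring
    rw [mul_pow, hqq, div_pow _ (4 : ℝ), e3] at e2
    have := Real.exp_pos (-(4 * (2 * (m:ℝ) + 1)))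
    linarith
  obtain ⟨x₀, hx₀, hux₀⟩ := h.att
  obtain ⟨x₁, hx1, hd1⟩ := barrier h.tb h.eig h.lam0 h.cont h.le1 h.neum hx₀ hux₀ hs0
    (hsκ.trans hκR) hls
  have hle1 : Real.exp (-(4 * (2 * (m:ℝ) + 1))) ≤ 1 :=
    Real.exp_le_one_iff.2 (by have := Nat.cast_nonneg (α := ℝ) m; linarith)
  have hM := hmean Ω u g B lam x₁ (s / 8) h.eig h.lam0 (by positivity)
    ((closedBall_subset_ball (by linarith)).trans (h.tb.ball_dd_subset x₁)) h.nb.ub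
    (by nlinarith) hx1
  have hcomp := h.tb.core_compact (s / 4) (by positivity)
  have hsub := h.tb.core_subset (a := s / 4) (by positivity)
  have hintg : IntegrableOn (fun x => u x ^ 2) {x | s / 4 ≤ dd Ω x} :=
    ((h.eig.continuousOn_u.mono hsub).pow 2).integrableOn_compact hcomp
  have hI : ∫ y in closedBall x₁ (s / 8), u y ^ 2 ≤ ∫ x in {x | s / 4 ≤ dd Ω x}, u x ^ 2 := by
    refine setIntegral_mono_set hintg (Eventually.of_forall fun x => sq_nonneg _) ?_
    refine HasSubset.Subset.eventuallyLE fun y hy => ?_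
    rw [mem_closedBall, dist_comm] at hy
    have := dd_le_add (Ω := Ω) x₁ y
    show s / 4 ≤ dd Ω y
    linarith
  have hB := hA Ω nu u g B lam h.tb h.eig h.lam0 h.nb (s / 4) (by positivity)
  set J := ∫ x in {x | dep m R ≤ dd Ω x}, u x ^ 2 with hJ
  have h1 : c * (s / 8) ^ m ≤ Real.exp (A * (1 + q)) * J := hM.trans (hI.trans hB)
  have h2 : c0 * Real.exp (-(m * (1 + q))) ≤ c * (s / 8) ^ m := by
    have e1 : 1 + q ≤ Real.exp (1 + q) := by linarith [Real.add_one_le_exp (1 + q)]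
    have e2 : c * (s / 8) ^ m = c0 * ((1 + q)⁻¹) ^ m := by
      rw [hc0, hs, mul_assoc, ← mul_pow]; congr 2; field_simp
    rw [e2, neg_mul_eq_mul_neg, Real.exp_nat_mul, Real.exp_neg]
    gcongr
  have h3 := exp_lower hc0p (show 1 ≤ 1 + q by linarith)
  have h4 : Real.exp (-(|Real.log c0| * (1 + q))) * Real.exp (-(m * (1 + q))) ≤
      Real.exp (A * (1 + q)) * J := by
    refine le_trans ?_ (h2.trans h1)
    gcongr
  have h5 : Real.exp (-((A + m + |Real.log c0|) * (1 + q))) = Real.exp (-(A * (1 + q))) *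
      (Real.exp (-(|Real.log c0| * (1 + q))) * Real.exp (-(m * (1 + q)))) := by
    rw [← Real.exp_add, ← Real.exp_add]; congr 1; ring
  rw [h5]
  calc _ ≤ Real.exp (-(A * (1 + q))) * (Real.exp (A * (1 + q)) * J) := by gcongr
    _ = J := by rw [← mul_assoc, ← Real.exp_add]; simp

/-- Pigeonhole: one small ball of a finite cover carries a good part of the mass. -/
lemma pigeon {S : Set (Euc m)} (hS : MeasurableSet S) {f : Euc m → ℝ} (hf : IntegrableOn f S)
    (h0 : ∀ x, 0 ≤ f x) (T : Finset (Euc m)) {δ : ℝ}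
    (hT : ∀ x ∈ S, ∃ t ∈ T, x ∈ closedBall t δ) (hT0 : 0 < ∫ x in S, f x) :
    ∃ t ∈ T, (∫ x in S, f x) / T.card ≤ ∫ x in S ∩ closedBall t δ, f x := by
  by_contra hcon
  push Not at hcon
  have hintg : ∀ t ∈ T, IntegrableOn ((closedBall t δ).indicator f) S := fun t _ =>
    hf.indicator measurableSet_closedBall
  have h1 : ∫ x in S, f x ≤ ∫ x in S, ∑ t ∈ T, (closedBall t δ).indicator f x := by
    refine setIntegral_mono_on hf (integrable_finset_sum T hintg) hS fun x hx => ?_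
    obtain ⟨t, ht, hxt⟩ := hT x hx
    have : (closedBall t δ).indicator f x ≤ ∑ t ∈ T, (closedBall t δ).indicator f x :=
      Finset.single_le_sum (f := fun t => (closedBall t δ).indicator f x)
        (fun t _ => indicator_nonneg (fun x _ => h0 x) x) ht
    rwa [indicator_of_mem hxt] at this
  rw [integral_finset_sum T hintg] at h1
  simp_rw [setIntegral_indicator measurableSet_closedBall] at h1
  have hne : T.Nonempty := by
    rw [Finset.nonempty_iff_ne_empty]
    rintro rfl
    simp at h1
    linarith
  have h2 := Finset.sum_lt_sum_of_nonempty hne hcon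
  rw [Finset.sum_const, nsmul_eq_mul, mul_div_cancel₀ _ (by
    simpa using hne.ne_empty)] at h2
  linarith

lemma core_point (hm : 1 ≤ m) {R : ℝ} (hR : 0 < R) (D : ℝ) {t : ℝ} (ht : 0 < t) :
    ∃ A : ℝ, ∀ (Ω : Set (Euc m))
    (nu : Euc m → Euc m) (u : Euc m → ℝ) (g : Euc m → Euc m) (B : Euc m → Euc m →L[ℝ] Euc m)
    (lam : ℝ), NE Ω R nu u g B lam → IsPreconnected Ω → (∀ x ∈ Ω, ∀ y ∈ Ω, dist x y ≤ D) →
    ∀ y ∈ closure Ω, ∃ x ∈ Ω, dist x y < t ∧ Real.exp (-(A * (1 + √lam))) ≤ |u x| := by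
  obtain ⟨A1, hA1⟩ := start_mass hm hR
  have hdep := dep_pos m hR
  set b := min (dep m R) (min (R / 4) (t / 4)) with hb
  have hb0 : 0 < b := lt_min hdep (lt_min (by positivity) (by positivity))
  have hb1 : b ≤ dep m R := min_le_left _ _
  have hb2 : b ≤ R / 4 := (min_le_right _ _).trans (min_le_left _ _)
  have hb3 : b ≤ t / 4 := (min_le_right _ _).trans (min_le_right _ _)
  set ρ := b / 4 with hρ
  have hρ0 : 0 < ρ := by positivity
  have hσ : 0 < sg m ρ := sg_pos hρ0
  have hσρ := sg_le (m := m) hρ0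
  set σ := sg m ρ
  obtain ⟨T0, -, hTf, hTc⟩ := (isCompact_closedBall (0 : Euc m) D).finite_cover_balls
    (show 0 < ρ / 2 by positivity)
  set T := hTf.toFinset with hTdef
  set N : ℝ := T.card + 1 with hN
  have hN0 : 0 < N := by positivity
  obtain ⟨A3, hA3⟩ := chain_mass m hρ0 D (A1 + |Real.log N⁻¹|)
  set V := (volume.real (closedBall (0 : Euc m) (ρ + 4 * σ))) + 1 with hV
  have hV0 : 0 < V := by positivity
  refine ⟨A3 + |Real.log V⁻¹|, fun Ω nu u g B lam h hcon hD y hy => ?_⟩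
  set q := √lam with hq
  have hq0 : 0 ≤ q := Real.sqrt_nonneg _
  have huc := h.eig.continuousOn_u
  have hball : ∀ z, b ≤ dd Ω z → closedBall z (2 * ρ) ⊆ Ω := fun z hz =>
    (closedBall_subset_ball (by linarith)).trans (h.tb.ball_dd_subset z)
  set S := {x | dep m R ≤ dd Ω x} with hSdef
  have hSc : IsCompact S := h.tb.core_compact _ hdep
  have hSs : S ⊆ Ω := h.tb.core_subset hdep
  have hSi : IntegrableOn (fun x => u x ^ 2) S := ((huc.mono hSs).pow 2).integrableOn_compact hSc
  have hJ := hA1 Ω nu u g B lam h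
  set J := ∫ x in S, u x ^ 2 with hJdef
  have hJ0 : 0 < J := lt_of_lt_of_le (Real.exp_pos _) hJ
  have hSne : S.Nonempty := by
    by_contra hcon
    rw [not_nonempty_iff_eq_empty] at hcon
    rw [hJdef, hcon] at hJ0
    simp at hJ0
  obtain ⟨w, hw⟩ := hSne
  classical
  obtain ⟨p, hp, hpm⟩ := pigeon hSc.measurableSet hSi (fun x => sq_nonneg _)
    (T.image fun v => w + v) (δ := ρ / 2) (by
      intro x hx
      have h1 : x - w ∈ closedBall (0 : Euc m) D := by
        rw [mem_closedBall_zero_iff, ← dist_eq_norm]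
        exact hD x (hSs hx) w (hSs hw)
      obtain ⟨v, hv, hxv⟩ := mem_iUnion₂.1 (hTc h1)
      refine ⟨w + v, Finset.mem_image_of_mem _ (hTf.mem_toFinset.2 hv), ?_⟩
      rw [mem_closedBall, dist_eq_norm, ← sub_sub, ← dist_eq_norm]
      exact (mem_ball.1 hxv).le) hJ0
  have hcard : ((T.image fun v => w + v).card : ℝ) ≤ N := by
    have : (T.image fun v => w + v).card ≤ T.card := Finset.card_image_le
    have : ((T.image fun v => w + v).card : ℝ) ≤ T.card := by exact_mod_cast this
    linarith
  have hcard0 : 0 < ((T.image fun v => w + v).card : ℝ) := by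
    exact_mod_cast Finset.card_pos.2 ⟨p, hp⟩
  have hpm' : J / N ≤ ∫ x in S ∩ closedBall p (ρ / 2), u x ^ 2 :=
    le_trans (div_le_div_of_nonneg_left hJ0.le hcard0 hcard) hpm
  have hne : (S ∩ closedBall p (ρ / 2)).Nonempty := by
    by_contra hcon
    rw [not_nonempty_iff_eq_empty] at hcon
    rw [hcon] at hpm'
    simp at hpm'
    have : 0 < J / N := by positivity
    linarith
  obtain ⟨z, hzS, hzp⟩ := hne
  have hzE : b ≤ dd Ω z := hb1.trans hzS
  have hri : ∀ z, b ≤ dd Ω z → closedBall z (ρ + 4 * σ) ⊆ Ω := fun z hz =>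
    (closedBall_subset_closedBall (by linarith)).trans (hball z hz)
  have hzi : IntegrableOn (fun x => u x ^ 2) (closedBall z (ρ + 4 * σ)) :=
    ((huc.mono (hri z hzE)).pow 2).integrableOn_compact (isCompact_closedBall _ _)
  have hz1 : J / N ≤ ∫ x in closedBall z (ρ + 4 * σ), u x ^ 2 := by
    refine hpm'.trans (setIntegral_mono_set hzi (Eventually.of_forall fun x => sq_nonneg _) ?_)
    refine HasSubset.Subset.eventuallyLE fun y hy => ?_
    have h1 := mem_closedBall.1 hy.2
    have h2 := mem_closedBall'.1 hzp
    have h3 := dist_triangle y p z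
    rw [mem_closedBall]
    linarith
  have hz2 : Real.exp (-((A1 + |Real.log N⁻¹|) * (1 + q))) ≤ J / N := by
    have h3 := exp_lower (inv_pos.2 hN0) (show 1 ≤ 1 + q by linarith)
    rw [show -((A1 + |Real.log N⁻¹|) * (1 + q)) = -(A1 * (1 + q)) + -(|Real.log N⁻¹| * (1 + q)) by
      ring, Real.exp_add, div_eq_mul_inv]
    gcongr
  -- target
  obtain ⟨y', hy', hyy⟩ := Metric.mem_closure_iff.1 hy (t / 4) (by positivity)
  set e := retr Ω nu b y' with he
  have heE : b ≤ dd Ω e := h.tb.le_dd_retr hy' (by linarith)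
  have hey : dist e y' ≤ b := h.tb.dist_retr hy' hb0.le
  have hm3 := hA3 Ω u g B lam {x | b ≤ dd Ω x} h.eig h.lam0 h.nb.ub
    (h.tb.isPreconnected_core hcon hb0 (by linarith)) hball
    (fun x hx y hy => hD x (h.tb.core_subset hb0 hx) y (h.tb.core_subset hb0 hy)) z hzE
    (hz2.trans hz1) e heE
  by_contra hno
  push Not at hno
  set η := Real.exp (-((A3 + |Real.log V⁻¹|) * (1 + q))) with hη
  have hη0 : 0 < η := Real.exp_pos _
  have hsmall : ∀ x ∈ closedBall e (ρ + 4 * σ), u x ^ 2 ≤ η := by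
    intro x hx
    have hxΩ := hri e heE hx
    have h1 := mem_closedBall.1 hx
    have h2 := dist_triangle4 x e y' y
    rw [dist_comm y' y] at h2
    have h3 := hno x hxΩ (by linarith)
    have h4 := h.nb.ub x hxΩ
    rw [← sq_abs]
    nlinarith [abs_nonneg (u x)]
  have hmle : ∫ x in closedBall e (ρ + 4 * σ), u x ^ 2 ≤ η * volume.real (closedBall e (ρ + 4 * σ)) := by
    have hzi : IntegrableOn (fun x => u x ^ 2) (closedBall e (ρ + 4 * σ)) :=
      ((huc.mono (hri e heE)).pow 2).integrableOn_compact (isCompact_closedBall _ _)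
    have := setIntegral_mono_on hzi (integrableOn_const (C := η)
      (isCompact_closedBall e (ρ + 4 * σ)).measure_lt_top.ne) measurableSet_closedBall hsmall
    rw [setIntegral_const, smul_eq_mul, mul_comm _ η] at this
    exact this
  have hvol : volume.real (closedBall e (ρ + 4 * σ)) = volume.real (closedBall (0 : Euc m) (ρ + 4 * σ)) := by
    simp only [Measure.real]
    rw [Measure.addHaar_closedBall_center]
  rw [hvol] at hmle
  have h6 : η * V ≤ Real.exp (-(A3 * (1 + q))) := by
    have h3 := exp_lower (inv_pos.2 hV0) (show 1 ≤ 1 + q by linarith)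
    rw [hη, show -((A3 + |Real.log V⁻¹|) * (1 + q)) = -(A3 * (1 + q)) + -(|Real.log V⁻¹| * (1 + q)) by
      ring, Real.exp_add, mul_assoc]
    refine mul_le_of_le_one_right (Real.exp_pos _).le ?_
    calc _ ≤ V⁻¹ * V := by gcongr
      _ = 1 := inv_mul_cancel₀ hV0.ne'
  rw [hV] at h6
  nlinarith [hm3.trans hmle]

end assembly

lemma dist_snocVec {n : ℕ} (x y : Euc n) : dist (snocVec x 0) (snocVec y 0) = dist x y := by
  rw [EuclideanSpace.dist_eq, EuclideanSpace.dist_eq, Fin.sum_univ_castSucc]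
  simp [snocVec_castSucc, snocVec_last]

lemma hExt_snocVec {n : ℕ} (lam : ℝ) (u : Euc n → ℝ) (x : Euc n) : hExt lam u (snocVec x 0) = u x := by
  simp [hExt, front_snocVec, lastc_snocVec]

lemma abs_lastc_le {n : ℕ} (z : Euc (n + 1)) : |lastc z| ≤ ‖z‖ := by
  have := PiLp.norm_apply_le z (Fin.last n)
  rwa [Real.norm_eq_abs] at this

/-- Chain-of-balls lower bound for the harmonic extension: for
`C^{1,1}` character `(ρ, M)` and diameter bound `D` there is `r₀ > 0` such that
for every `0 < r < r₀/16` there are `c₁, C₂ > 0` (depending only on `n`, `r`,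
`D` and `(ρ, M)`) with: for every Neumann eigenfunction `u` normalized by
`max_{Ω̄₀} |u| = 1`, the extension `h(x,t) = e^{√λ t} u(x)` satisfies
`sup_{B((y,0),r/2) ∩ Ω} |h| ≥ c₁ e^{-C₂ √λ}` for every `y ∈ Ω̄₀`. -/
theorem chain_lower_bound_extension {n : ℕ} (ρ : ℝ) (M : ℝ≥0) (D : ℝ) :
    ∃ r₀ : ℝ, 0 < r₀ ∧ ∀ r : ℝ, 0 < r → r < r₀ / 16 →
      ∃ c₁ : ℝ, 0 < c₁ ∧ ∃ C₂ : ℝ, 0 < C₂ ∧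
      ∀ (Ω₀ : Set (Euc (n + 1))) (ν₀ : Euc (n + 1) → Euc (n + 1))
        (lam : ℝ) (u : Euc (n + 1) → ℝ),
        Bornology.IsBounded Ω₀ → IsC11DomainWith Ω₀ ρ M →
        Metric.diam Ω₀ ≤ D →
        OutwardNormalFieldOn Ω₀ ν₀ univ → 0 < lam →
        ContDiffOn ℝ 2 u Ω₀ → ContDiffOn ℝ 1 u (closure Ω₀) →
        (∀ x ∈ Ω₀, laplacian u x + lam * u x = 0) →
        NeumannBC Ω₀ ν₀ u univ →
        supOn (fun x => |u x|) (closure Ω₀) = 1 →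
        ∀ y ∈ closure Ω₀,
          c₁ * Real.exp (-(C₂ * Real.sqrt lam)) ≤
            supOn (fun z => |hExt lam u z|)
              (ball (snocVec y 0) (r / 2) ∩ prodDomain Ω₀) := by
  refine ⟨1, one_pos, fun r hr _ => ?_⟩
  by_cases hρ : 0 < ρ
  swap
  · exact ⟨1, one_pos, 1, one_pos, fun Ω₀ ν₀ lam u _ h => absurd h.2.2.1 hρ⟩
  obtain ⟨R, hR, hTB⟩ := exists_TB n ρ M hρ
  obtain ⟨A, hA⟩ := core_point (m := n + 1) (by omega) hR D (t := r / 2) (by positivity)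
  refine ⟨Real.exp (-|A|), Real.exp_pos _, |A| + 1, by positivity, ?_⟩
  intro Ω ν lam u hbd hC11 hdiam hν hlam hu2 hu1 hlap hneu hsup y hy
  have tb : TB Ω R (fun p => -ν p) := hTB Ω ν hbd hC11 hν
  have hK : IsCompact (closure Ω) := hbd.isCompact_closure
  have hcu : ContinuousOn u (closure Ω) := hu1.continuousOn
  obtain ⟨xm, hxm, hmax⟩ := hK.exists_isMaxOn ⟨y, hy⟩ hcu.abs
  have hgr : IsGreatest ((fun x => |u x|) '' closure Ω) |u xm| :=
    ⟨⟨xm, hxm, rfl⟩, by rintro _ ⟨x, hx, rfl⟩; exact hmax hx⟩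
  have hxm1 : |u xm| = 1 := by rw [← hsup, supOn, hgr.csSup_eq]
  have hle : ∀ x ∈ closure Ω, |u x| ≤ 1 := fun x hx => hxm1 ▸ hmax hx
  have eig := mk_Eig hC11.1 hu2 hlap
  have hN : ∀ x ∈ frontier Ω, fderivWithin ℝ u (closure Ω) x (-ν x) = 0 := by
    intro x hx
    rw [map_neg, (hneu x ⟨hx, mem_univ _⟩).2, neg_zero]
  have nb := mk_NB tb hu1 hN fun x hx => hle x (subset_closure hx)
  have hdist : ∀ x ∈ Ω, ∀ y ∈ Ω, dist x y ≤ D := fun x hx y hy =>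
    (dist_le_diam_of_mem hbd hx hy).trans hdiam
  have hN' : ∀ x ∈ frontier Ω, HasFDerivWithinAt u (fderivWithin ℝ u (closure Ω) x) (closure Ω) x :=
    fun x hx => (hneu x ⟨hx, mem_univ _⟩).1.hasFDerivWithinAt
  have key : ∃ x ∈ Ω, dist x y < r / 2 ∧ Real.exp (-(A * (1 + √lam))) ≤ |u x| := by
    rcases abs_eq (zero_le_one (α := ℝ)) |>.1 hxm1 with h1 | h1
    · refine hA Ω _ u _ _ lam ⟨tb, eig, hlam.le, nb, hcu, fun x hx => (le_abs_self _).trans (hle x hx),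
        fun x hx => ⟨_, hN' x hx, hN x hx⟩, ⟨xm, hxm, h1⟩⟩ hC11.2.1.isPreconnected hdist y hy
    · have := hA Ω _ (fun x => -u x) _ _ lam ⟨tb, eig.neg, hlam.le, nb.neg, hcu.neg,
        fun x hx => (neg_le_abs _).trans (hle x hx),
        fun x hx => ⟨-fderivWithin ℝ u (closure Ω) x, (hN' x hx).neg, by
          rw [ContinuousLinearMap.neg_apply, hN x hx, neg_zero]⟩, ⟨xm, hxm, by rw [h1, neg_neg]⟩⟩
        hC11.2.1.isPreconnected hdist y hy
      simpa only [abs_neg] using this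
  obtain ⟨x, hx, hxy, hux⟩ := key
  have hq0 : 0 ≤ √lam := Real.sqrt_nonneg _
  have hbdd : BddAbove ((fun z => |hExt lam u z|) '' (ball (snocVec y 0) (r / 2) ∩ prodDomain Ω)) := by
    refine ⟨Real.exp (√lam * (‖snocVec y 0‖ + r / 2)), ?_⟩
    rintro _ ⟨z, ⟨hz1, hz2⟩, rfl⟩
    have h1 : lastc z ≤ ‖snocVec y 0‖ + r / 2 := by
      have a1 := abs_lastc_le z
      have a2 := le_abs_self (lastc z)
      have a3 : ‖z‖ ≤ ‖snocVec y 0‖ + ‖z - snocVec y 0‖ := by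
        simpa using norm_add_le (snocVec y 0) (z - snocVec y 0)
      rw [mem_ball, dist_eq_norm] at hz1
      linarith
    have h2 : |u (front z)| ≤ 1 := hle _ (subset_closure hz2)
    simp only [hExt, abs_mul, Real.abs_exp]
    calc _ ≤ Real.exp (√lam * lastc z) * 1 := by gcongr
      _ ≤ _ := by rw [mul_one]; gcongr
  have hmem : |u x| ≤ supOn (fun z => |hExt lam u z|) (ball (snocVec y 0) (r / 2) ∩ prodDomain Ω) := by
    refine le_csSup hbdd ⟨snocVec x 0, ⟨?_, ?_⟩, ?_⟩
    · rw [mem_ball, dist_snocVec]; exact hxy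
    · show front (snocVec x 0) ∈ Ω
      rwa [front_snocVec]
    · simp only [hExt_snocVec]
  refine le_trans ?_ (hux.trans hmem)
  rw [← Real.exp_add]
  refine Real.exp_le_exp.2 ?_
  nlinarith [le_abs_self A]

end NodalNeumann
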